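/- arXiv:2004.12721 — 4 statements merged into one kernel-verified Lean document; each statement's English description precedes it below -/
import Mathlib

section
/- Let V₁, P, Q, V₂ be four distinct collinear points of ℝ², with P in the open segment from V₁ to Q and Q in the open segment from P to V₂. For the function F(a,b) = a + b (so that an interior F-chordal point is an equichordal point: all chords of c through it have the same length), there is at most one analytic solution of the interior F-chordal problem with equichordal points P, Q and vertices V₁, V₂: if K₁ and K₂ are two such solutions, then frontier K₁ = frontier K₂. -/
open Set

noncomputable section

/-- The Euclidean plane. -/
abbrev Plane := EuclideanSpace ℝ (Fin 2)

/-- `P` is an interior `F`-chordal point of the curve `c`. -/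
def IsChordalPoint (F : ℝ → ℝ → ℝ) (c : Set Plane) (P : Plane) : Prop :=
  ∃ k : ℝ, ∀ A B : Plane, A ∈ c → B ∈ c → P ∈ openSegment ℝ A B →
    F (dist A P) (dist B P) = k

/-- `c` is analytic: every point of `c` has a regular analytic local parametrization
whose image is a relatively open neighbourhood of the point in `c`. -/
def IsAnalyticBoundary (c : Set Plane) : Prop :=
  ∀ p ∈ c, ∃ ε : ℝ, 0 < ε ∧ ∃ γ : ℝ → Plane,
    AnalyticOnNhd ℝ γ (Ioo (-ε) ε) ∧ γ 0 = p ∧ deriv γ 0 ≠ 0 ∧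
    ∃ U : Set Plane, IsOpen U ∧ p ∈ U ∧ γ '' Ioo (-ε) ε = c ∩ U

/-- `K` is an analytic solution of the interior `F`-chordal problem with interior
`F`-chordal points `P, Q` and vertices `V₁, V₂`. -/
def IsAnalyticSolution (F : ℝ → ℝ → ℝ) (P Q V₁ V₂ : Plane) (K : Set Plane) : Prop :=
  IsCompact K ∧ Convex ℝ K ∧ (interior K).Nonempty ∧
  P ∈ interior K ∧ Q ∈ interior K ∧
  IsChordalPoint F (frontier K) P ∧ IsChordalPoint F (frontier K) Q ∧
  (affineSpan ℝ ({P, Q} : Set Plane) : Set Plane) ∩ frontier K = {V₁, V₂} ∧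
  IsAnalyticBoundary (frontier K)


def tau (k : ℝ) (P A : Plane) : Plane := A - (k / ‖A - P‖) • (A - P)

def Ec (e : Plane) (c : ℝ) : Plane →L[ℝ] Plane :=
  c • ContinuousLinearMap.id ℝ Plane + (1 - c) • (innerSL ℝ e).smulRight e

lemma Ec_apply (e : Plane) (c : ℝ) (v : Plane) :
    Ec e c v = c • v + ((1 - c) * inner ℝ e v) • e := by
  simp [Ec, smul_smul]

lemma Ec_comp (e : Plane) (he : ‖e‖ = 1) (c c' : ℝ) :
    (Ec e c).comp (Ec e c') = Ec e (c * c') := by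
  ext1 v
  have h : inner ℝ e e = (1 : ℝ) := by rw [real_inner_self_eq_norm_sq, he]; norm_num
  simp only [ContinuousLinearMap.comp_apply, Ec_apply, inner_add_right, inner_smul_right, h]
  module

lemma Ec_norm (e : Plane) (he : ‖e‖ = 1) (c : ℝ) (hc : 1 ≤ c) : ‖Ec e c‖ ≤ c := by
  refine ContinuousLinearMap.opNorm_le_bound _ (by linarith) fun v => ?_
  have h : inner ℝ e e = (1 : ℝ) := by rw [real_inner_self_eq_norm_sq, he]; norm_num
  refine abs_le_of_sq_le_sq' ?_ (by positivity) |>.2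
  rw [← real_inner_self_eq_norm_sq, Ec_apply, mul_pow, ← real_inner_self_eq_norm_sq v]
  simp only [inner_add_right, inner_add_left, inner_smul_right, inner_smul_left, h,
    real_inner_comm e v, RCLike.conj_to_real]
  nlinarith [mul_nonneg (by nlinarith : (0:ℝ) ≤ c^2 - 1) (sq_nonneg (inner ℝ e v : ℝ))]

lemma tau_strict (k : ℝ) (P e : Plane) (he : ‖e‖ = 1) (s r : ℝ) (hr : 0 < r) (hs : |s| = r) :
    HasStrictFDerivAt (tau k P) (Ec e (1 - k / r)) (P + s • e) := by
  have hs0 : s ≠ 0 := by rintro rfl; simp at hs; linarith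
  have hs2 : s ^ 2 = r ^ 2 := by rw [← hs, sq_abs]
  have hn : ‖P + s • e - P‖ = r := by
    rw [add_sub_cancel_left, norm_smul, he, Real.norm_eq_abs, hs, mul_one]
  have h1 : HasStrictFDerivAt (fun A : Plane => A - P) (ContinuousLinearMap.id ℝ Plane)
      (P + s • e) := (hasStrictFDerivAt_id _).sub_const P
  have h2 := (hasStrictFDerivAt_norm_sq (P + s • e - P)).comp (P + s • e) h1
  have h3 := h2.sqrt (by rw [hn]; positivity)
  have h4 := h3.congr_of_eventuallyEq (f₁ := fun A : Plane => ‖A - P‖)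
    (Filter.Eventually.of_forall fun A => Real.sqrt_sq (norm_nonneg _))
  have h5 := (HasStrictDerivAt.comp_hasStrictFDerivAt (P + s • e)
    (hasStrictDerivAt_inv (x := ‖P + s • e - P‖) (by rw [hn]; exact hr.ne')) h4).const_mul k
  have h6 := (hasStrictFDerivAt_id (P + s • e)).sub (h5.smul h1)
  refine (h6.congr_of_eventuallyEq (Filter.Eventually.of_forall fun A => ?_)).congr_fderiv ?_
  · simp [tau, div_eq_mul_inv]
  · ext1 v
    rw [Ec_apply]
    have hn' : ‖s • e‖ = r := by rw [norm_smul, he, Real.norm_eq_abs, hs, mul_one]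
    simp only [add_sub_cancel_left]
    simp only [hn', smul_smul, sub_smul, Real.sqrt_sq hr.le,
      _root_.sub_apply, _root_.add_apply, _root_.smul_apply,
      ContinuousLinearMap.smulRight_apply, ContinuousLinearMap.comp_apply,
      ContinuousLinearMap.id_apply, Function.comp, innerSL_apply_apply, inner_smul_left,
      RCLike.conj_to_real, add_sub_cancel_left, smul_eq_mul, one_smul, nsmul_eq_mul]
    rw [show ∀ x : ℝ, k * (-(r ^ 2)⁻¹ * (1 / (2 * r))) * (((2 : ℕ) : ℝ) * (s * x)) * s
      = - (k / r * x) from fun x => ?_]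
    · rw [div_eq_mul_inv]; module
    · push_cast
      field_simp; rw [hs2]

lemma tau_tau (k : ℝ) (P A : Plane) (hA : A ≠ P) (hk : ‖A - P‖ < k) :
    tau k P (tau k P A) = A := by
  have hr : 0 < ‖A - P‖ := norm_pos_iff.2 (sub_ne_zero.2 hA)
  set r := ‖A - P‖ with hrdef
  have h1 : tau k P A - P = (1 - k / r) • (A - P) := by
    simp only [tau, ← hrdef]; module
  have h2 : ‖tau k P A - P‖ = k - r := by
    rw [h1, norm_smul, ← hrdef, Real.norm_eq_abs, abs_of_neg]
    · field_simp; ring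
    · rw [sub_neg, one_lt_div hr]; exact hk
  have h3 : k - r ≠ 0 := by linarith
  have : tau k P (tau k P A) = P + ((1 - k / (k - r)) * (1 - k / r)) • (A - P) := by
    rw [tau, h2, ← smul_smul, ← h1]; module
  rw [this]
  have : (1 - k / (k - r)) * (1 - k / r) = 1 := by field_simp; ring
  rw [this]; module

lemma ray_unique {K : Set Plane} (hKc : IsCompact K) (hK : Convex ℝ K) {P A B : Plane}
    (hP : P ∈ interior K) (hA : A ∈ frontier K) (hB : B ∈ frontier K) (s : ℝ) (hs : 0 < s)
    (h : A - P = s • (B - P)) : A = B := by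
  have key : ∀ (A B : Plane) (s : ℝ), A ∈ frontier K → B ∈ frontier K → 0 < s →
      A - P = s • (B - P) → 1 ≤ s := by
    intro A B s hA hB hs h
    by_contra! hlt
    have h1 := hK.combo_interior_self_mem_interior hP (hKc.isClosed.frontier_subset hB)
      (sub_pos.2 hlt) hs.le (by ring)
    have h2 : (1 - s) • P + s • B = A := by
      have : A = P + s • (B - P) := by rw [← h]; abel
      rw [this]; module
    rw [h2] at h1
    exact hA.2 h1
  have h1 := key A B s hA hB hs h
  have h2 := key B A s⁻¹ hB hA (inv_pos.2 hs) (by rw [h, smul_smul, inv_mul_cancel₀ hs.ne', one_smul])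
  have h3 : s = 1 := le_antisymm ((one_le_inv₀ hs).1 h2) h1
  rw [h3, one_smul] at h
  exact sub_left_injective h

lemma tau_mem {K : Set Plane} (hKc : IsCompact K) {P : Plane}
    (hP : P ∈ interior K) (k : ℝ)
    (hk : ∀ A B : Plane, A ∈ frontier K → B ∈ frontier K → P ∈ openSegment ℝ A B →
      dist A P + dist B P = k) {A : Plane} (hA : A ∈ frontier K) :
    tau k P A ∈ frontier K ∧ A ≠ P ∧ ‖A - P‖ < k := by
  have hAP : A ≠ P := by rintro rfl; exact hA.2 hP
  have hr : 0 < ‖A - P‖ := norm_pos_iff.2 (sub_ne_zero.2 hAP)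
  obtain ⟨s, hs0, hs⟩ : ∃ s : ℝ, 0 ≤ s ∧ P - s • (A - P) ∈ frontier K := by
    by_contra! hcon
    have hpre : IsPreconnected ((fun s : ℝ => P - s • (A - P)) '' Ici 0) :=
      isPreconnected_Ici.image _ (by fun_prop)
    obtain ⟨R, hR⟩ := hKc.isBounded.subset_closedBall P
    have := hpre (interior K) Kᶜ isOpen_interior hKc.isClosed.isOpen_compl ?_ ?_ ?_
    · obtain ⟨x, _, hx1, hx2⟩ := this
      exact hx2 (interior_subset hx1)
    · rintro _ ⟨s, hs, rfl⟩
      by_contra hx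
      simp only [mem_union, not_or, mem_compl_iff, not_not] at hx
      exact hcon s hs ⟨subset_closure hx.2, hx.1⟩
    · exact ⟨P, ⟨0, by simp, by simp⟩, hP⟩
    · refine ⟨_, ⟨(|R| + 1) / ‖A - P‖, by simp; positivity, rfl⟩, fun hx => ?_⟩
      have := hR hx
      simp only [Metric.mem_closedBall, dist_eq_norm, sub_sub_cancel_left, norm_neg, norm_smul,
        norm_div, norm_norm] at this
      rw [div_mul_cancel₀ _ hr.ne', Real.norm_of_nonneg (by positivity)] at this
      linarith [le_abs_self R]
  have hs1 : 0 < s := by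
    refine lt_of_le_of_ne hs0 ?_
    rintro rfl
    simp at hs
    exact hs.2 hP
  have hseg : P ∈ openSegment ℝ A (P - s • (A - P)) := by
    refine ⟨s / (1 + s), 1 / (1 + s), by positivity, by positivity, by field_simp; ring, ?_⟩
    rw [← sub_eq_zero]
    have : (s / (1 + s)) • A + (1 / (1 + s)) • (P - s • (A - P)) - P
      = (s / (1 + s) - (1 / (1+s)) * s) • A + ((1 / (1 + s)) * (1 + s) - 1) • P := by module
    rw [this]
    have h1 : s / (1 + s) - (1 / (1+s)) * s = 0 := by ring
    have h2 : (1 / (1 + s)) * (1 + s) - 1 = 0 := by field_simp; ring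
    rw [h1, h2]; simp
  have hd := hk _ _ hA hs hseg
  simp only [dist_eq_norm, sub_sub_cancel_left, norm_neg, norm_smul, Real.norm_of_nonneg hs0] at hd
  refine ⟨?_, hAP, by nlinarith⟩
  have : tau k P A = P - s • (A - P) := by
    have h1 : k / ‖A - P‖ = 1 + s := by rw [← hd]; field_simp
    rw [tau, h1]; module
  rwa [this]

lemma exists_support {K : Set Plane} (hK : Convex ℝ K) {P V : Plane}
    (hP : P ∈ interior K) (hV : V ∈ frontier K) :
    ∃ φ : Plane →L[ℝ] ℝ, (∀ x ∈ K, φ V ≤ φ x) ∧ φ V < φ P := by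
  obtain ⟨φ, hφ⟩ := geometric_hahn_banach_point_open hK.interior isOpen_interior hV.2
  refine ⟨φ, fun x hx => ?_, hφ P hP⟩
  have h1 : x ∈ closure (interior K) := by
    rw [hK.closure_interior_eq_closure_of_nonempty_interior ⟨P, hP⟩]; exact subset_closure hx
  have h2 : closure (interior K) ⊆ {x | φ V ≤ φ x} :=
    closure_minimal (fun y hy => (hφ y hy).le) (isClosed_le continuous_const φ.continuous)
  exact h2 h1

def Je (e : Plane) : Plane := !₂[-e 1, e 0]

lemma Je_decomp (e : Plane) (he : ‖e‖ = 1) (v : Plane) :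
    v = (inner ℝ e v) • e + (inner ℝ (Je e) v) • Je e := by
  have h : (inner ℝ e e : ℝ) = 1 := by rw [real_inner_self_eq_norm_sq, he]; norm_num
  simp only [PiLp.inner_apply, Fin.sum_univ_two, RCLike.inner_apply, RCLike.conj_to_real] at h
  ext i
  fin_cases i <;> simp [Je, PiLp.inner_apply, Fin.sum_univ_two] <;> grind

lemma Je_norm (e : Plane) (he : ‖e‖ = 1) : ‖Je e‖ = 1 := by
  rw [← he]; simp [Je, EuclideanSpace.norm_eq, Fin.sum_univ_two, add_comm]

lemma prop_of (e : Plane) (he : ‖e‖ = 1) (u v : Plane) (s : ℝ)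
    (h1 : (inner ℝ e u : ℝ) = s * inner ℝ e v)
    (h2 : (inner ℝ (Je e) u : ℝ) = s * inner ℝ (Je e) v) : u = s • v := by
  rw [Je_decomp e he u, h1, h2]
  conv_rhs => rw [Je_decomp e he v]
  module

open Filter Topology in
lemma taylor2 {γ : ℝ → Plane} {V w : Plane} (ha : AnalyticAt ℝ γ 0) (h0 : γ 0 = V)
    (hw : HasDerivAt γ w 0) :
    ∃ C : ℝ, 0 ≤ C ∧ ∀ᶠ t in 𝓝 (0 : ℝ), ‖γ t - V - t • w‖ ≤ C * t ^ 2 := by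
  obtain ⟨p, hp⟩ := ha
  have h1 := hp.isBigO_sub_partialSum_pow 2
  obtain ⟨C, hC, hb⟩ := h1.exists_nonneg
  refine ⟨C, hC, ?_⟩
  rw [Asymptotics.isBigOWith_iff] at hb
  filter_upwards [hb] with t ht
  have hd : p 1 (fun _ => t) = t • w := by
    have h2 := hp.hasDerivAt.unique hw
    have h3 : (fun _ : Fin 1 => t) = fun _ => t • (1 : ℝ) := by simp
    have h4 := (p 1).map_smul_univ (fun _ : Fin 1 => t) (fun _ => (1:ℝ))
    rw [h3, h4, ← h2]; simp
  have h00 : p 0 (fun _ => t) = V := by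
    rw [← h0]; exact hp.coeff_zero _
  rw [FormalMultilinearSeries.partialSum, Finset.sum_range_succ, Finset.sum_range_one, hd, h00] at ht
  simpa [sub_sub] using ht

open Filter Topology in
lemma tangent {K : Set Plane} (hKc : IsCompact K) (hK : Convex ℝ K) {P V e : Plane}
    (hP : P ∈ interior K) (he : ‖e‖ = 1) (a : ℝ) (ha : 0 < a) (hVP : V = P + (-a) • e)
    (hV : V ∈ frontier K) (han : IsAnalyticBoundary (frontier K)) (S : Plane → Plane)
    (hSV : S V = V) (μ : ℝ) (hμ : μ ≠ 1) (hS : HasFDerivAt S (Ec e μ) V)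
    (hSc : ∀ A ∈ frontier K, S A ∈ frontier K) :
    (∃ C : ℝ, 0 ≤ C ∧ ∀ᶠ A in 𝓝 V, A ∈ frontier K → |inner ℝ e (A - V)| ≤ C * ‖A - V‖ ^ 2) ∧
    (∃ C : ℝ, 0 ≤ C ∧ ∀ᶠ y in 𝓝 (0 : ℝ), ∃ B ∈ frontier K,
      ‖B - (V + y • Je e)‖ ≤ C * y ^ 2) := by
  have hee : inner ℝ e e = (1 : ℝ) := by rw [real_inner_self_eq_norm_sq, he]; norm_num
  obtain ⟨ε, hε, γ, hγ, hγ0, hγd, U, hU, hVU, himg⟩ := han V hV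
  have hmem : ∀ᶠ t in 𝓝 (0 : ℝ), γ t ∈ frontier K := by
    filter_upwards [Ioo_mem_nhds (neg_lt_zero.2 hε) hε] with t ht
    have : γ t ∈ frontier K ∩ U := himg ▸ mem_image_of_mem γ ht
    exact this.1
  have hga : AnalyticAt ℝ γ 0 := hγ 0 ⟨by linarith, hε⟩
  set w := deriv γ 0 with hwdef
  have hw : HasDerivAt γ w 0 := hga.differentiableAt.hasDerivAt
  obtain ⟨φ, hφ, hφP⟩ := exists_support hK hP hV
  have hfs := hKc.isClosed.frontier_subset
  have h1 : φ w = 0 := by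
    refine IsLocalMin.hasDerivAt_eq_zero (f := fun t => φ (γ t)) (a := 0) ?_
      (φ.hasFDerivAt.comp_hasDerivAt 0 hw)
    filter_upwards [hmem] with t ht
    rw [hγ0]; exact hφ _ (hfs ht)
  have h2 : φ (Ec e μ w) = 0 := by
    have hS' : HasFDerivAt S (Ec e μ) (γ 0) := by rw [hγ0]; exact hS
    refine IsLocalMin.hasDerivAt_eq_zero (f := fun t => φ (S (γ t))) (a := 0) ?_
      (φ.hasFDerivAt.comp_hasDerivAt 0 (hS'.comp_hasDerivAt 0 hw))
    filter_upwards [hmem] with t ht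
    rw [hγ0, hSV]; exact hφ _ (hfs (hSc _ ht))
  have hφe : φ e ≠ 0 := by
    intro h
    rw [hVP] at hφP
    simp [h] at hφP
  have hwe : inner ℝ e w = (0 : ℝ) := by
    rw [Ec_apply] at h2
    simp only [map_add, map_smul, h1, smul_eq_mul, mul_zero, zero_add, mul_eq_zero, hφe, or_false]
      at h2
    rcases h2 with h2 | h2
    · exact absurd (by linarith) hμ
    · exact h2
  obtain ⟨ω, hω, hwω⟩ : ∃ ω : ℝ, ω ≠ 0 ∧ w = ω • Je e := by
    have := Je_decomp e he w
    rw [hwe, zero_smul, zero_add] at this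
    refine ⟨_, ?_, this⟩
    intro h
    rw [h, zero_smul] at this
    exact hγd this
  have hJJ : inner ℝ (Je e) (Je e) = (1 : ℝ) := by
    rw [real_inner_self_eq_norm_sq, Je_norm e he]; norm_num
  have hJe : inner ℝ (Je e) e = (0 : ℝ) := by
    simp [Je, PiLp.inner_apply, Fin.sum_univ_two]; ring
  have heJ : inner ℝ e (Je e) = (0 : ℝ) := by rw [real_inner_comm]; exact hJe
  obtain ⟨C, hC, hT⟩ := taylor2 hga hγ0 hw
  constructor
  · -- slope function around P
    have hden : inner ℝ e (V - P) = -a := by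
      rw [hVP]; simp [inner_smul_right, he]
    have hnum : inner ℝ (Je e) (V - P) = (0:ℝ) := by
      rw [hVP]; simp [inner_smul_right, hJe]
    set h : Plane → ℝ := fun A => inner ℝ (Je e) (A - P) / inner ℝ e (A - P) with hh
    have hstrict : HasStrictDerivAt γ w 0 := hga.hasStrictDerivAt
    have hi : ∀ v : Plane, HasStrictDerivAt (fun t => (inner ℝ v (γ t - P) : ℝ)) (inner ℝ v w) 0 := by
      intro v
      exact (innerSL ℝ v).hasStrictFDerivAt.comp_hasStrictDerivAt 0 (hstrict.sub_const P)
    have hd0 : (inner ℝ e (γ 0 - P) : ℝ) ≠ 0 := by rw [hγ0, hden]; linarith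
    have hhd := (hi (Je e)).div (hi e) hd0
    have hmap := hhd.map_nhds_eq (by
      rw [hγ0, hden, hnum, hwe, hwω, inner_smul_right, hJJ]
      field_simp; simp [hω, ha.ne'])
    have hcont : ContinuousAt h V := by
      refine ContinuousAt.div (by fun_prop) (by fun_prop) ?_
      rw [hden]; linarith
    have hgc : ContinuousAt γ 0 := hga.continuousAt
    -- good parameters
    have hgood : ∀ᶠ t in 𝓝 (0 : ℝ), γ t ∈ frontier K ∧ inner ℝ e (γ t - P) < (0:ℝ) ∧
        ‖γ t - V - t • w‖ ≤ C * t ^ 2 ∧ C * |t| ≤ |ω| / 2 := by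
      refine hmem.and (Eventually.and ?_ (hT.and ?_))
      · have : ContinuousAt (fun t => (inner ℝ e (γ t - P) : ℝ)) 0 := by fun_prop
        refine this.eventually_lt continuousAt_const ?_
        rw [hγ0, hden]; linarith
      · have : ContinuousAt (fun t : ℝ => C * |t|) 0 := by fun_prop
        refine (this.eventually_lt continuousAt_const ?_).mono fun t ht => ht.le
        simp; exact hω
    have himg2 : ∀ᶠ z in 𝓝 (h V), ∃ t, h (γ t) = z ∧ γ t ∈ frontier K ∧
        inner ℝ e (γ t - P) < (0:ℝ) ∧
        ‖γ t - V - t • w‖ ≤ C * t ^ 2 ∧ C * |t| ≤ |ω| / 2 := by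
      have := image_mem_map hgood (m := fun t => h (γ t))
      have hmap' : map (fun t => h (γ t)) (𝓝 0) = 𝓝 (h V) := by rw [← hγ0]; exact hmap
      rw [hmap'] at this
      filter_upwards [this] with z hz
      obtain ⟨t, ht, rfl⟩ := hz
      exact ⟨t, rfl, ht⟩
    have hcont2 : ContinuousAt (fun A : Plane => (inner ℝ e (A - P) : ℝ)) V := by fun_prop
    refine ⟨4 * C / ω ^ 2, by positivity, ?_⟩
    filter_upwards [hcont.eventually himg2, hcont2.eventually_lt continuousAt_const
      (show (inner ℝ e (V - P) : ℝ) < 0 by rw [hden]; linarith)] with A hA hAneg hAc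
    obtain ⟨t, ht, htc, htneg, htT, htC⟩ := hA
    have hAt : A = γ t := by
      refine ray_unique hKc hK hP hAc htc (inner ℝ e (A - P) / inner ℝ e (γ t - P))
        (div_pos_of_neg_of_neg hAneg htneg) ?_
      have e1 : (inner ℝ (Je e) (A - P) : ℝ) =
          inner ℝ e (A - P) / inner ℝ e (γ t - P) * inner ℝ (Je e) (γ t - P) := by
        simp only [hh] at ht
        have := hAneg.ne
        have := htneg.ne
        field_simp at ht ⊢
        linarith
      have e2 : (inner ℝ e (A - P) : ℝ) =
          inner ℝ e (A - P) / inner ℝ e (γ t - P) * inner ℝ e (γ t - P) := by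
        have := htneg.ne
        field_simp
      exact prop_of e he _ _ _ e2 e1
    rw [hAt]
    have e3 : |(inner ℝ e (γ t - V) : ℝ)| ≤ C * t ^ 2 := by
      have : (inner ℝ e (γ t - V) : ℝ) = inner ℝ e (γ t - V - t • w) := by
        rw [inner_sub_right _ _ (t • w), inner_smul_right, hwe]; ring
      rw [this]
      refine (abs_real_inner_le_norm _ _).trans ?_
      rw [he, one_mul]; exact htT
    have e4 : |t| * |ω| / 2 ≤ ‖γ t - V‖ := by
      have : ‖t • w‖ = |t| * |ω| := by
        rw [hwω, norm_smul, norm_smul, Je_norm e he]; simp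
      have h5 := norm_sub_norm_le (t • w) (t • w - (γ t - V))
      rw [sub_sub_cancel, norm_sub_rev (t • w), this] at h5
      have h6 : C * t ^ 2 = C * |t| * |t| := by rw [← sq_abs]; ring
      nlinarith [abs_nonneg t]
    have e5 : t ^ 2 * ω ^ 2 ≤ 4 * ‖γ t - V‖ ^ 2 := by
      have := pow_le_pow_left₀ (by positivity) e4 2
      rw [div_pow, mul_pow, sq_abs, sq_abs] at this
      linarith
    have hω2 : 0 < ω ^ 2 := by positivity
    calc _ ≤ C * t ^ 2 := e3
      _ = C / ω ^ 2 * (t ^ 2 * ω ^ 2) := by field_simp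
      _ ≤ C / ω ^ 2 * (4 * ‖γ t - V‖ ^ 2) := by gcongr
      _ = _ := by ring
  · refine ⟨C / ω ^ 2, by positivity, ?_⟩
    have hc : Tendsto (fun y : ℝ => y / ω) (𝓝 0) (𝓝 0) := by
      have : ContinuousAt (fun y : ℝ => y / ω) 0 := by fun_prop
      simpa [ContinuousAt] using this
    filter_upwards [hc.eventually (hmem.and hT)] with y hy
    refine ⟨γ (y / ω), hy.1, ?_⟩
    have := hy.2
    rw [hwω, smul_smul, div_mul_cancel₀ _ hω, sub_sub] at this
    refine this.trans (le_of_eq ?_)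
    field_simp

open Filter Topology in
lemma local_uniq {c₁ c₂ : Set Plane} (hc₂ : IsCompact c₂) {V e : Plane} (he : ‖e‖ = 1)
    (hV : V ∈ c₂) (T S : Plane → Plane) (l m : ℝ) (hl : 1 < l) (hlm : l * m = 1)
    (hSV : S V = V)
    (hT : HasStrictFDerivAt T (Ec e l) V) (hS : HasFDerivAt S (Ec e m) V)
    (hSc : ∀ A ∈ c₁, S A ∈ c₁) (hTc : ∀ A ∈ c₂, T A ∈ c₂) (hTS : ∀ A ∈ c₁, T (S A) = A)
    (h1 : ∃ C : ℝ, 0 ≤ C ∧ ∀ᶠ A in 𝓝 V, A ∈ c₁ → |inner ℝ e (A - V)| ≤ C * ‖A - V‖ ^ 2)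
    (h2 : ∃ C : ℝ, 0 ≤ C ∧ ∀ᶠ y in 𝓝 (0 : ℝ), ∃ B ∈ c₂, ‖B - (V + y • Je e)‖ ≤ C * y ^ 2) :
    ∀ᶠ A in 𝓝 V, A ∈ c₁ → A ∈ c₂ := by
  obtain ⟨C₁, hC₁, h1⟩ := h1
  obtain ⟨C₂, hC₂, h2⟩ := h2
  have hm : 0 < m := by
    by_contra! h; nlinarith
  obtain ⟨ν, hν1, hν⟩ : ∃ ν : ℝ, 1 < ν ∧ ν ^ 3 < l := by
    have hc : ContinuousAt (fun x : ℝ => x ^ 3) 1 := by fun_prop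
    have h3 : ∀ᶠ x in 𝓝[>] (1:ℝ), x ^ 3 < l :=
      (hc.eventually_lt continuousAt_const (by simpa using hl)).filter_mono nhdsWithin_le_nhds
    obtain ⟨x, hx⟩ := (h3.and self_mem_nhdsWithin).exists
    exact ⟨x, hx.2, hx.1⟩
  set L := l * ν with hL
  set ρ := m * ν with hρ
  have hL0 : 0 < L := by positivity
  have hρ0 : 0 < ρ := by positivity
  have hq : L * ρ ^ 2 < 1 := by
    have : L * ρ ^ 2 = m * ν ^ 3 := by
      rw [hL, hρ]; linear_combination (m * ν ^ 3) * hlm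
    rw [this]; nlinarith
  have hρ1 : ρ < 1 := by
    by_contra! h
    have hL1 : 1 < L := by nlinarith
    have : 1 ≤ ρ ^ 2 := one_le_pow₀ h
    nlinarith
  -- Lipschitz bound
  obtain ⟨L', hL'⟩ : ∃ L' : NNReal, (L' : ℝ) = L := ⟨L.toNNReal, Real.coe_toNNReal _ hL0.le⟩
  obtain ⟨U, hU, hLip⟩ := hT.exists_lipschitzOnWith_of_nnnorm_lt L' (by
    rw [← NNReal.coe_lt_coe, coe_nnnorm, hL']
    refine (Ec_norm e he l hl.le).trans_lt ?_
    rw [hL]; nlinarith)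
  obtain ⟨R₁, hR₁, hRU⟩ := Metric.mem_nhds_iff.1 hU
  -- contraction
  have hcon : ∀ᶠ A in 𝓝 V, A ∈ c₁ → ‖S A - V‖ ≤ ρ * ‖A - V‖ := by
    have hε : 0 < (ρ - m) / 2 := by rw [hρ]; nlinarith
    have h3 := hS.isLittleO.def hε
    have h4 : ∀ᶠ A in 𝓝 V, |1 - m| * C₁ * ‖A - V‖ < (ρ - m) / 2 := by
      have : ContinuousAt (fun A : Plane => |1 - m| * C₁ * ‖A - V‖) V := by fun_prop
      exact this.eventually_lt continuousAt_const (by simpa using hε)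
    filter_upwards [h1, h3, h4] with A a1 a2 a3 hA
    have a1 := a1 hA
    rw [hSV] at a2
    have a4 : ‖Ec e m (A - V)‖ ≤ m * ‖A - V‖ + |1 - m| * (C₁ * ‖A - V‖ ^ 2) := by
      rw [Ec_apply]
      refine (norm_add_le _ _).trans ?_
      rw [norm_smul, norm_smul, he, Real.norm_of_nonneg hm.le, Real.norm_eq_abs, abs_mul, mul_one]
      gcongr
    have a5 := norm_add_le (S A - V - Ec e m (A - V)) (Ec e m (A - V))
    rw [sub_add_cancel] at a5
    have a6 : |1 - m| * C₁ * ‖A - V‖ * ‖A - V‖ ≤ (ρ - m) / 2 * ‖A - V‖ := by gcongr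
    nlinarith
  -- second order contact
  have hclose : ∀ᶠ A in 𝓝 V, A ∈ c₁ → Metric.infDist A c₂ ≤ (C₁ + C₂) * ‖A - V‖ ^ 2 := by
    have hc : Tendsto (fun A : Plane => (inner ℝ (Je e) (A - V) : ℝ)) (𝓝 V) (𝓝 0) := by
      have : ContinuousAt (fun A : Plane => (inner ℝ (Je e) (A - V) : ℝ)) V := by fun_prop
      simpa [ContinuousAt] using this
    filter_upwards [h1, hc.eventually h2] with A a1 a2 hA
    obtain ⟨B, hB, a3⟩ := a2
    refine (Metric.infDist_le_dist_of_mem hB).trans ?_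
    have a4 : A - B = (inner ℝ e (A - V) : ℝ) • e
        - (B - (V + (inner ℝ (Je e) (A - V) : ℝ) • Je e)) := by
      have := Je_decomp e he (A - V)
      rw [sub_eq_iff_eq_add] at this
      nth_rewrite 1 [this]
      module
    have a5 : (inner ℝ (Je e) (A - V) : ℝ) ^ 2 ≤ ‖A - V‖ ^ 2 := by
      have := abs_real_inner_le_norm (Je e) (A - V)
      rw [Je_norm e he, one_mul] at this
      rw [← sq_abs]
      gcongr
    rw [dist_eq_norm, a4]
    refine (norm_sub_le _ _).trans ?_
    rw [norm_smul, he, mul_one, Real.norm_eq_abs, add_mul]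
    exact add_le_add (a1 hA) (a3.trans (by gcongr))
  obtain ⟨R₂, hR₂, hR⟩ := Metric.mem_nhds_iff.1 (hcon.and hclose)
  have hr : 0 < min R₂ (R₁ / 2) := by positivity
  have key : ∀ n : ℕ, ∀ A ∈ c₁, ‖A - V‖ < min R₂ (R₁ / 2) →
      Metric.infDist A c₂ ≤ (C₁ + C₂) * (L * ρ ^ 2) ^ n * ‖A - V‖ ^ 2 := by
    intro n
    induction n with
    | zero =>
      intro A hA hAr
      have := (hR (show A ∈ Metric.ball V R₂ by
        rw [Metric.mem_ball, dist_eq_norm]; exact hAr.trans_le (min_le_left _ _))).2 hA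
      simpa using this
    | succ n ih =>
      intro A hA hAr
      have b1 := (hR (show A ∈ Metric.ball V R₂ by
        rw [Metric.mem_ball, dist_eq_norm]; exact hAr.trans_le (min_le_left _ _))).1 hA
      have b2 : ‖S A - V‖ < min R₂ (R₁ / 2) := by nlinarith [norm_nonneg (A - V)]
      have b3 := ih (S A) (hSc A hA) b2
      obtain ⟨B, hB, hBd⟩ := hc₂.exists_infDist_eq_dist ⟨V, hV⟩ (S A)
      have b4 : dist (S A) B ≤ ‖S A - V‖ := by
        rw [← hBd, ← dist_eq_norm]; exact Metric.infDist_le_dist_of_mem hV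
      have b5 : ‖S A - V‖ < R₁ / 2 := b2.trans_le (min_le_right _ _)
      have hBU : B ∈ U := hRU (by
        rw [Metric.mem_ball]
        have := dist_triangle_left B V (S A)
        rw [dist_eq_norm (S A) V] at this
        linarith)
      have hAU : S A ∈ U := hRU (by rw [Metric.mem_ball, dist_eq_norm]; linarith)
      have b6 := hLip.dist_le_mul _ hAU _ hBU
      rw [hTS A hA] at b6
      rw [hL'] at b6
      have b7 := (Metric.infDist_le_dist_of_mem (x := A) (hTc B hB)).trans b6
      rw [← hBd] at b7
      have hq0 : 0 ≤ (C₁ + C₂) * (L * ρ ^ 2) ^ n := by positivity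
      calc _ ≤ L * Metric.infDist (S A) c₂ := b7
        _ ≤ L * ((C₁ + C₂) * (L * ρ ^ 2) ^ n * ‖S A - V‖ ^ 2) := by gcongr
        _ ≤ L * ((C₁ + C₂) * (L * ρ ^ 2) ^ n * (ρ * ‖A - V‖) ^ 2) := by gcongr
        _ = _ := by ring
  filter_upwards [Metric.ball_mem_nhds V hr] with A hA hAc
  rw [Metric.mem_ball, dist_eq_norm] at hA
  rw [hc₂.isClosed.mem_iff_infDist_zero ⟨V, hV⟩]
  refine le_antisymm ?_ Metric.infDist_nonneg
  have hlim : Tendsto (fun n : ℕ => (C₁ + C₂) * (L * ρ ^ 2) ^ n * ‖A - V‖ ^ 2) atTop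
      (𝓝 ((C₁ + C₂) * 0 * ‖A - V‖ ^ 2)) :=
    ((tendsto_pow_atTop_nhds_zero_of_lt_one (by positivity) hq).const_mul _).mul_const _
  rw [mul_zero, zero_mul] at hlim
  exact ge_of_tendsto' hlim fun n => key n A hAc hA

def cosAt (e P A : Plane) : ℝ := inner ℝ e (A - P) / ‖A - P‖

lemma cos_mono (s t y p q : ℝ) (hst : s < t) (hy : y ≠ 0) (hp : 0 < p) (hq : 0 < q)
    (hp2 : p ^ 2 = s ^ 2 + y ^ 2) (hq2 : q ^ 2 = t ^ 2 + y ^ 2) : s / p < t / q := by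
  rw [div_lt_div_iff₀ hp hq]
  have hy2 : 0 < y ^ 2 := by positivity
  by_contra! h
  rcases le_or_gt 0 t with ht | ht
  · have h0 : 0 ≤ t * p := by positivity
    have h1 := pow_le_pow_left₀ h0 h 2
    rw [mul_pow, mul_pow, hp2, hq2] at h1
    have hs : 0 ≤ s := by
      by_contra! hs; nlinarith
    have h2 : t ^ 2 ≤ s ^ 2 := le_of_mul_le_mul_right (by linarith : t ^ 2 * y ^ 2 ≤ s ^ 2 * y ^ 2) hy2
    nlinarith
  · have h0 : 0 ≤ -(s * q) := by nlinarith
    have h1 := pow_le_pow_left₀ h0 (neg_le_neg h) 2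
    rw [neg_sq, neg_sq, mul_pow, mul_pow, hp2, hq2] at h1
    have h2 : s ^ 2 ≤ t ^ 2 := le_of_mul_le_mul_right (by linarith : s ^ 2 * y ^ 2 ≤ t ^ 2 * y ^ 2) hy2
    nlinarith

lemma norm_sq_decomp (e : Plane) (he : ‖e‖ = 1) (v : Plane) :
    ‖v‖ ^ 2 = (inner ℝ e v) ^ 2 + (inner ℝ (Je e) v) ^ 2 := by
  rw [← real_inner_self_eq_norm_sq]
  nth_rewrite 2 [Je_decomp e he v]
  rw [inner_add_right, inner_smul_right, inner_smul_right, real_inner_comm, 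
    real_inner_comm (Je e) v]
  ring

lemma Je_inner (e : Plane) : (inner ℝ (Je e) e : ℝ) = 0 := by
  simp [Je, PiLp.inner_apply, Fin.sum_univ_two]; ring

lemma cosAt_lt (e P Q X : Plane) (he : ‖e‖ = 1) (d : ℝ) (hd : 0 < d) (hQ : Q = P + d • e)
    (hX : (inner ℝ (Je e) (X - P) : ℝ) ≠ 0) : cosAt e Q X < cosAt e P X := by
  have hee : inner ℝ e e = (1 : ℝ) := by rw [real_inner_self_eq_norm_sq, he]; norm_num
  have h1 : X - Q = (X - P) - d • e := by rw [hQ]; module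
  have h2 : (inner ℝ e (X - Q) : ℝ) = inner ℝ e (X - P) - d := by
    rw [h1, inner_sub_right, inner_smul_right, hee, mul_one]
  have h3 : (inner ℝ (Je e) (X - Q) : ℝ) = inner ℝ (Je e) (X - P) := by
    rw [h1, inner_sub_right, inner_smul_right, Je_inner]; ring
  have hP0 : X - P ≠ 0 := by intro h; rw [h] at hX; simp at hX
  have hQ0 : X - Q ≠ 0 := by intro h; rw [← h3, h] at hX; simp at hX
  refine cos_mono _ _ (inner ℝ (Je e) (X - P)) _ _ (by rw [h2]; linarith) hX
    (norm_pos_iff.2 hQ0) (norm_pos_iff.2 hP0) ?_ (norm_sq_decomp e he _)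
  rw [← h3]; exact norm_sq_decomp e he _

lemma tau_sub (k : ℝ) (P X : Plane) : tau k P X - P = (1 - k / ‖X - P‖) • (X - P) := by
  rw [tau]; module

lemma cosAt_tau (k : ℝ) (e P X : Plane) (hX : X ≠ P) (hk : ‖X - P‖ < k) :
    cosAt e P (tau k P X) = - cosAt e P X := by
  have hr : 0 < ‖X - P‖ := norm_pos_iff.2 (sub_ne_zero.2 hX)
  have hc : 1 - k / ‖X - P‖ < 0 := by rw [sub_neg, one_lt_div hr]; exact hk
  rw [cosAt, cosAt, tau_sub, inner_smul_right, norm_smul, Real.norm_eq_abs, abs_of_neg hc, neg_mul,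
    div_neg, mul_div_mul_left _ _ hc.ne]

open Filter Topology in
structure Good (e P Q V₁ V₂ : Plane) (k : ℝ) (c : Set Plane) : Prop where
  compact : IsCompact c
  mem₁ : V₁ ∈ c
  mem₂ : V₂ ∈ c
  tauP : ∀ A ∈ c, tau k P A ∈ c ∧ A ≠ P ∧ ‖A - P‖ < k
  tauQ : ∀ A ∈ c, tau k Q A ∈ c ∧ A ≠ Q ∧ ‖A - Q‖ < k
  axis : ∀ A ∈ c, (inner ℝ (Je e) (A - P) : ℝ) = 0 → A = V₁ ∨ A = V₂
  tan₁ : ∃ C : ℝ, 0 ≤ C ∧ ∀ᶠ A in 𝓝 V₁, A ∈ c → |inner ℝ e (A - V₁)| ≤ C * ‖A - V₁‖ ^ 2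
  tan₂ : ∃ C : ℝ, 0 ≤ C ∧ ∀ᶠ y in 𝓝 (0 : ℝ), ∃ B ∈ c, ‖B - (V₁ + y • Je e)‖ ≤ C * y ^ 2

lemma tau_continuousAt (k : ℝ) (P A : Plane) (h : A ≠ P) : ContinuousAt (tau k P) A := by
  have : ‖A - P‖ ≠ 0 := norm_ne_zero_iff.2 (sub_ne_zero.2 h)
  unfold tau
  fun_prop (disch := assumption)

open Filter Topology in
lemma good_sub {e P Q V₁ V₂ : Plane} {k : ℝ} (he : ‖e‖ = 1) (d b : ℝ) (hd : 0 < d)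
    (hb : 0 < b) (hQ : Q = P + d • e) (hV₂ : V₂ = Q + b • e) {c₁ c₂ : Set Plane}
    (g₁ : Good e P Q V₁ V₂ k c₁) (g₂ : Good e P Q V₁ V₂ k c₂)
    (hloc : ∀ᶠ A in 𝓝 V₁, A ∈ c₁ → A ∈ c₂) : c₁ ⊆ c₂ := by
  by_contra hne
  rw [Set.not_subset] at hne
  obtain ⟨A₀, hA₀, hA₀'⟩ := hne
  set W := c₁ \ c₂ with hW
  set S : Plane → Plane := fun A => tau k P (tau k Q A) with hS
  have hSc : ∀ A ∈ c₁, S A ∈ c₁ := fun A hA => (g₁.tauP _ (g₁.tauQ A hA).1).1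
  have hSW : ∀ A ∈ W, S A ∈ W := by
    intro A hA
    refine ⟨hSc A hA.1, fun h => hA.2 ?_⟩
    have h1 := (g₂.tauQ _ (g₂.tauP _ h).1).1
    have h2 := g₁.tauQ A hA.1
    have h3 := g₁.tauP _ h2.1
    simp only [hS] at h1
    rwa [tau_tau k P _ h3.2.1 h3.2.2, tau_tau k Q _ h2.2.1 h2.2.2] at h1
  have hScont : ContinuousOn S c₁ := by
    intro A hA
    have h2 := g₁.tauQ A hA
    have h3 := g₁.tauP _ h2.1
    exact (ContinuousAt.comp (f := tau k Q) (g := tau k P) (tau_continuousAt k P _ h3.2.1)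
      (tau_continuousAt k Q A h2.2.1)).continuousWithinAt
  have hcW : closure W ⊆ c₁ := closure_minimal sdiff_subset g₁.compact.isClosed
  have hScW : ∀ A ∈ closure W, S A ∈ closure W := by
    intro A hA
    exact (hScont.mono hcW).image_closure (s := W) |>.trans
      (closure_mono (image_subset_iff.2 hSW)) (mem_image_of_mem S hA)
  have hV₁W : V₁ ∉ closure W := by
    intro h
    rw [mem_closure_iff_frequently] at h
    obtain ⟨A, hA, hA'⟩ := (h.and_eventually hloc).exists
    exact hA.2 (hA' hA.1)
  have hgc : ContinuousOn (cosAt e P) (closure W) := by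
    intro A hA
    have : ‖A - P‖ ≠ 0 := norm_ne_zero_iff.2 (sub_ne_zero.2 (g₁.tauP A (hcW hA)).2.1)
    refine ContinuousAt.continuousWithinAt ?_
    unfold cosAt
    fun_prop (disch := assumption)
  have hdec : ∀ A ∈ c₁, A ≠ V₁ → A ≠ V₂ → cosAt e P (S A) < cosAt e P A := by
    intro A hA h1 h2
    have hy : (inner ℝ (Je e) (A - P) : ℝ) ≠ 0 := fun h => (g₁.axis A hA h).elim h1 h2
    have hAQ := g₁.tauQ A hA
    have hB := g₁.tauP _ hAQ.1
    have hyQ : ∀ X : Plane, (inner ℝ (Je e) (X - Q) : ℝ) = inner ℝ (Je e) (X - P) := by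
      intro X
      have : X - Q = (X - P) - d • e := by rw [hQ]; module
      rw [this, inner_sub_right, inner_smul_right, Je_inner]; ring
    have hr : 0 < ‖A - Q‖ := norm_pos_iff.2 (sub_ne_zero.2 hAQ.2.1)
    have hc : 1 - k / ‖A - Q‖ < 0 := by rw [sub_neg, one_lt_div hr]; exact hAQ.2.2
    have hyB : (inner ℝ (Je e) (tau k Q A - P) : ℝ) ≠ 0 := by
      rw [← hyQ, tau_sub, inner_smul_right, hyQ]
      exact mul_ne_zero hc.ne hy
    have i1 := cosAt_lt e P Q A he d hd hQ hy
    have i2 := cosAt_lt e P Q _ he d hd hQ hyB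
    rw [cosAt_tau k e Q A hAQ.2.1 hAQ.2.2] at i2
    simp only [hS]
    rw [cosAt_tau k e P _ hB.2.1 hB.2.2]
    linarith
  obtain ⟨M, hM, hmin⟩ := (g₁.compact.of_isClosed_subset isClosed_closure hcW).exists_isMinOn
    ⟨A₀, subset_closure ⟨hA₀, hA₀'⟩⟩ hgc
  have hM1 : M ≠ V₁ := by rintro rfl; exact hV₁W hM
  have hM2 : M = V₂ := by
    by_contra h
    have := hdec M (hcW hM) hM1 h
    exact absurd (hmin (hScW M hM)) (not_le.2 this)
  have hcos2 : cosAt e P V₂ = 1 := by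
    have : V₂ - P = (d + b) • e := by rw [hV₂, hQ]; module
    rw [cosAt, this, inner_smul_right, norm_smul, he, real_inner_self_eq_norm_sq, he,
      Real.norm_of_nonneg (by positivity)]
    have : d + b ≠ 0 := by positivity
    field_simp
  have hA1 : A₀ ≠ V₁ := by rintro rfl; exact hA₀' g₂.mem₁
  have hA2 : A₀ ≠ V₂ := by rintro rfl; exact hA₀' g₂.mem₂
  have j1 := hdec A₀ hA₀ hA1 hA2
  have j2 : cosAt e P M ≤ cosAt e P (S A₀) := hmin (hScW A₀ (subset_closure ⟨hA₀, hA₀'⟩))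
  rw [hM2, hcos2] at j2
  have j3 : cosAt e P A₀ ≤ 1 := by
    have hr : 0 < ‖A₀ - P‖ := norm_pos_iff.2 (sub_ne_zero.2 (g₁.tauP _ hA₀).2.1)
    rw [cosAt, div_le_one hr]
    have := real_inner_le_norm e (A₀ - P)
    rwa [he, one_mul] at this
  linarith

lemma tau_axis (k s : ℝ) (P e : Plane) (he : ‖e‖ = 1) (hs : s ≠ 0) :
    tau k P (P + s • e) = P + (s - k * s / |s|) • e := by
  rw [tau, add_sub_cancel_left, norm_smul, he, mul_one, Real.norm_eq_abs]
  have : |s| ≠ 0 := abs_ne_zero.2 hs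
  module

/-- Derivatives of the two return maps at `V₁`. -/
lemma deriv_two {e P Q V V' : Plane} (he : ‖e‖ = 1) (k s s' : ℝ) (hs : s ≠ 0) (hs' : s' ≠ 0)
    (h1 : V = P + s • e) (h2 : tau k P V = V') (h3 : V' = Q + s' • e) :
    HasStrictFDerivAt (fun A => tau k Q (tau k P A))
      (Ec e ((1 - k / |s'|) * (1 - k / |s|))) V := by
  rw [← Ec_comp e he]
  have d1 := tau_strict k P e he s |s| (abs_pos.2 hs) rfl
  have d2 := tau_strict k Q e he s' |s'| (abs_pos.2 hs') rfl
  rw [← h1] at d1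
  rw [← h3, ← h2] at d2
  exact d2.comp V d1

section
variable {e P Q V₁ V₂ : Plane} {a d b : ℝ}

lemma axis_maps (he : ‖e‖ = 1) (ha : 0 < a) (hd : 0 < d) (hb : 0 < b)
    (hQ : Q = P + d • e) (hV₁ : V₁ = P + (-a) • e) (hV₂ : V₂ = Q + b • e) :
    tau (a + d + b) P V₁ = V₂ ∧ tau (a + d + b) Q V₂ = V₁ ∧ tau (a + d + b) Q V₁ = V₂ ∧
      tau (a + d + b) P V₂ = V₁ := by
  have hV₁' : V₁ = Q + (-(a + d)) • e := by rw [hV₁, hQ]; module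
  have hV₂' : V₂ = P + (d + b) • e := by rw [hV₂, hQ]; module
  refine ⟨?_, ?_, ?_, ?_⟩
  · rw [hV₁, tau_axis _ _ _ _ he (by linarith), hV₂', abs_neg, abs_of_pos ha]
    congr 2; field_simp; ring
  · rw [hV₂, tau_axis _ _ _ _ he (by linarith), hV₁', abs_of_pos hb]
    congr 2; field_simp; ring
  · rw [hV₁', tau_axis _ _ _ _ he (by linarith), hV₂, abs_neg, abs_of_pos (by linarith)]
    congr 2; field_simp; ring
  · rw [hV₂', tau_axis _ _ _ _ he (by linarith), hV₁, abs_of_pos (by linarith)]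
    congr 2; field_simp; ring

lemma deriv_S (he : ‖e‖ = 1) (ha : 0 < a) (hd : 0 < d) (hb : 0 < b)
    (hQ : Q = P + d • e) (hV₁ : V₁ = P + (-a) • e) (hV₂ : V₂ = Q + b • e) :
    HasStrictFDerivAt (fun A => tau (a + d + b) P (tau (a + d + b) Q A))
      (Ec e (a * b / ((a + d) * (d + b)))) V₁ := by
  have hV₁' : V₁ = Q + (-(a + d)) • e := by rw [hV₁, hQ]; module
  have hV₂' : V₂ = P + (d + b) • e := by rw [hV₂, hQ]; module
  obtain ⟨m1, m2, m3, m4⟩ := axis_maps he ha hd hb hQ hV₁ hV₂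
  have := deriv_two he (a + d + b) (-(a + d)) (d + b) (by linarith) (by linarith) hV₁' m3 hV₂'
  convert this using 2
  rw [abs_neg, abs_of_pos (by linarith : 0 < a + d), abs_of_pos (by linarith : 0 < d + b)]
  field_simp; ring

lemma deriv_T (he : ‖e‖ = 1) (ha : 0 < a) (hd : 0 < d) (hb : 0 < b)
    (hQ : Q = P + d • e) (hV₁ : V₁ = P + (-a) • e) (hV₂ : V₂ = Q + b • e) :
    HasStrictFDerivAt (fun A => tau (a + d + b) Q (tau (a + d + b) P A))
      (Ec e ((a + d) * (d + b) / (a * b))) V₁ := by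
  obtain ⟨m1, m2, m3, m4⟩ := axis_maps he ha hd hb hQ hV₁ hV₂
  have := deriv_two he (a + d + b) (-a) b (by linarith) (by linarith) hV₁ m1 hV₂
  convert this using 2
  rw [abs_neg, abs_of_pos ha, abs_of_pos hb]
  field_simp; ring

lemma lam_gt (ha : 0 < a) (hd : 0 < d) (hb : 0 < b) : 1 < (a + d) * (d + b) / (a * b) := by
  rw [one_lt_div (by positivity)]
  nlinarith [mul_pos ha hd, mul_pos hd hb, mul_pos hd hd]

lemma sol_good (he : ‖e‖ = 1) (ha : 0 < a) (hd : 0 < d) (hb : 0 < b)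
    (hQ : Q = P + d • e) (hV₁ : V₁ = P + (-a) • e) (hV₂ : V₂ = Q + b • e) {K : Set Plane}
    (h : IsAnalyticSolution (fun a b => a + b) P Q V₁ V₂ K) :
    Good e P Q V₁ V₂ (a + d + b) (frontier K) := by
  obtain ⟨hKc, hK, -, hP, hQi, ⟨kP, hkP⟩, ⟨kQ, hkQ⟩, hax, han⟩ := h
  have hV₁' : V₁ = Q + (-(a + d)) • e := by rw [hV₁, hQ]; module
  have hV₂' : V₂ = P + (d + b) • e := by rw [hV₂, hQ]; module
  obtain ⟨m1, m2, m3, m4⟩ := axis_maps he ha hd hb hQ hV₁ hV₂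
  have hm₁ : V₁ ∈ frontier K := by
    have : V₁ ∈ ({V₁, V₂} : Set Plane) := by simp
    rw [← hax] at this; exact this.2
  have hm₂ : V₂ ∈ frontier K := by
    have : V₂ ∈ ({V₁, V₂} : Set Plane) := by simp
    rw [← hax] at this; exact this.2
  have hseg : ∀ (X : Plane) (s t : ℝ), 0 < s → 0 < t → V₁ = X + (-s) • e → V₂ = X + t • e →
      X ∈ openSegment ℝ V₁ V₂ ∧ dist V₁ X + dist V₂ X = s + t := by
    intro X s t hs ht e1 e2
    constructor
    · refine ⟨t / (s + t), s / (s + t), by positivity, by positivity, by field_simp; ring, ?_⟩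
      rw [e1, e2]
      have : (t / (s + t)) • (X + (-s) • e) + (s / (s + t)) • (X + t • e)
        = (t / (s + t) + s / (s + t)) • X + (- (t / (s + t) * s) + s / (s + t) * t) • e := by
        module
      rw [this, show t / (s + t) + s / (s + t) = 1 by field_simp; ring,
        show - (t / (s + t) * s) + s / (s + t) * t = 0 by ring]
      simp
    · rw [e1, e2, dist_eq_norm, dist_eq_norm, add_sub_cancel_left, add_sub_cancel_left, norm_smul,
        norm_smul, he, norm_neg, Real.norm_of_nonneg hs.le, Real.norm_of_nonneg ht.le]
      ring
  have sP := hseg P a (d + b) ha (by linarith) hV₁ hV₂'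
  have sQ := hseg Q (a + d) b (by linarith) hb hV₁' hV₂
  have hkP' : kP = a + d + b := by
    rw [← hkP V₁ V₂ hm₁ hm₂ sP.1]; simp only; rw [sP.2]; ring
  have hkQ' : kQ = a + d + b := by
    rw [← hkQ V₁ V₂ hm₁ hm₂ sQ.1]; simp only; rw [sQ.2]
  subst hkP'
  subst hkQ'
  have tP : ∀ A ∈ frontier K, _ := fun A hA => tau_mem hKc hP (a + d + b) hkP hA
  have tQ : ∀ A ∈ frontier K, _ := fun A hA => tau_mem hKc hQi (a + d + b) hkQ hA
  have tan := tangent hKc hK hP he a ha hV₁ hm₁ han _ (by rw [m3, m4]) _ ?_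
    (deriv_S he ha hd hb hQ hV₁ hV₂).hasFDerivAt
    (fun A hA => (tP _ (tQ A hA).1).1)
  · refine ⟨hKc.of_isClosed_subset isClosed_frontier hKc.isClosed.frontier_subset, hm₁, hm₂, tP, tQ,
      ?_, tan.1, tan.2⟩
    intro A hA hy
    have : A ∈ (affineSpan ℝ ({P, Q} : Set Plane) : Set Plane) ∩ frontier K := by
      refine ⟨?_, hA⟩
      have h1 := Je_decomp e he (A - P)
      rw [hy, zero_smul, add_zero] at h1
      have h2 : A = AffineMap.lineMap P Q ((inner ℝ e (A - P) : ℝ) / d) := by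
        rw [AffineMap.lineMap_apply, hQ]
        simp only [vsub_eq_sub, vadd_eq_add, add_sub_cancel_left, smul_smul]
        rw [div_mul_cancel₀ _ hd.ne', ← h1]; abel
      rw [h2]
      exact AffineMap.lineMap_mem_affineSpan_pair _ _ _
    rw [hax] at this
    simpa using this
  · have := lam_gt ha hd hb
    rw [one_lt_div (by positivity)] at this
    rw [Ne, div_eq_one_iff_eq (by positivity)]
    exact this.ne

lemma good_subset (he : ‖e‖ = 1) (ha : 0 < a) (hd : 0 < d) (hb : 0 < b)
    (hQ : Q = P + d • e) (hV₁ : V₁ = P + (-a) • e) (hV₂ : V₂ = Q + b • e) {c₁ c₂ : Set Plane}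
    (g₁ : Good e P Q V₁ V₂ (a + d + b) c₁) (g₂ : Good e P Q V₁ V₂ (a + d + b) c₂) :
    c₁ ⊆ c₂ := by
  obtain ⟨m1, m2, m3, m4⟩ := axis_maps he ha hd hb hQ hV₁ hV₂
  refine good_sub he d b hd hb hQ hV₂ g₁ g₂ ?_
  refine local_uniq g₂.compact he g₂.mem₁ _ _ _ _ (lam_gt ha hd hb) ?_ ?_
    (deriv_T he ha hd hb hQ hV₁ hV₂) (deriv_S he ha hd hb hQ hV₁ hV₂).hasFDerivAt ?_ ?_ ?_
    g₁.tan₁ g₂.tan₂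
  · field_simp
  · rw [m3, m4]
  · exact fun A hA => (g₁.tauP _ (g₁.tauQ A hA).1).1
  · exact fun A hA => (g₂.tauQ _ (g₂.tauP A hA).1).1
  · intro A hA
    have h2 := g₁.tauQ A hA
    have h3 := g₁.tauP _ h2.1
    rw [tau_tau _ P _ h3.2.1 h3.2.2, tau_tau _ Q _ h2.2.1 h2.2.2]

end

/-- Uniqueness of analytic solutions of the Equichordal Problem (`F(a,b) = a + b`). -/
theorem uniqueness_equichordal
    (V₁ P Q V₂ : Plane)
    (hne : V₁ ≠ P ∧ V₁ ≠ Q ∧ V₁ ≠ V₂ ∧ P ≠ Q ∧ P ≠ V₂ ∧ Q ≠ V₂)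
    (hcol : Collinear ℝ ({V₁, P, Q, V₂} : Set Plane))
    (hPseg : P ∈ openSegment ℝ V₁ Q) (hQseg : Q ∈ openSegment ℝ P V₂)
    (K₁ K₂ : Set Plane)
    (h₁ : IsAnalyticSolution (fun a b => a + b) P Q V₁ V₂ K₁)
    (h₂ : IsAnalyticSolution (fun a b => a + b) P Q V₁ V₂ K₂) :
    frontier K₁ = frontier K₂ := by
  obtain ⟨-, -, -, hPQ, -, -⟩ := hne
  obtain ⟨α, β, hα, hβ, hαβ, hP⟩ := hPseg
  obtain ⟨α', β', hα', hβ', hαβ', hQ⟩ := hQseg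
  have hd : 0 < ‖Q - P‖ := norm_pos_iff.2 (sub_ne_zero.2 hPQ.symm)
  obtain ⟨d, hdd⟩ : ∃ d, d = ‖Q - P‖ := ⟨_, rfl⟩
  rw [← hdd] at hd
  obtain ⟨e, hee⟩ : ∃ e, e = d⁻¹ • (Q - P) := ⟨_, rfl⟩
  have he : ‖e‖ = 1 := by
    rw [hee, norm_smul, ← hdd, norm_inv, Real.norm_of_nonneg hd.le, inv_mul_cancel₀ hd.ne']
  have hde : d • e = Q - P := by rw [hee, smul_smul, mul_inv_cancel₀ hd.ne', one_smul]
  have e1 : Q = P + d • e := by rw [hde]; abel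
  have e2 : V₁ = P + (-(β / α * d)) • e := by
    have h1 : α • V₁ = P - β • Q := by rw [← hP]; abel
    have h2 : V₁ = α⁻¹ • (P - β • Q) := by rw [← h1, smul_smul, inv_mul_cancel₀ hα.ne', one_smul]
    rw [h2, ← neg_mul, ← smul_smul, hde]
    have h3 : P - β • Q = α • P - β • (Q - P) := by
      rw [show α = 1 - β by linarith]; module
    rw [h3, smul_sub, smul_smul, inv_mul_cancel₀ hα.ne', one_smul, div_eq_mul_inv]
    module
  have e3 : V₂ = Q + (α' / β' * d) • e := by
    have h1 : β' • V₂ = Q - α' • P := by nth_rewrite 1 [← hQ]; abel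
    have h2 : V₂ = β'⁻¹ • (Q - α' • P) := by
      rw [← h1, smul_smul, inv_mul_cancel₀ hβ'.ne', one_smul]
    rw [h2, ← smul_smul, hde]
    have h3 : Q - α' • P = β' • Q + α' • (Q - P) := by
      rw [show β' = 1 - α' by linarith]; module
    rw [h3, smul_add, smul_smul, inv_mul_cancel₀ hβ'.ne', one_smul, div_eq_mul_inv]
    module
  have ha : 0 < β / α * d := by positivity
  have hb : 0 < α' / β' * d := by positivity
  have g₁ := sol_good he ha hd hb e1 e2 e3 h₁
  have g₂ := sol_good he ha hd hb e1 e2 e3 h₂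
  exact (good_subset he ha hd hb e1 e2 e3 g₁ g₂).antisymm (good_subset he ha hd hb e1 e2 e3 g₂ g₁)
end
end

section
/- Let V₁, P, Q, V₂ be four distinct collinear points of ℝ², with P in the open segment from V₁ to Q and Q in the open segment from P to V₂. For the function F(a,b) = 1/a + 1/b (so that an interior F-chordal point is an equireciprocal point), there is at most one analytic solution of the interior F-chordal problem with equireciprocal points P, Q and vertices V₁, V₂: if K₁ and K₂ are two such solutions, then frontier K₁ = frontier K₂. -/
open Set

noncomputable section

open Filter Topology in
theorem exists_ray_frontier {E : Type*} [NormedAddCommGroup E] [NormedSpace ℝ E] {K : Set E}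
    (hK : IsCompact K) {o w : E} (ho : o ∈ interior K) (hw : w ≠ 0) :
    ∃ t : ℝ, 0 < t ∧ o + t • w ∈ frontier K := by
  obtain ⟨R, hR⟩ := hK.isBounded.exists_norm_le
  have hwn : 0 < ‖w‖ := norm_pos_iff.mpr hw
  have hc : Continuous (fun t : ℝ => o + t • w) := by fun_prop
  set S : Set ℝ := {t | o + t • w ∈ K} with hS
  have hSc : IsClosed S := hK.isClosed.preimage hc
  have hbdd : BddAbove S := by
    refine ⟨(R + ‖o‖) / ‖w‖, fun t ht => ?_⟩
    rw [le_div_iff₀ hwn]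
    have h1 := hR _ ht
    have h2 : ‖t • w‖ ≤ ‖o + t • w‖ + ‖o‖ := by
      have := norm_sub_le (o + t • w) o
      simpa using this
    rw [norm_smul, Real.norm_eq_abs] at h2
    have := le_abs_self t
    nlinarith
  have h0 : (0 : ℝ) ∈ S := by simpa [hS] using interior_subset ho
  have hmem : sSup S ∈ S := hSc.csSup_mem ⟨0, h0⟩ hbdd
  have key : ∀ t : ℝ, o + t • w ∈ interior K → ∃ s ∈ S, t < s := by
    intro t ht
    have h1 : ∀ᶠ s in 𝓝 t, o + s • w ∈ interior K :=
      hc.continuousAt.eventually (isOpen_interior.mem_nhds ht)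
    have h2 : ∀ᶠ s in 𝓝[>] t, o + s • w ∈ interior K ∧ t < s :=
      (h1.filter_mono nhdsWithin_le_nhds).and self_mem_nhdsWithin
    obtain ⟨s, hs1, hs2⟩ := h2.exists
    exact ⟨s, (interior_subset hs1 : o + s • w ∈ K), hs2⟩
  refine ⟨sSup S, ?_, ?_⟩
  · obtain ⟨s, hs, hs0⟩ := key 0 (by simpa using ho)
    exact hs0.trans_le (le_csSup hbdd hs)
  · rw [frontier, hK.isClosed.closure_eq]
    refine ⟨hmem, fun h => ?_⟩
    obtain ⟨s, hs, hs0⟩ := key _ h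
    exact absurd (le_csSup hbdd hs) (not_le.mpr hs0)

open Classical in
/-- Position of a point with respect to a set: `1` inside, `0` on the boundary, `-1` outside. -/
def side {E : Type*} [TopologicalSpace E] (K : Set E) (A : E) : SignType :=
  if A ∈ interior K then 1 else if A ∈ K then 0 else -1

theorem ray_side {E : Type*} [NormedAddCommGroup E] [NormedSpace ℝ E] {K : Set E}
    (hK : IsCompact K) (hc : Convex ℝ K) {o w : E} (ho : o ∈ interior K) {t₁ t : ℝ}
    (h1 : 0 < t₁) (ht : 0 < t) (hf : o + t₁ • w ∈ frontier K) :
    side K (o + t • w) = SignType.sign (t₁ - t) := by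
  rw [frontier, hK.isClosed.closure_eq] at hf
  have key : ∀ {a b : ℝ}, 0 < a → a < b → o + b • w ∈ K → o + a • w ∈ interior K := by
    intro a b ha hab hb
    apply hc.openSegment_interior_self_subset_interior ho hb
    have hb0 : 0 < b := ha.trans hab
    refine ⟨1 - a / b, a / b, ?_, by positivity, by ring, ?_⟩
    · rw [sub_pos, div_lt_one hb0]; exact hab
    · rw [smul_add, smul_smul, div_mul_cancel₀ _ hb0.ne', ← add_assoc, ← add_smul]
      simp
  unfold side
  rcases lt_trichotomy t t₁ with h | h | h
  · rw [if_pos (key ht h hf.1), sign_pos (by linarith)]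
  · subst h
    rw [if_neg hf.2, if_pos hf.1]; simp
  · have : o + t • w ∉ K := fun h' => hf.2 (key h1 h h')
    rw [if_neg (fun h' => this (interior_subset h')), if_neg this, sign_neg (by linarith)]

theorem side_eq_zero {E : Type*} [TopologicalSpace E] {K : Set E} (hK : IsClosed K) {A : E} :
    side K A = 0 ↔ A ∈ frontier K := by
  unfold side
  rw [frontier, hK.closure_eq]
  split_ifs with h1 h2 <;> simp_all

/-- Euclidean distance to `(p, 0)`. -/
def Nm (p : ℝ) (A : ℝ × ℝ) : ℝ := √((A.1 - p) ^ 2 + A.2 ^ 2)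

/-- The point on the opposite side of `(p, 0)`. -/
def opp (p t : ℝ) (A : ℝ × ℝ) : ℝ × ℝ := (p - t * (A.1 - p), -(t * A.2))

def phi (p k : ℝ) (A : ℝ × ℝ) : ℝ × ℝ := opp p (1 / (k * Nm p A - 1)) A

/-- chordal property in coordinates -/
structure Chord (p k : ℝ) (K : Set (ℝ × ℝ)) : Prop where
  compact : IsCompact K
  convex : Convex ℝ K
  inter : (p, (0 : ℝ)) ∈ interior K
  chord : ∀ A ∈ frontier K, ∀ t : ℝ, 0 < t → opp p t A ∈ frontier K →
    1 / Nm p A + 1 / (t * Nm p A) = k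

theorem Chord.ne {p k : ℝ} {K : Set (ℝ × ℝ)} (h : Chord p k K) {A : ℝ × ℝ}
    (hA : A ∈ frontier K) : (A.1 - p, A.2) ≠ 0 := by
  intro h0
  have h1 : A = (p, 0) := by
    have := congrArg Prod.fst h0
    have h2 := congrArg Prod.snd h0
    simp at this h2
    ext <;> simp <;> linarith
  rw [h1] at hA
  exact hA.2 h.inter

theorem Nm_pos {p : ℝ} {A : ℝ × ℝ} (h : (A.1 - p, A.2) ≠ 0) : 0 < Nm p A := by
  unfold Nm
  apply Real.sqrt_pos.mpr
  by_contra hn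
  apply h
  have h1 : A.1 - p = 0 := by nlinarith [sq_nonneg (A.1 - p), sq_nonneg A.2]
  have h2 : A.2 = 0 := by nlinarith [sq_nonneg (A.1 - p), sq_nonneg A.2]
  simp [h1, h2]

theorem opp_eq (p t : ℝ) (A : ℝ × ℝ) : opp p t A = (p, (0:ℝ)) + t • (-(A.1 - p, A.2)) := by
  simp only [opp]; ext <;> simp <;> ring

theorem Chord.phi_mem {p k : ℝ} {K : Set (ℝ × ℝ)} (h : Chord p k K) {A : ℝ × ℝ}
    (hA : A ∈ frontier K) : 1 < k * Nm p A ∧ phi p k A ∈ frontier K := by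
  have hne := h.ne hA
  have hN := Nm_pos hne
  obtain ⟨t, ht, hf⟩ := exists_ray_frontier h.compact h.inter (neg_ne_zero.mpr hne)
  rw [← opp_eq] at hf
  have hk := h.chord A hA t ht hf
  have hkN : k * Nm p A - 1 = 1 / t := by
    rw [← hk]; field_simp; ring
  have : 0 < 1 / t := by positivity
  refine ⟨by linarith, ?_⟩
  rw [phi, hkN]; simpa using hf

theorem Nm_ray (p : ℝ) {t : ℝ} (ht : 0 < t) (A : ℝ × ℝ) :
    Nm p ((p, (0:ℝ)) + t • (A.1 - p, A.2)) = t * Nm p A := by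
  unfold Nm
  rw [← Real.sqrt_sq ht.le, ← Real.sqrt_mul (sq_nonneg t), Real.sqrt_sq ht.le]
  congr 1; simp; ring

theorem side_phi {p k : ℝ} {K L : Set (ℝ × ℝ)} (hK : Chord p k K) (hL : Chord p k L)
    {A : ℝ × ℝ} (hA : A ∈ frontier L) : side K (phi p k A) = - side K A := by
  have hne := hL.ne hA
  have hN := Nm_pos hne
  obtain ⟨hk, -⟩ := hL.phi_mem hA
  obtain ⟨t, ht, hf⟩ := exists_ray_frontier hK.compact hK.inter hne
  have h1 := ray_side hK.compact hK.convex hK.inter ht one_pos hf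
  have hA1 : (p, (0:ℝ)) + (1:ℝ) • (A.1 - p, A.2) = A := by ext <;> simp
  rw [hA1] at h1
  obtain ⟨hk', hm⟩ := hK.phi_mem hf
  rw [Nm_ray p ht] at hk'
  have h2 : phi p k ((p, (0:ℝ)) + t • (A.1 - p, A.2)) =
      (p, (0:ℝ)) + (t / (k * (t * Nm p A) - 1)) • (-(A.1 - p, A.2)) := by
    rw [phi, Nm_ray p ht, opp_eq]
    ext <;> simp <;> ring
  rw [h2] at hm
  have hd : 0 < k * (t * Nm p A) - 1 := by linarith
  have hd' : 0 < k * Nm p A - 1 := by linarith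
  have h3 := ray_side hK.compact hK.convex hK.inter (t := 1 / (k * Nm p A - 1))
    (by positivity) (by positivity) hm
  rw [phi, opp_eq, h3, h1, ← Left.sign_neg]
  have : t / (k * (t * Nm p A) - 1) - 1 / (k * Nm p A - 1) =
      (-(t - 1)) / ((k * (t * Nm p A) - 1) * (k * Nm p A - 1)) := by
    rw [div_sub_div _ _ hd.ne' hd'.ne']
    congr 1; ring
  rw [this]
  rcases lt_trichotomy t 1 with h | h | h
  · rw [sign_pos, sign_pos]
    · linarith
    · apply div_pos <;> [linarith; positivity]
  · subst h; simp
  · rw [sign_neg, sign_neg]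
    · linarith
    · apply div_neg_of_neg_of_pos <;> [linarith; positivity]

structure Sol (q v₁ v₂ kP kQ : ℝ) (K : Set (ℝ × ℝ)) : Prop where
  cP : Chord 0 kP K
  cQ : Chord q kQ K
  hv₁ : v₁ < 0
  hq : 0 < q
  hv₂ : q < v₂
  vert : ∀ x : ℝ, (x, (0 : ℝ)) ∈ frontier K ↔ x = v₁ ∨ x = v₂
  graph : ∃ f : ℝ → ℝ, AnalyticAt ℝ f 0 ∧ f 0 = v₁ ∧ ∀ᶠ y in nhds (0 : ℝ), (f y, y) ∈ frontier K

section dyn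
variable {q v₁ v₂ kP kQ : ℝ} {K L : Set (ℝ × ℝ)}

theorem Chord.phi_snd {p k : ℝ} {K : Set (ℝ × ℝ)} (h : Chord p k K) {A : ℝ × ℝ}
    (hA : A ∈ frontier K) : ∃ τ : ℝ, 0 < τ ∧ phi p k A = opp p τ A :=
  ⟨1 / (k * Nm p A - 1), one_div_pos.mpr (by linarith [(h.phi_mem hA).1]), rfl⟩

/-- One backward step of the dynamics. -/
def step (q kP kQ : ℝ) (A : ℝ × ℝ) : ℝ × ℝ := phi 0 kP (phi q kQ A)

theorem Sol.step_mem (h : Sol q v₁ v₂ kP kQ K) {A : ℝ × ℝ} (hA : A ∈ frontier K) :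
    step q kP kQ A ∈ frontier K := (h.cP.phi_mem (h.cQ.phi_mem hA).2).2

theorem Sol.step_pos (h : Sol q v₁ v₂ kP kQ K) {A : ℝ × ℝ} (hA : A ∈ frontier K) (hy : 0 < A.2) :
    0 < (step q kP kQ A).2 ∧
    (step q kP kQ A).1 / (step q kP kQ A).2 ≤ A.1 / A.2 - q / A.2 := by
  obtain ⟨τ, hτ, e⟩ := h.cQ.phi_snd hA
  obtain ⟨σ, hσ, e'⟩ := h.cP.phi_snd (h.cQ.phi_mem hA).2
  have hq := h.hq
  rw [step, e', e]
  simp only [opp]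
  refine ⟨by have := mul_pos hσ (mul_pos hτ hy); linarith, ?_⟩
  have : (0 - σ * (q - τ * (A.1 - q) - 0)) / -(σ * -(τ * A.2)) =
      A.1 / A.2 - q / A.2 - q / (τ * A.2) := by
    field_simp; ring
  rw [this]
  have : 0 < q / (τ * A.2) := by positivity
  linarith

theorem Sol.near (h : Sol q v₁ v₂ kP kQ K) {W : Set (ℝ × ℝ)} (hW : W ∈ nhds (v₁, (0 : ℝ))) :
    ∃ M : ℝ, ∀ A ∈ frontier K, 0 < A.2 → A.1 / A.2 < M → A ∈ W := by
  obtain ⟨R, hR⟩ := h.cP.compact.isBounded.exists_norm_le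
  have hfK : ∀ A ∈ frontier K, A ∈ K := fun A hA => h.cP.compact.isClosed.frontier_subset hA
  have hR0 : 0 ≤ R := (norm_nonneg _).trans (hR _ (interior_subset h.cP.inter))
  have hcomp : IsCompact (frontier K ∩ (interior W)ᶜ ∩ {A : ℝ × ℝ | A.1 ≤ 0 ∧ 0 ≤ A.2}) := by
    apply h.cP.compact.of_isClosed_subset
    · apply (isClosed_frontier.inter isOpen_interior.isClosed_compl).inter
      exact (isClosed_le continuous_fst continuous_const).inter
        (isClosed_le continuous_const continuous_snd)
    · exact fun A hA => hfK A hA.1.1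
  have hpos : ∀ A ∈ frontier K ∩ (interior W)ᶜ ∩ {A : ℝ × ℝ | A.1 ≤ 0 ∧ 0 ≤ A.2}, 0 < A.2 := by
    rintro ⟨x, y⟩ ⟨⟨h1, h2⟩, h3, h4⟩
    simp only at h3 h4 ⊢
    rcases h4.lt_or_eq with h5 | h5
    · exact h5
    · subst h5
      exfalso
      rcases (h.vert x).mp h1 with h6 | h6
      · subst h6; exact h2 (mem_interior_iff_mem_nhds.mpr hW)
      · have := h.hq; have := h.hv₂; linarith
  obtain ⟨δ, hδ, hδ'⟩ := hcomp.exists_forall_le' continuous_snd.continuousOn hpos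
  refine ⟨-(R / δ), fun A hA hy hX => ?_⟩
  by_contra hn
  have hRd : 0 ≤ R / δ := by positivity
  have hx : A.1 < 0 := by
    by_contra hx
    have : 0 ≤ A.1 / A.2 := div_nonneg (not_lt.mp hx) hy.le
    linarith
  have hd := hδ' A ⟨⟨hA, fun hh => hn (interior_subset hh)⟩, hx.le, hy.le⟩
  have hxR : -R ≤ A.1 := by
    have h1 := hR A (hfK A hA)
    have h2 := (norm_fst_le A).trans h1
    rw [Real.norm_eq_abs] at h2
    exact (abs_le.mp h2).1
  have : -(R / δ) ≤ A.1 / A.2 := by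
    rw [le_div_iff₀ hy]
    have : R / δ * δ = R := by field_simp
    nlinarith
  linarith

theorem Sol.tends (h : Sol q v₁ v₂ kP kQ K) {W : Set (ℝ × ℝ)} (hW : W ∈ nhds (v₁, (0 : ℝ)))
    {A : ℝ × ℝ} (hA : A ∈ frontier K) (hy : 0 < A.2) :
    ∃ n : ℕ, (step q kP kQ)^[n] A ∈ W := by
  obtain ⟨R, hR⟩ := h.cP.compact.isBounded.exists_norm_le
  have hfK : ∀ A ∈ frontier K, A ∈ K := fun A hA => h.cP.compact.isClosed.frontier_subset hA
  have hyR : ∀ B ∈ frontier K, B.2 ≤ R := fun B hB =>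
    (le_abs_self _).trans ((norm_snd_le B).trans (hR B (hfK B hB)))
  have hR0 : 0 < R := hy.trans_le (hyR A hA)
  have hq := h.hq
  obtain ⟨M, hM⟩ := h.near hW
  have key : ∀ n : ℕ, (step q kP kQ)^[n] A ∈ frontier K ∧ 0 < ((step q kP kQ)^[n] A).2 ∧
      ((step q kP kQ)^[n] A).1 / ((step q kP kQ)^[n] A).2 ≤ A.1 / A.2 - n * (q / R) := by
    intro n
    induction n with
    | zero => simpa using ⟨hA, hy⟩
    | succ n ih =>
      obtain ⟨h1, h2, h3⟩ := ih
      rw [Function.iterate_succ_apply']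
      obtain ⟨h4, h5⟩ := h.step_pos h1 h2
      refine ⟨h.step_mem h1, h4, h5.trans ?_⟩
      have : q / R ≤ q / ((step q kP kQ)^[n] A).2 :=
        div_le_div_of_nonneg_left hq.le h2 (hyR _ h1)
      push_cast
      linarith
  obtain ⟨n, hn⟩ := exists_nat_gt ((A.1 / A.2 - M) / (q / R))
  rw [div_lt_iff₀ (by positivity)] at hn
  obtain ⟨h1, h2, h3⟩ := key n
  exact ⟨n, hM _ h1 h2 (by linarith)⟩

theorem const_side (hK : Sol q v₁ v₂ kP kQ K) (hL : Sol q v₁ v₂ kP kQ L) (σ : SignType)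
    (hσ : ∀ᶠ A in nhds (v₁, (0 : ℝ)), A ∈ frontier L → A.2 ≠ 0 → side K A = σ) :
    frontier L ⊆ frontier K := by
  have hup : ∀ A ∈ frontier L, 0 < A.2 → side K A = σ := by
    intro A hA hy
    obtain ⟨n, hn⟩ := hL.tends hσ hA hy
    have key : ∀ n : ℕ, (step q kP kQ)^[n] A ∈ frontier L ∧ 0 < ((step q kP kQ)^[n] A).2 ∧
        side K ((step q kP kQ)^[n] A) = side K A := by
      intro n
      induction n with
      | zero => simpa using ⟨hA, hy⟩
      | succ n ih =>
        obtain ⟨h1, h2, h3⟩ := ih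
        rw [Function.iterate_succ_apply']
        refine ⟨hL.step_mem h1, (hL.step_pos h1 h2).1, ?_⟩
        rw [step, side_phi hK.cP hL.cP (hL.cQ.phi_mem h1).2, side_phi hK.cQ hL.cQ h1, h3, neg_neg]
    obtain ⟨h1, h2, h3⟩ := key n
    rw [← h3]
    exact hn h1 h2.ne'
  have hlow : ∀ A ∈ frontier L, A.2 < 0 → side K A = -σ := by
    intro A hA hy
    have h1 := hup _ (hL.cP.phi_mem hA).2 (by
      obtain ⟨τ, hτ, e⟩ := hL.cP.phi_snd hA
      rw [e]; simp only [opp]; nlinarith)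
    rw [side_phi hK.cP hL.cP hA] at h1
    rw [← h1, neg_neg]
  have hs : σ = -σ := by
    obtain ⟨f, hf, hf0, hfr⟩ := hL.graph
    have hc : ContinuousAt (fun y : ℝ => (f y, y)) 0 := hf.continuousAt.prodMk continuousAt_id
    have h1 := hc.eventually (p := fun A => A ∈ frontier L → A.2 ≠ 0 → side K A = σ)
      (by simpa [hf0] using hσ)
    have h2 : ∀ᶠ y in nhdsWithin (0:ℝ) (Iio 0), y < 0 := self_mem_nhdsWithin
    obtain ⟨y, ⟨hy1, hy2⟩, hy3⟩ := (((h1.and hfr).filter_mono nhdsWithin_le_nhds).and h2).exists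
    rw [← hlow _ hy2 hy3, hy1 hy2 hy3.ne]
  have hs0 : σ = 0 := (by decide : ∀ s : SignType, s = -s → s = 0) σ hs
  intro A hA
  rcases lt_trichotomy A.2 0 with h | h | h
  · exact (side_eq_zero hK.cP.compact.isClosed).mp (by rw [hlow A hA h, hs0]; rfl)
  · have e : A = (A.1, (0:ℝ)) := by ext <;> simp [h]
    rw [e] at hA ⊢
    exact (hK.vert _).mpr ((hL.vert _).mp hA)
  · exact (side_eq_zero hK.cP.compact.isClosed).mp (by rw [hup A hA h, hs0])

end dyn

section expansion
open Filter Topology Asymptotics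
variable {q v₁ v₂ kP kQ : ℝ} {K L : Set (ℝ × ℝ)}

theorem Sol.side_graph (h : Sol q v₁ v₂ kP kQ K) {f : ℝ → ℝ} (hf : ContinuousAt f 0)
    (hf0 : f 0 = v₁) (hfr : ∀ᶠ y in 𝓝 (0 : ℝ), (f y, y) ∈ frontier K) :
    ∀ᶠ A in 𝓝 (v₁, (0 : ℝ)), side K A = SignType.sign (A.1 - f A.2) := by
  have c2 : Tendsto (fun A : ℝ × ℝ => A.2) (𝓝 (v₁, (0:ℝ))) (𝓝 0) := continuous_snd.tendsto _
  have c1 : Tendsto (fun A : ℝ × ℝ => A.1) (𝓝 (v₁, (0:ℝ))) (𝓝 v₁) := continuous_fst.tendsto _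
  have c3 : Tendsto (fun A : ℝ × ℝ => ((0:ℝ), A.2)) (𝓝 (v₁, (0:ℝ))) (𝓝 (0, 0)) :=
    (by fun_prop : Continuous (fun A : ℝ × ℝ => ((0:ℝ), A.2))).tendsto _
  have e1 := c3.eventually (isOpen_interior.mem_nhds h.cP.inter)
  have e2 := c1.eventually (gt_mem_nhds h.hv₁)
  have e3 := c2.eventually (hf.eventually (gt_mem_nhds (by rw [hf0]; exact h.hv₁)))
  have e4 := c2.eventually hfr
  filter_upwards [e1, e2, e3, e4] with A h1 h2 h3 h4
  have := ray_side h.cP.compact h.cP.convex h1 (w := (-1, 0)) (t₁ := -f A.2) (t := -A.1)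
    (by linarith) (by linarith) (by simpa using h4)
  have e : ((0:ℝ), A.2) + (-A.1) • ((-1:ℝ), (0:ℝ)) = A := by ext <;> simp
  rw [e] at this
  rw [this]; congr 1; ring

/-- diagonal linear map -/
def diag (a b : ℝ) : ℝ × ℝ →L[ℝ] ℝ × ℝ :=
  (a • ContinuousLinearMap.fst ℝ ℝ ℝ).prod (b • ContinuousLinearMap.snd ℝ ℝ ℝ)

theorem diag_apply (a b : ℝ) (A : ℝ × ℝ) : diag a b A = (a * A.1, b * A.2) := by
  simp [diag]

theorem Nm_axis (p v : ℝ) : Nm p (v, 0) = |v - p| := by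
  simp [Nm, Real.sqrt_sq_eq_abs]

theorem phi_strict {p k v : ℝ} (hv : v ≠ p) (hk : k * |v - p| - 1 ≠ 0) :
    HasStrictFDerivAt (phi p k)
      (diag ((1 / (k * |v - p| - 1)) ^ 2) (-(1 / (k * |v - p| - 1)))) (v, (0:ℝ)) := by
  have hvp : v - p ≠ 0 := sub_ne_zero.mpr hv
  have habs : |v - p| ≠ 0 := abs_ne_zero.mpr hvp
  have d1 : HasStrictFDerivAt (fun A : ℝ × ℝ => A.1 - p) (ContinuousLinearMap.fst ℝ ℝ ℝ)
      (v, (0:ℝ)) := hasStrictFDerivAt_fst.sub_const p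
  have d2 : HasStrictFDerivAt (fun A : ℝ × ℝ => A.2) (ContinuousLinearMap.snd ℝ ℝ ℝ)
      (v, (0:ℝ)) := hasStrictFDerivAt_snd
  have dN : HasStrictFDerivAt (Nm p) (((v - p) / |v - p|) • ContinuousLinearMap.fst ℝ ℝ ℝ)
      (v, (0:ℝ)) := by
    have := ((d1.pow 2).add (d2.pow 2)).sqrt (by simpa using hvp)
    refine this.congr_fderiv ?_
    ext <;> simp [Real.sqrt_sq_eq_abs]
    field_simp
  have dg : HasStrictFDerivAt (fun A => k * Nm p A - 1)
      (k • ((v - p) / |v - p|) • ContinuousLinearMap.fst ℝ ℝ ℝ) (v, (0:ℝ)) :=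
    (dN.const_mul k).sub_const 1
  have hk' : k * Nm p (v, 0) - 1 ≠ 0 := by rwa [Nm_axis]
  have di := (hasStrictDerivAt_inv hk').comp_hasStrictFDerivAt (v, (0:ℝ)) dg
  have e1 := (di.mul d1).const_sub p
  have e2 := (di.mul d2).neg
  have := e1.prodMk e2
  have h3 : HasStrictFDerivAt (phi p k) _ (v, (0:ℝ)) := this.congr_of_eventuallyEq
    (Eventually.of_forall fun A => by simp [phi, opp])
  refine h3.congr_fderiv ?_
  have hsq : (v - p) * (v - p) = |v - p| * |v - p| := (abs_mul_abs_self _).symm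
  have hk2 : |v - p| * k - 1 ≠ 0 := by rwa [mul_comm]
  ext <;> simp [diag, Nm_axis]
  field_simp
  rw [pow_two (v - p), hsq]; ring

theorem order_two {ψ : ℝ × ℝ → ℝ × ℝ} {v l : ℝ} (hl : 1 < l)
    (hψ : HasStrictFDerivAt ψ (diag (l ^ 2) l) (v, (0:ℝ))) (hψ0 : ψ (v, 0) = (v, 0))
    {f₁ f₂ : ℝ → ℝ} (h1 : AnalyticAt ℝ f₁ 0) (h2 : AnalyticAt ℝ f₂ 0) (h10 : f₁ 0 = v)
    (h20 : f₂ 0 = v)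
    (i1 : ∀ᶠ y in 𝓝 (0:ℝ), (ψ (f₁ y, y)).1 = f₁ (ψ (f₁ y, y)).2)
    (i2 : ∀ᶠ y in 𝓝 (0:ℝ), (ψ (f₂ y, y)).1 = f₂ (ψ (f₂ y, y)).2)
    {m : ℕ} {g : ℝ → ℝ} (hg : ContinuousAt g 0) (hg0 : g 0 ≠ 0)
    (hd : ∀ᶠ y in 𝓝 (0:ℝ), f₁ y - f₂ y = y ^ m * g y) : m = 2 := by
  set A : ℝ → ℝ × ℝ := fun y => (f₁ y, y) with hA
  set B : ℝ → ℝ × ℝ := fun y => (f₂ y, y) with hB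
  set D : ℝ → ℝ := fun y => f₁ y - f₂ y with hD
  have tA : Tendsto A (𝓝 0) (𝓝 (v, 0)) := by
    have : ContinuousAt A 0 := h1.continuousAt.prodMk continuousAt_id
    simpa [ContinuousAt, hA, h10] using this
  have tB : Tendsto B (𝓝 0) (𝓝 (v, 0)) := by
    have : ContinuousAt B 0 := h2.continuousAt.prodMk continuousAt_id
    simpa [ContinuousAt, hB, h20] using this
  have tψ : Tendsto ψ (𝓝 (v, 0)) (𝓝 (v, 0)) := by
    have := hψ.hasFDerivAt.continuousAt
    rwa [ContinuousAt, hψ0] at this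
  have tA2 : Tendsto (fun y => (ψ (A y)).2) (𝓝 0) (𝓝 0) :=
    (continuous_snd.tendsto _).comp (tψ.comp tA)
  have tB2 : Tendsto (fun y => (ψ (B y)).2) (𝓝 0) (𝓝 0) :=
    (continuous_snd.tendsto _).comp (tψ.comp tB)
  -- strict differentiability along the two curves
  have s0 : (fun y => ψ (A y) - ψ (B y) - diag (l ^ 2) l (A y - B y)) =o[𝓝 0]
      fun y => A y - B y := by
    have := hψ.isLittleO.comp_tendsto (tA.prodMk_nhds tB)
    exact this
  have s1 : (fun y => ψ (A y) - ψ (B y) - (l ^ 2 * D y, 0)) =o[𝓝 0] D := by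
    refine (s0.congr_left (fun y => ?_)).trans_isBigO (IsBigO.of_bound 1 (.of_forall fun y => ?_))
    · rw [diag_apply]; simp [hA, hB, hD]
    · simp [hA, hB, hD, Prod.norm_def]
  have s2 : (fun y => (ψ (A y)).2 - (ψ (B y)).2) =o[𝓝 0] D := by
    refine (IsBigO.of_bound 1 (.of_forall fun y => ?_)).trans_isLittleO s1
    rw [one_mul]
    refine le_trans (le_of_eq ?_) (norm_snd_le _)
    simp
  have s3 : (fun y => (ψ (A y)).1 - (ψ (B y)).1 - l ^ 2 * D y) =o[𝓝 0] D := by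
    refine (IsBigO.of_bound 1 (.of_forall fun y => ?_)).trans_isLittleO s1
    rw [one_mul]
    exact norm_fst_le (ψ (A y) - ψ (B y) - (l ^ 2 * D y, 0))
  have s4 : (fun y => f₁ (ψ (A y)).2 - f₁ (ψ (B y)).2) =o[𝓝 0] D := by
    have := h1.hasStrictFDerivAt.isBigO_sub.comp_tendsto (tA2.prodMk_nhds tB2)
    exact IsBigO.trans_isLittleO this s2
  have s5 : (fun y => D (ψ (B y)).2 - l ^ 2 * D y) =o[𝓝 0] D := by
    refine (s3.sub s4).congr' ?_ EventuallyEq.rfl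
    filter_upwards [i1, i2] with y e1 e2
    simp only [hA, hB] at *
    rw [e1, e2]; simp only [hD]; ring
  -- the ratio of heights
  have r1 : Tendsto (fun y => (ψ (B y)).2 / y) (𝓝[≠] 0) (𝓝 l) := by
    have dB : HasDerivAt B (deriv f₂ 0, 1) 0 :=
      h2.differentiableAt.hasDerivAt.prodMk (hasDerivAt_id 0)
    have hB0 : B 0 = (v, 0) := by simp [hB, h20]
    have dψ : HasDerivAt (fun y => ψ (B y)) (diag (l ^ 2) l (deriv f₂ 0, 1)) 0 := by
      have h' := hψ.hasFDerivAt
      rw [← hB0] at h'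
      exact h'.comp_hasDerivAt 0 dB
    have d2 : HasDerivAt (fun y => (ψ (B y)).2) l 0 := by
      have := (hasFDerivAt_snd (𝕜 := ℝ) (p := ψ (B 0))).comp_hasDerivAt (0:ℝ) dψ
      convert! this using 1
      simp [diag_apply]
    have := d2.tendsto_slope
    refine this.congr' ?_
    filter_upwards with y
    rw [slope_def_field, hB0, hψ0]; simp
  have hd' : ∀ᶠ y in 𝓝[≠] (0:ℝ), D y = y ^ m * g y := hd.filter_mono nhdsWithin_le_nhds
  have hdB : ∀ᶠ y in 𝓝[≠] (0:ℝ), D (ψ (B y)).2 = (ψ (B y)).2 ^ m * g (ψ (B y)).2 :=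
    (tB2.eventually hd).filter_mono nhdsWithin_le_nhds
  have r2 : Tendsto (fun y => D y / y ^ m) (𝓝[≠] 0) (𝓝 (g 0)) := by
    refine (hg.tendsto.mono_left nhdsWithin_le_nhds).congr' ?_
    filter_upwards [hd', self_mem_nhdsWithin] with y e hy
    have hy : y ≠ 0 := hy
    rw [e]; field_simp
  have r3 : Tendsto (fun y => D (ψ (B y)).2 / y ^ m) (𝓝[≠] 0) (𝓝 (l ^ m * g 0)) := by
    refine ((r1.pow m).mul (hg.tendsto.comp (tB2.mono_left nhdsWithin_le_nhds))).congr' ?_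
    filter_upwards [hdB] with y e
    rw [e, div_pow]; simp only [Function.comp]; ring
  have r4 : Tendsto (fun y => (D (ψ (B y)).2 - l ^ 2 * D y) / y ^ m) (𝓝[≠] 0)
      (𝓝 (l ^ m * g 0 - l ^ 2 * g 0)) := by
    refine (r3.sub (r2.const_mul (l ^ 2))).congr fun y => ?_
    ring
  have r5 : (fun y => D y) =O[𝓝[≠] 0] fun y => y ^ m := by
    refine isBigO_of_div_tendsto_nhds ?_ _ r2
    filter_upwards [self_mem_nhdsWithin] with y hy h0
    exact absurd h0 (pow_ne_zero _ hy)
  have r6 : Tendsto (fun y => (D (ψ (B y)).2 - l ^ 2 * D y) / y ^ m) (𝓝[≠] 0) (𝓝 0) :=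
    ((s5.mono nhdsWithin_le_nhds).trans_isBigO r5).tendsto_div_nhds_zero
  have e := tendsto_nhds_unique r4 r6
  have e' : l ^ m = l ^ 2 := by
    have : (l ^ m - l ^ 2) * g 0 = 0 := by linarith
    rcases mul_eq_zero.mp this with h | h
    · linarith
    · exact absurd h hg0
  exact pow_right_injective₀ (by linarith) hl.ne' e'

end expansion

section coords
open Filter Topology
variable {q v₁ v₂ kP kQ : ℝ} {K L : Set (ℝ × ℝ)}

theorem Sol.tauP (h : Sol q v₁ v₂ kP kQ K) : 1 / (kP * |v₁ - 0| - 1) = v₂ / (-v₁) := by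
  have a := h.hv₁; have b := h.hq; have c := h.hv₂
  have ht : 0 < v₂ / (-v₁) := div_pos (by linarith) (by linarith)
  have e : opp 0 (v₂ / (-v₁)) (v₁, 0) = (v₂, 0) := by
    have : v₁ ≠ 0 := a.ne
    ext <;> simp [opp]
    field_simp
  have := h.cP.chord (v₁, 0) ((h.vert _).mpr (Or.inl rfl)) _ ht
    (by rw [e]; exact (h.vert _).mpr (Or.inr rfl))
  rw [Nm_axis] at this
  have hN : 0 < |v₁ - 0| := abs_pos.mpr (by linarith)
  rw [← this]
  set t := v₂ / (-v₁)
  have : (1 / |v₁ - 0| + 1 / (t * |v₁ - 0|)) * |v₁ - 0| - 1 = 1 / t := by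
    field_simp; ring
  rw [this, one_div_one_div]

theorem Sol.tauQ (h : Sol q v₁ v₂ kP kQ K) : 1 / (kQ * |v₂ - q| - 1) = (q - v₁) / (v₂ - q) := by
  have a := h.hv₁; have b := h.hq; have c := h.hv₂
  have hvq : 0 < v₂ - q := by linarith
  have ht : 0 < (q - v₁) / (v₂ - q) := div_pos (by linarith) (by linarith)
  have e : opp q ((q - v₁) / (v₂ - q)) (v₂, 0) = (v₁, 0) := by
    ext <;> simp [opp]
    field_simp; ring
  have := h.cQ.chord (v₂, 0) ((h.vert _).mpr (Or.inr rfl)) _ ht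
    (by rw [e]; exact (h.vert _).mpr (Or.inl rfl))
  rw [Nm_axis] at this
  have hN : 0 < |v₂ - q| := abs_pos.mpr (by linarith)
  rw [← this]
  set t := (q - v₁) / (v₂ - q)
  have : (1 / |v₂ - q| + 1 / (t * |v₂ - q|)) * |v₂ - q| - 1 = 1 / t := by
    field_simp; ring
  rw [this, one_div_one_div]

theorem Sol.subset (hK : Sol q v₁ v₂ kP kQ K) (hL : Sol q v₁ v₂ kP kQ L) :
    frontier L ⊆ frontier K := by
  have a := hK.hv₁; have b := hK.hq; have c := hK.hv₂
  have hvq : 0 < v₂ - q := by linarith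
  have hV1 : (v₁, (0:ℝ)) ∈ frontier K := (hK.vert _).mpr (Or.inl rfl)
  have hV2 : (v₂, (0:ℝ)) ∈ frontier K := (hK.vert _).mpr (Or.inr rfl)
  set ψ : ℝ × ℝ → ℝ × ℝ := fun A => phi q kQ (phi 0 kP A) with hψd
  have p1 : phi 0 kP (v₁, 0) = (v₂, 0) := by
    rw [phi, Nm_axis, hK.tauP]
    have : v₁ ≠ 0 := a.ne
    ext <;> simp [opp]
    field_simp
  have p2 : phi q kQ (v₂, 0) = (v₁, 0) := by
    rw [phi, Nm_axis, hK.tauQ]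
    ext <;> simp [opp]
    field_simp; ring
  have hψ0 : ψ (v₁, 0) = (v₁, 0) := by simp only [hψd, p1, p2]
  set l : ℝ := ((q - v₁) / (v₂ - q)) * (v₂ / (-v₁)) with hl
  have hl1 : 1 < l := by
    rw [hl, div_mul_div_comm, one_lt_div (mul_pos hvq (by linarith))]
    nlinarith [mul_pos b (show 0 < v₂ - v₁ by linarith)]
  have dP := phi_strict (p := 0) (k := kP) (v := v₁) a.ne (by
    have := (hK.cP.phi_mem hV1).1
    rw [Nm_axis] at this; linarith)
  have dQ := phi_strict (p := q) (k := kQ) (v := v₂) c.ne' (by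
    have := (hK.cQ.phi_mem hV2).1
    rw [Nm_axis] at this; linarith)
  rw [hK.tauP] at dP
  rw [hK.tauQ, ← p1] at dQ
  have dψ : HasStrictFDerivAt ψ (diag (l ^ 2) l) (v₁, (0:ℝ)) := by
    have := dQ.comp (v₁, (0:ℝ)) dP
    refine HasStrictFDerivAt.congr_fderiv this ?_
    ext <;> simp [diag, hl] <;> ring
  have inv : ∀ {M : Set (ℝ × ℝ)}, Sol q v₁ v₂ kP kQ M → ∀ {f : ℝ → ℝ}, ContinuousAt f 0 →
      f 0 = v₁ → (∀ᶠ y in 𝓝 (0:ℝ), (f y, y) ∈ frontier M) →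
      ∀ᶠ y in 𝓝 (0:ℝ), (ψ (f y, y)).1 = f (ψ (f y, y)).2 := by
    intro M hM f hf hf0 hfr
    have t1 : Tendsto (fun y => ψ (f y, y)) (𝓝 0) (𝓝 (v₁, 0)) := by
      have h1 : Tendsto (fun y : ℝ => (f y, y)) (𝓝 0) (𝓝 (v₁, 0)) := by
        rw [← hf0]; exact hf.prodMk continuousAt_id
      have h2 := dψ.hasFDerivAt.continuousAt
      rw [ContinuousAt, hψ0] at h2
      exact h2.comp h1
    filter_upwards [t1.eventually (hM.side_graph hf hf0 hfr), hfr] with y h1 h2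
    rw [(side_eq_zero hM.cP.compact.isClosed).mpr
      (hM.cQ.phi_mem (hM.cP.phi_mem h2).2).2] at h1
    linarith [sign_eq_zero_iff.mp h1.symm]
  obtain ⟨f₁, a1, f10, fr1⟩ := hK.graph
  obtain ⟨f₂, a2, f20, fr2⟩ := hL.graph
  have c2 : Tendsto (fun A : ℝ × ℝ => A.2) (𝓝 (v₁, (0:ℝ))) (𝓝 0) := continuous_snd.tendsto _
  have sK := hK.side_graph a1.continuousAt f10 fr1
  have sL := hL.side_graph a2.continuousAt f20 fr2
  have main : ∀ᶠ A in 𝓝 (v₁, (0:ℝ)), A ∈ frontier L →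
      side K A = SignType.sign (-(f₁ A.2 - f₂ A.2)) := by
    filter_upwards [sK, sL] with A h1 h2 h3
    rw [(side_eq_zero hL.cP.compact.isClosed).mpr h3] at h2
    rw [h1]; congr 1
    linarith [sign_eq_zero_iff.mp h2.symm]
  by_cases hz : ∀ᶠ y in 𝓝 (0:ℝ), (f₁ - f₂) y = 0
  · refine const_side hK hL 0 ?_
    filter_upwards [main, c2.eventually hz] with A h1 h2 h3 _
    have h2 : f₁ A.2 - f₂ A.2 = 0 := h2
    rw [h1 h3, h2]; simp
  · obtain ⟨m, g, hg, hg0, hd⟩ := (a1.sub a2).exists_eventuallyEq_pow_smul_nonzero_iff.mpr hz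
    have hd' : ∀ᶠ y in 𝓝 (0:ℝ), f₁ y - f₂ y = y ^ m * g y := by
      filter_upwards [hd] with y hy
      simpa using hy
    have hm : m = 2 := order_two hl1 dψ hψ0 a1 a2 f10 f20 (inv hK a1.continuousAt f10 fr1)
      (inv hL a2.continuousAt f20 fr2) hg.continuousAt hg0 hd'
    subst hm
    rcases lt_or_gt_of_ne hg0 with hneg | hpos
    · refine const_side hK hL 1 ?_
      filter_upwards [main, c2.eventually hd',
        c2.eventually (hg.continuousAt.eventually (gt_mem_nhds hneg))] with A h1 h2 h4 h3 h5
      rw [h1 h3, h2, sign_pos]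
      have := mul_neg_of_pos_of_neg (pow_pos (abs_pos.mpr h5) 2) h4
      rw [sq_abs] at this; linarith
    · refine const_side hK hL (-1) ?_
      filter_upwards [main, c2.eventually hd',
        c2.eventually (hg.continuousAt.eventually (lt_mem_nhds hpos))] with A h1 h2 h4 h3 h5
      rw [h1 h3, h2, sign_neg]
      have := mul_pos (pow_pos (abs_pos.mpr h5) 2) h4
      rw [sq_abs] at this; linarith

end coords

section transport
open Filter Topology

/-- Rectangular coordinates with origin `P` and unit direction `(a, b)`. -/
def coordH (P : Plane) (a b : ℝ) (h : a ^ 2 + b ^ 2 = 1) : (ℝ × ℝ) ≃ₜ Plane where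
  toFun A := !₂[P 0 + A.1 * a - A.2 * b, P 1 + A.1 * b + A.2 * a]
  invFun B := ((B 0 - P 0) * a + (B 1 - P 1) * b, -((B 0 - P 0) * b) + (B 1 - P 1) * a)
  left_inv A := by
    ext <;> simp
    · linear_combination A.1 * h
    · linear_combination A.2 * h
  right_inv B := by
    ext i
    fin_cases i <;> simp
    · linear_combination (B 0 - P 0) * h
    · linear_combination (B 1 - P 1) * h
  continuous_toFun := by fun_prop
  continuous_invFun := by fun_prop

variable {P : Plane} {a b : ℝ} {hab : a ^ 2 + b ^ 2 = 1}

theorem coordH_apply (A : ℝ × ℝ) : coordH P a b hab A =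
    P + A.1 • (!₂[a, b] : Plane) + A.2 • (!₂[-b, a] : Plane) := by
  ext i
  fin_cases i <;> simp [coordH] <;> ring

theorem coordH_dist (A B : ℝ × ℝ) : dist (coordH P a b hab A) (coordH P a b hab B) =
    √((A.1 - B.1) ^ 2 + (A.2 - B.2) ^ 2) := by
  rw [EuclideanSpace.dist_eq]
  congr 1
  simp [coordH, Real.dist_eq, sq_abs]
  linear_combination ((A.1 - B.1) ^ 2 + (A.2 - B.2) ^ 2) * hab

theorem coordH_combo (A B : ℝ × ℝ) {s t : ℝ} (h : s + t = 1) :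
    coordH P a b hab (s • A + t • B) = s • coordH P a b hab A + t • coordH P a b hab B := by
  obtain rfl : s = 1 - t := by linarith
  ext i
  fin_cases i <;> simp [coordH] <;> ring

theorem chord_of {K : Set Plane} (hK : IsCompact K) (hc : Convex ℝ K) {p k : ℝ}
    (hi : coordH P a b hab (p, 0) ∈ interior K)
    (hk : ∀ A B : Plane, A ∈ frontier K → B ∈ frontier K →
      coordH P a b hab (p, 0) ∈ openSegment ℝ A B →
      1 / dist A (coordH P a b hab (p, 0)) + 1 / dist B (coordH P a b hab (p, 0)) = k) :
    Chord p k (coordH P a b hab ⁻¹' K) where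
  compact := (coordH P a b hab).isCompact_preimage.mpr hK
  convex := by
    intro A hA B hB s t hs ht hst
    simp only [mem_preimage] at *
    rw [coordH_combo _ _ hst]
    exact hc hA hB hs ht hst
  inter := by rw [← Homeomorph.preimage_interior]; exact hi
  chord := by
    intro A hA t ht hB
    rw [← Homeomorph.preimage_frontier] at hA hB
    have h1 := hk _ _ hA hB ⟨t / (1 + t), 1 / (1 + t), by positivity, by positivity,
      by field_simp; ring, ?_⟩
    · rw [coordH_dist, coordH_dist] at h1
      have e1 : √((A.1 - (p, (0:ℝ)).1) ^ 2 + (A.2 - (p, (0:ℝ)).2) ^ 2) = Nm p A := by simp [Nm]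
      have e2 : √(((opp p t A).1 - (p, (0:ℝ)).1) ^ 2 + ((opp p t A).2 - (p, (0:ℝ)).2) ^ 2) =
          t * Nm p A := by
        unfold Nm opp
        rw [← Real.sqrt_sq ht.le, ← Real.sqrt_mul (sq_nonneg t), Real.sqrt_sq ht.le]
        congr 1; simp; ring
      rwa [e1, e2] at h1
    · rw [← coordH_combo _ _ (by field_simp; ring)]
      congr 1
      ext <;> simp [opp] <;> field_simp <;> ring

theorem graph_of {K : Set Plane} (hK : IsCompact K) (hc : Convex ℝ K) {v : ℝ}
    (hP : P ∈ interior K) (hV : coordH P a b hab (v, 0) ∈ frontier K)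
    (han : IsAnalyticBoundary (frontier K)) :
    ∃ f : ℝ → ℝ, AnalyticAt ℝ f 0 ∧ f 0 = v ∧
      ∀ᶠ y in 𝓝 (0:ℝ), (f y, y) ∈ frontier (coordH P a b hab ⁻¹' K) := by
  obtain ⟨ε, hε, γ, hγ, hγ0, hγ', U, -, -, hU⟩ := han _ hV
  have hγa : AnalyticAt ℝ γ 0 := hγ 0 ⟨by linarith, hε⟩
  have hmem : ∀ᶠ s in 𝓝 (0:ℝ), γ s ∈ frontier K := by
    filter_upwards [Ioo_mem_nhds (neg_lt_zero.mpr hε) hε] with s hs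
    have : γ s ∈ γ '' Ioo (-ε) ε := mem_image_of_mem γ hs
    rw [hU] at this
    exact this.1
  have g0 : AnalyticAt ℝ (fun s => γ s 0) 0 :=
    ((EuclideanSpace.proj (𝕜 := ℝ) (0 : Fin 2) : Plane →L[ℝ] ℝ).analyticAt _).comp hγa
  have g1 : AnalyticAt ℝ (fun s => γ s 1) 0 :=
    ((EuclideanSpace.proj (𝕜 := ℝ) (1 : Fin 2) : Plane →L[ℝ] ℝ).analyticAt _).comp hγa
  set x : ℝ → ℝ := fun s => (γ s 0 - P 0) * a + (γ s 1 - P 1) * b with hx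
  set y : ℝ → ℝ := fun s => -((γ s 0 - P 0) * b) + (γ s 1 - P 1) * a with hy
  have ax : AnalyticAt ℝ x 0 := by
    simp only [hx]; fun_prop
  have ay : AnalyticAt ℝ y 0 := by
    simp only [hy]; fun_prop
  have hxy : ∀ s, coordH P a b hab (x s, y s) = γ s := fun s =>
    (coordH P a b hab).apply_symm_apply (γ s)
  have h00 : (x 0, y 0) = (v, 0) := by
    apply (coordH P a b hab).injective
    rw [hxy, hγ0]
  have hx0 : x 0 = v := congrArg Prod.fst h00
  have hy0 : y 0 = 0 := congrArg Prod.snd h00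
  have dγ : HasDerivAt γ (deriv x 0 • (!₂[a, b] : Plane) + deriv y 0 • (!₂[-b, a] : Plane)) 0 := by
    have h1 := ((ax.differentiableAt.hasDerivAt.smul_const (!₂[a, b] : Plane)).const_add P).add
      (ay.differentiableAt.hasDerivAt.smul_const (!₂[-b, a] : Plane))
    refine h1.congr_of_eventuallyEq (Eventually.of_forall fun s => ?_)
    rw [← hxy s, coordH_apply]; rfl
  have hy' : deriv y 0 ≠ 0 := by
    intro hz
    rw [hz, zero_smul, add_zero] at dγ
    have hVi : coordH P a b hab (v, 0) ∉ interior K := hV.2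
    obtain ⟨ℓ, hℓ⟩ := geometric_hahn_banach_open_point hc.interior isOpen_interior hVi
    have hle : ∀ A ∈ frontier K, ℓ A ≤ ℓ (coordH P a b hab (v, 0)) := by
      intro A hA
      have h1 : A ∈ closure (interior K) := by
        rw [hc.closure_interior_eq_closure_of_nonempty_interior ⟨P, hP⟩]
        exact frontier_subset_closure hA
      exact closure_minimal (fun z hz => (hℓ z hz).le)
        (isClosed_le ℓ.continuous continuous_const) h1
    have hmax : IsLocalMax (fun s => ℓ (γ s)) 0 := by
      filter_upwards [hmem] with s hs
      simp only [hγ0]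
      exact hle _ hs
    have hd : HasDerivAt (fun s => ℓ (γ s)) (ℓ (deriv x 0 • (!₂[a, b] : Plane))) 0 :=
      ℓ.hasFDerivAt.comp_hasDerivAt 0 dγ
    have h0 := hmax.hasDerivAt_eq_zero hd
    rw [map_smul, smul_eq_mul] at h0
    have hPl := hℓ P hP
    rw [coordH_apply] at hPl
    simp only [zero_smul, add_zero, map_add, map_smul, smul_eq_mul] at hPl
    rcases mul_eq_zero.mp h0 with h | h
    · rw [h, zero_smul] at dγ
      exact hγ' dγ.deriv
    · rw [h] at hPl; simp at hPl
  set r := ay.hasStrictDerivAt.localInverse _ _ _ hy' with hr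
  have ar : AnalyticAt ℝ r (y 0) := ay.analyticAt_localInverse hy'
  have hr0 : r (y 0) = 0 := HasStrictFDerivAt.localInverse_apply_image ..
  have hri : ∀ᶠ t in 𝓝 (y 0), y (r t) = t := HasStrictDerivAt.eventually_right_inverse ..
  rw [hy0] at ar hr0 hri
  refine ⟨fun t => x (r t), ?_, by simp only [hr0, hx0], ?_⟩
  · exact AnalyticAt.comp' (by rw [hr0]; exact ax) ar
  · have h1 : Tendsto r (𝓝 0) (𝓝 0) := by
      have := ar.continuousAt
      rwa [ContinuousAt, hr0] at this
    filter_upwards [hri, h1.eventually hmem] with t ht hm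
    rw [← Homeomorph.preimage_frontier, mem_preimage]
    have := hxy (r t)
    rw [ht] at this
    rwa [this]

theorem sol_of {K : Set Plane} {q v₁ v₂ : ℝ} {kP kQ : ℝ} (hq : 0 < q) (hv₁ : v₁ < 0) (hv₂ : q < v₂)
    {Q V₁ V₂ : Plane} (eQ : Q = coordH P a b hab (q, 0))
    (e1 : V₁ = coordH P a b hab (v₁, 0)) (e2 : V₂ = coordH P a b hab (v₂, 0))
    (hkP : kP = 1 / dist V₁ P + 1 / dist V₂ P) (hkQ : kQ = 1 / dist V₁ Q + 1 / dist V₂ Q)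
    (h : IsAnalyticSolution (fun a b => 1 / a + 1 / b) P Q V₁ V₂ K) :
    Sol q v₁ v₂ kP kQ (coordH P a b hab ⁻¹' K) := by
  obtain ⟨hK, hc, -, hP, hQ, ⟨k1, hk1⟩, ⟨k2, hk2⟩, hV, han⟩ := h
  have eP : P = coordH P a b hab (0, 0) := by rw [coordH_apply]; simp
  have hV1 : V₁ ∈ frontier K := by
    have : V₁ ∈ ({V₁, V₂} : Set Plane) := by simp
    rw [← hV] at this; exact this.2
  have hV2 : V₂ ∈ frontier K := by
    have : V₂ ∈ ({V₁, V₂} : Set Plane) := by simp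
    rw [← hV] at this; exact this.2
  have seg : ∀ p, v₁ < p → p < v₂ → coordH P a b hab (p, 0) ∈ openSegment ℝ V₁ V₂ := by
    intro p h1 h2
    have hd : 0 < v₂ - v₁ := by linarith
    refine ⟨(v₂ - p) / (v₂ - v₁), (p - v₁) / (v₂ - v₁), div_pos (by linarith) hd,
      div_pos (by linarith) hd, by field_simp; ring, ?_⟩
    rw [e1, e2, ← coordH_combo _ _ (by field_simp; ring)]
    congr 1
    ext <;> simp
    field_simp; ring
  have k1e : k1 = kP := by
    rw [hkP]; exact (hk1 V₁ V₂ hV1 hV2 (by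
      have := seg 0 hv₁ (by linarith)
      rwa [← eP] at this)).symm
  have k2e : k2 = kQ := by
    rw [hkQ]; exact (hk2 V₁ V₂ hV1 hV2 (by
      have := seg q (by linarith) hv₂
      rwa [← eQ] at this)).symm
  subst k1e k2e
  refine ⟨?_, ?_, hv₁, hq, hv₂, ?_, ?_⟩
  · apply chord_of hK hc
    · rwa [← eP]
    · rwa [← eP]
  · apply chord_of hK hc
    · rwa [← eQ]
    · rwa [← eQ]
  · intro t
    rw [← Homeomorph.preimage_frontier, mem_preimage]
    have hm : coordH P a b hab (t, 0) ∈ (affineSpan ℝ ({P, Q} : Set Plane) : Set Plane) := by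
      have h1 : coordH P a b hab (t, 0) = AffineMap.lineMap P Q (t / q) := by
        rw [AffineMap.lineMap_apply, eQ, coordH_apply, coordH_apply]
        simp [smul_smul]
        rw [div_mul_cancel₀ _ hq.ne', add_comm]
      rw [h1]
      exact AffineMap.lineMap_mem_affineSpan_pair _ _ _
    have : coordH P a b hab (t, 0) ∈ frontier K ↔
        coordH P a b hab (t, 0) ∈ ({V₁, V₂} : Set Plane) := by
      rw [← hV]; exact ⟨fun h => ⟨hm, h⟩, fun h => h.2⟩
    rw [this, mem_insert_iff, mem_singleton_iff, e1, e2]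
    simp
  · exact graph_of hK hc hP (by rwa [← e1]) han

end transport

/-- Uniqueness of analytic solutions of the Equireciprocal Problem
(`F(a,b) = 1/a + 1/b`). -/
theorem uniqueness_equireciprocal
    (V₁ P Q V₂ : Plane)
    (hne : V₁ ≠ P ∧ V₁ ≠ Q ∧ V₁ ≠ V₂ ∧ P ≠ Q ∧ P ≠ V₂ ∧ Q ≠ V₂)
    (hcol : Collinear ℝ ({V₁, P, Q, V₂} : Set Plane))
    (hPseg : P ∈ openSegment ℝ V₁ Q) (hQseg : Q ∈ openSegment ℝ P V₂)
    (K₁ K₂ : Set Plane)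
    (h₁ : IsAnalyticSolution (fun a b => 1 / a + 1 / b) P Q V₁ V₂ K₁)
    (h₂ : IsAnalyticSolution (fun a b => 1 / a + 1 / b) P Q V₁ V₂ K₂) :
    frontier K₁ = frontier K₂ := by
  have hPQ : P ≠ Q := hne.2.2.2.1
  set q := dist Q P with hq
  have hq0 : 0 < q := dist_pos.mpr hPQ.symm
  have hqs : q ^ 2 = (Q 0 - P 0) ^ 2 + (Q 1 - P 1) ^ 2 := by
    rw [hq, EuclideanSpace.dist_eq, Real.sq_sqrt (by positivity)]
    simp [Real.dist_eq, sq_abs]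
  have hab : ((Q 0 - P 0) / q) ^ 2 + ((Q 1 - P 1) / q) ^ 2 = 1 := by
    field_simp; linarith
  set H := coordH P ((Q 0 - P 0) / q) ((Q 1 - P 1) / q) hab with hH
  have hline : ∀ t : ℝ, H (t * q, 0) = P + t • (Q - P) := by
    intro t
    ext i
    fin_cases i <;> simp [hH, coordH] <;> field_simp
  have eQ : Q = H (q, 0) := by
    have := hline 1
    simpa using this.symm
  obtain ⟨s, t, hs, ht, hst, e⟩ := hPseg
  obtain ⟨s', t', hs', ht', hst', e'⟩ := hQseg
  have e1 : V₁ = H (-(t / s) * q, 0) := by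
    rw [hline]
    have h1 : V₁ = (1 / s) • (s • V₁ + t • Q) - (t / s) • Q := by
      rw [smul_add, smul_smul, smul_smul, one_div_mul_cancel hs.ne', one_smul,
        show 1 / s * t = t / s by ring]
      abel
    rw [e] at h1
    have h2 : 1 / s = 1 + t / s := by field_simp; linarith
    rw [h1, h2]; module
  have e2 : V₂ = H ((1 / t') * q, 0) := by
    rw [hline]
    have h1 : V₂ = (1 / t') • (s' • P + t' • V₂) - (s' / t') • P := by
      rw [smul_add, smul_smul, smul_smul, one_div_mul_cancel ht'.ne', one_smul,
        show 1 / t' * s' = s' / t' by ring]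
      abel
    rw [e'] at h1
    have h2 : s' / t' = 1 / t' - 1 := by field_simp; linarith
    rw [h2] at h1
    nth_rewrite 1 [h1]
    module
  have hv1 : -(t / s) * q < 0 := by
    have : 0 < t / s * q := by positivity
    linarith
  have hv2 : q < (1 / t') * q := by
    have : 1 < 1 / t' := by rw [one_lt_div ht']; linarith
    nlinarith
  have S1 := sol_of hq0 hv1 hv2 eQ e1 e2 rfl rfl h₁
  have S2 := sol_of hq0 hv1 hv2 eQ e1 e2 rfl rfl h₂
  have key : frontier (H ⁻¹' K₁) = frontier (H ⁻¹' K₂) :=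
    Subset.antisymm (S2.subset S1) (S1.subset S2)
  rw [← Homeomorph.preimage_frontier, ← Homeomorph.preimage_frontier] at key
  exact H.surjective.preimage_injective key
end
end

section
/- Let V₁, P, Q, V₂ be four distinct collinear points of ℝ², with P in the open segment from V₁ to Q and Q in the open segment from P to V₂, and suppose additionally that dist(V₁,Q) = dist(V₂,P). For the function F(a,b) = 1/a + 1/b (equireciprocal points), the unique analytic solution of the interior F-chordal problem with equireciprocal points P, Q and vertices V₁, V₂ is the ellipse with foci P, Q and major axis the segment V₁V₂: if K is any analytic solution with these data, then frontier K = { X ∈ ℝ² : dist(X,P) + dist(X,Q) = dist(V₁,V₂) }. -/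
open Set

noncomputable section

open Filter Topology


lemma sqrt_diff (x y : ℝ) :
    √(1 + x ^ 2) - √(1 + y ^ 2) = (x - y) * ((x + y) / (√(1 + x ^ 2) + √(1 + y ^ 2))) := by
  have hx : 0 < √(1 + x ^ 2) := Real.sqrt_pos.2 (by positivity)
  have hy : 0 < √(1 + y ^ 2) := Real.sqrt_pos.2 (by positivity)
  have h1 : √(1 + x ^ 2) ^ 2 = 1 + x ^ 2 := Real.sq_sqrt (by positivity)
  have h2 : √(1 + y ^ 2) ^ 2 = 1 + y ^ 2 := Real.sq_sqrt (by positivity)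
  field_simp
  nlinarith

lemma abs_lt_sqrt (x : ℝ) : |x| < √(1 + x ^ 2) := by
  apply Real.lt_sqrt_of_sq_lt
  rw [sq_abs]; linarith

lemma slope_abs_lt (x y : ℝ) : |(x + y) / (√(1 + x ^ 2) + √(1 + y ^ 2))| < 1 := by
  have hx := abs_lt_sqrt x
  have hy := abs_lt_sqrt y
  have h := abs_add_le x y
  have hp : 0 < √(1 + x ^ 2) + √(1 + y ^ 2) := by
    have := abs_nonneg x; have := abs_nonneg y; linarith
  rw [abs_div, abs_of_pos hp, div_lt_one hp]
  linarith

lemma slope_tendsto {x y : ℝ → ℝ} (hx : Tendsto x atTop atTop) (hy : Tendsto y atTop atTop) :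
    Tendsto (fun t => (x t + y t) / (√(1 + x t ^ 2) + √(1 + y t ^ 2))) atTop (𝓝 1) := by
  have hxy : Tendsto (fun t => 1 - 2 / (x t + y t)) atTop (𝓝 1) := by
    have := (tendsto_const_nhds (x := (2:ℝ))).div_atTop (hx.atTop_add_atTop hy)
    simpa using (tendsto_const_nhds (x := (1:ℝ))).sub this
  refine tendsto_of_tendsto_of_tendsto_of_le_of_le' hxy tendsto_const_nhds ?_ ?_
  · filter_upwards [hx.eventually_gt_atTop 1, hy.eventually_gt_atTop 1] with t h1 h2
    have a1 : √(1 + x t ^ 2) ≤ x t + 1 := Real.sqrt_le_iff.2 ⟨by linarith, by nlinarith⟩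
    have a2 : √(1 + y t ^ 2) ≤ y t + 1 := Real.sqrt_le_iff.2 ⟨by linarith, by nlinarith⟩
    have b1 := (le_abs_self _).trans (abs_lt_sqrt (x t)).le
    have b2 := (le_abs_self _).trans (abs_lt_sqrt (y t)).le
    have : (x t + y t) / (x t + y t + 2) ≤ (x t + y t) / (√(1 + x t ^ 2) + √(1 + y t ^ 2)) := by
      apply div_le_div_of_nonneg_left <;> linarith
    refine le_trans ?_ this
    have : 0 < x t + y t := by linarith
    rw [sub_le_iff_le_add, div_add_div _ _ (by positivity) (by positivity), le_div_iff₀ (by positivity)]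
    nlinarith
  · exact Eventually.of_forall fun t => (le_abs_self _).trans (slope_abs_lt _ _).le

lemma sqrt_div_tendsto : Tendsto (fun t : ℝ => √(1 + t ^ 2) / t) atTop (𝓝 1) := by
  have h : Tendsto (fun t : ℝ => √((t⁻¹) ^ 2 + 1)) atTop (𝓝 1) := by
    have := ((tendsto_inv_atTop_zero (𝕜 := ℝ)).pow 2).add_const 1
    simpa using this.sqrt
  refine h.congr' ?_
  filter_upwards [eventually_gt_atTop 0] with t ht
  rw [eq_div_iff ht.ne']
  nth_rw 2 [← Real.sqrt_sq ht.le]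
  rw [← Real.sqrt_mul (by positivity)]
  congr 1; field_simp

/-- The dynamical core of the argument. -/
theorem core (C S : ℝ) (hS : 0 < S) (hCS : C ^ 2 = S ^ 2 + 1) (hC : 0 < C) (G H D : ℝ → ℝ)
    (hG : Continuous G) (δ : ℝ) (hδ : 0 < δ)
    (hGd : ∀ t, δ ≤ 2 * S * √(1 + t ^ 2) - G t) (hH : ∀ s, 0 ≤ H s)
    (h2 : ∀ s, G (s + H s) = H s)
    (h3 : ∀ t, 2 * S * √(1 + (t + (2 * S * √(1 + t ^ 2) - G t)) ^ 2)
      - H (t + (2 * S * √(1 + t ^ 2) - G t)) = 2 * S * √(1 + t ^ 2) - G t)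
    (hD : AnalyticAt ℝ D 0) (hD0 : D 0 = 0)
    (hGD : ∀ t, t ≠ 0 → G t - S * √(1 + t ^ 2) + (C - 1) * t = t * D (t⁻¹)) :
    ∀ t, G t = S * √(1 + t ^ 2) - (C - 1) * t := by
  have hSC : S < C := by nlinarith
  have hinv : (C - S) * (C + S) = 1 := by nlinarith
  set f : ℝ → ℝ := fun t => G t - S * √(1 + t ^ 2) + (C - 1) * t with hf
  set U : ℝ → ℝ := fun t => C * t + S * √(1 + t ^ 2) with hU
  set V : ℝ → ℝ := fun t => C * t - S * √(1 + t ^ 2) with hV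
  set Φ : ℝ → ℝ := fun t => (U t - f t) + H (U t - f t) with hΦ
  have hUB : ∀ t, U t - f t = t + (2 * S * √(1 + t ^ 2) - G t) := by
    intro t; simp only [hU, hf]; ring
  have hVU : ∀ t, V (U t) = t := by
    intro t
    have hN : √(1 + t ^ 2) ^ 2 = 1 + t ^ 2 := Real.sq_sqrt (by positivity)
    have hn := abs_lt_sqrt t
    have : √(1 + (U t) ^ 2) = C * √(1 + t ^ 2) + S * t := by
      rw [Real.sqrt_eq_iff_mul_self_eq (by positivity)]
      · simp only [hU]; nlinarith
      · have hp : 0 ≤ (C - S) * √(1 + t ^ 2) := mul_nonneg (by linarith) (Real.sqrt_nonneg _)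
        have : 0 ≤ S * (√(1 + t ^ 2) + t) := mul_nonneg hS.le (by linarith [neg_abs_le t])
        linarith
    simp only [hV, this]; simp only [hU]; linear_combination t * hCS
  have hUV : ∀ t, U (V t) = t := by
    intro t
    have hN : √(1 + t ^ 2) ^ 2 = 1 + t ^ 2 := Real.sq_sqrt (by positivity)
    have hn := abs_lt_sqrt t
    have : √(1 + (V t) ^ 2) = C * √(1 + t ^ 2) - S * t := by
      rw [Real.sqrt_eq_iff_mul_self_eq (by positivity)]
      · simp only [hV]; nlinarith
      · have hp : 0 ≤ (C - S) * √(1 + t ^ 2) := mul_nonneg (by linarith) (Real.sqrt_nonneg _)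
        have : 0 ≤ S * (√(1 + t ^ 2) - t) := mul_nonneg hS.le (by linarith [le_abs_self t])
        linarith
    simp only [hU, this]; simp only [hV]; linear_combination t * hCS
  have hVPhi : ∀ t, V (Φ t) - f (Φ t) = U t - f t := by
    intro t
    have := h2 (U t - f t)
    have e : G (Φ t) = H (U t - f t) := this
    have : V (Φ t) - f (Φ t) = Φ t - G (Φ t) := by simp only [hV, hf]; ring
    rw [this, e]; simp only [hΦ]; ring
  set F1 : ℝ → ℝ := fun t => C - S * ((U t + (U t - f t)) /
    (√(1 + (U t) ^ 2) + √(1 + (U t - f t) ^ 2))) with hF1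
  set F2 : ℝ → ℝ := fun t => C + S * ((V (Φ t) + (V (Φ t) - f (Φ t))) /
    (√(1 + (V (Φ t)) ^ 2) + √(1 + (V (Φ t) - f (Φ t)) ^ 2))) with hF2
  have hF1p : ∀ t, 0 < F1 t := by
    intro t
    have := abs_lt.1 (slope_abs_lt (U t) (U t - f t))
    simp only [hF1]; nlinarith
  have hF2p : ∀ t, 0 < F2 t := by
    intro t
    have := abs_lt.1 (slope_abs_lt (V (Φ t)) (V (Φ t) - f (Φ t)))
    simp only [hF2]; nlinarith
  have hstar : ∀ t, f t * F1 t = f (Φ t) * F2 t := by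
    intro t
    have e1 : f t * F1 t = V (U t) - V (U t - f t) := by
      have := sqrt_diff (U t) (U t - f t)
      simp only [hF1]; simp only [hV]
      linear_combination (-S) * (- this)
    have e2 : f (Φ t) * F2 t = U (V (Φ t)) - U (V (Φ t) - f (Φ t)) := by
      have := sqrt_diff (V (Φ t)) (V (Φ t) - f (Φ t))
      simp only [hF2]; simp only [hU]
      linear_combination (-S) * this
    rw [e1, e2, hVU, hUV, hVPhi]
    have h := h3 t
    rw [← hUB] at h
    have h' := hUB t
    simp only [hΦ]
    simp only [hV]
    have : U (U t - f t) = C * (U t - f t) + S * √(1 + (U t - f t) ^ 2) := rfl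
    rw [this]
    linarith
  have hz : ∀ t, f t = 0 ↔ f (Φ t) = 0 := by
    intro t
    have := hstar t
    constructor
    · intro h; rw [h, zero_mul] at this
      exact (mul_eq_zero.1 this.symm).resolve_right (hF2p t).ne'
    · intro h; rw [h, zero_mul] at this
      exact (mul_eq_zero.1 this).resolve_right (hF1p t).ne'
  have hstep : ∀ t, t + δ ≤ Φ t := by
    intro t
    have := hH (U t - f t)
    have := hUB t
    have := hGd t
    simp only [hΦ]; linarith
  have hiter : ∀ n : ℕ, ∀ t, t + n * δ ≤ Φ^[n] t := by
    intro n
    induction n with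
    | zero => intro t; simp
    | succ n ih =>
      intro t
      rw [Function.iterate_succ_apply']
      have := ih t
      have := hstep (Φ^[n] t)
      push_cast; linarith
  have hziter : ∀ n : ℕ, ∀ t, f t = 0 ↔ f (Φ^[n] t) = 0 := by
    intro n
    induction n with
    | zero => intro t; simp
    | succ n ih =>
      intro t
      rw [Function.iterate_succ_apply', ← hz, ← ih]
  have hlarge : ∀ T t, ∃ n : ℕ, T ≤ Φ^[n] t := by
    intro T t
    obtain ⟨n, hn⟩ := exists_nat_ge ((T - t) / δ)
    refine ⟨n, le_trans ?_ (hiter n t)⟩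
    rw [div_le_iff₀ hδ] at hn; linarith
  suffices hev : ∀ᶠ v in 𝓝 (0:ℝ), D v = 0 by
    have h1 : ∀ᶠ t : ℝ in atTop, D t⁻¹ = 0 := tendsto_inv_atTop_zero.eventually hev
    obtain ⟨T, hT⟩ := eventually_atTop.1 (h1.and (eventually_gt_atTop 0))
    intro t
    obtain ⟨n, hn⟩ := hlarge T t
    have h0 : f t = 0 := by
      rw [hziter n]
      have := hT _ hn
      have e := hGD (Φ^[n] t) this.2.ne'
      rw [this.1, mul_zero] at e
      exact e
    simp only [hf] at h0; linarith
  by_contra hne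
  have hne' : ¬ ∀ᶠ v in 𝓝 (0:ℝ), D v = 0 := hne
  rw [← hD.exists_eventuallyEq_pow_smul_nonzero_iff] at hne'
  obtain ⟨N, q, hq, hq0, hDq⟩ := hne'
  have hN : N ≠ 0 := by
    rintro rfl
    have := hDq.self_of_nhds
    simp [hD0] at this
    exact hq0 this.symm
  obtain ⟨m, rfl⟩ := Nat.exists_eq_succ_of_ne_zero hN
  have hfq' : ∀ t, t ≠ 0 → D t⁻¹ = (t⁻¹) ^ (m+1) * q t⁻¹ → f t = (t⁻¹) ^ m * q t⁻¹ := by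
    intro t ht h
    simp only [hf]; rw [hGD t ht, h, pow_succ]; field_simp
  have hDq2 : ∀ᶠ v in 𝓝 (0:ℝ), D v = v ^ (m+1) * q v := by
    filter_upwards [hDq] with v hv
    simpa using hv
  have hfq : ∀ᶠ t in atTop, f t = (t⁻¹) ^ m * q t⁻¹ := by
    filter_upwards [tendsto_inv_atTop_zero.eventually hDq2, eventually_gt_atTop 0] with t h ht
    exact hfq' t ht.ne' h
  have hfqb : ∀ᶠ t in atBot, f t = (t⁻¹) ^ m * q t⁻¹ := by
    filter_upwards [tendsto_inv_atBot_zero.eventually hDq2, eventually_lt_atBot 0] with t h ht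
    exact hfq' t ht.ne h
  have hqt : Tendsto (fun t : ℝ => q t⁻¹) atTop (𝓝 (q 0)) :=
    hq.continuousAt.tendsto.comp tendsto_inv_atTop_zero
  have hqb : Tendsto (fun t : ℝ => q t⁻¹) atBot (𝓝 (q 0)) :=
    hq.continuousAt.tendsto.comp tendsto_inv_atBot_zero
  -- no zeros near infinity, hence none at all
  have hnz : ∀ t, f t ≠ 0 := by
    intro t ht
    have : ∀ᶠ t : ℝ in atTop, f t ≠ 0 := by
      filter_upwards [hfq, hqt.eventually_ne hq0, eventually_gt_atTop 0] with t h1 h2 h3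
      rw [h1]; positivity
    obtain ⟨T, hT⟩ := eventually_atTop.1 this
    obtain ⟨n, hn⟩ := hlarge T t
    exact hT _ hn ((hziter n t).1 ht)
  have hfc : Continuous f := by
    simp only [hf]; fun_prop
  -- asymptotics
  have hft : Tendsto (fun t => f t / t) atTop (𝓝 0) := by
    have hDt : Tendsto (fun t : ℝ => D t⁻¹) atTop (𝓝 0) := by
      have := hD.continuousAt.tendsto.comp tendsto_inv_atTop_zero
      rwa [hD0] at this
    refine hDt.congr' ?_
    filter_upwards [eventually_gt_atTop 0] with t ht
    simp only [hf]; rw [hGD t ht.ne']; field_simp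
  have hPt : Tendsto Φ atTop atTop :=
    tendsto_atTop_mono (fun t => (by linarith [hstep t] : t ≤ Φ t)) tendsto_id
  have hUt : Tendsto (fun t => U t / t) atTop (𝓝 (C + S)) := by
    have := (sqrt_div_tendsto.const_mul S).const_add C
    rw [mul_one] at this
    refine this.congr' ?_
    filter_upwards [eventually_gt_atTop 0] with t ht
    simp only [hU]; field_simp
  have hVt : Tendsto (fun t => V t / t) atTop (𝓝 (C - S)) := by
    have := (sqrt_div_tendsto.const_mul S).const_sub C
    rw [mul_one] at this
    refine this.congr' ?_
    filter_upwards [eventually_gt_atTop 0] with t ht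
    simp only [hV]; field_simp
  have hUft : Tendsto (fun t => (U t - f t) / t) atTop (𝓝 (C + S)) := by
    have := hUt.sub hft
    rw [sub_zero] at this
    exact this.congr fun t => by ring
  have hVft : Tendsto (fun t => (V t - f t) / t) atTop (𝓝 (C - S)) := by
    have := hVt.sub hft
    rw [sub_zero] at this
    exact this.congr fun t => by ring
  have up : ∀ (g : ℝ → ℝ) (l : ℝ), 0 < l → Tendsto (fun t => g t / t) atTop (𝓝 l) →
      Tendsto g atTop atTop := by
    intro g l hl h
    have := h.pos_mul_atTop hl tendsto_id
    refine this.congr' ?_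
    filter_upwards [eventually_gt_atTop 0] with t ht
    simp [ht.ne']
  have hU' := up _ _ (by positivity) hUt
  have hUf' := up _ _ (by positivity) hUft
  have hV' := (up _ _ (by linarith) hVt).comp hPt
  have hVf' := (up _ _ (by linarith) hVft).comp hPt
  have hF1t : Tendsto F1 atTop (𝓝 (C - S)) := by
    have := ((slope_tendsto hU' hUf').const_mul S).const_sub C
    rwa [mul_one] at this
  have hF2t : Tendsto F2 atTop (𝓝 (C + S)) := by
    have := ((slope_tendsto hV' hVf').const_mul S).const_add C
    rwa [mul_one] at this
  have hratio : Tendsto (fun t => t / Φ t) atTop (𝓝 ((C - S) / (C + S))) := by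
    have := (hVft.comp hPt).div hUft (by positivity)
    refine this.congr' ?_
    filter_upwards [eventually_gt_atTop 0, hPt.eventually_gt_atTop 0,
      hUf'.eventually_gt_atTop 0] with t h1 h2 h3
    simp only [Pi.div_apply, Function.comp]
    rw [hVPhi]
    field_simp
  have hlim : q 0 * (C - S) = ((C - S) / (C + S)) ^ m * q 0 * (C + S) := by
    have l1 := hqt.mul hF1t
    have l2 := ((hratio.pow m).mul (hqt.comp hPt)).mul hF2t
    refine tendsto_nhds_unique l1 (l2.congr' ?_)
    filter_upwards [hfq, hPt.eventually hfq, eventually_gt_atTop 0, hPt.eventually_gt_atTop 0]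
      with t h1 h2 h3 h4
    have := hstar t
    rw [h1, h2] at this
    simp only [Function.comp]
    rw [div_pow]
    rw [inv_pow, inv_pow] at this
    field_simp at this ⊢
    linarith
  have hm : m = 1 := by
    have h0 : 0 < (C - S) / (C + S) := div_pos (by linarith) (by linarith)
    have h1 : (C - S) / (C + S) < 1 := by rw [div_lt_one (by linarith)]; linarith
    have h2 : ((C - S) / (C + S)) ^ m = ((C - S) / (C + S)) ^ 1 := by
      have h3 : C - S = ((C - S) / (C + S)) ^ m * (C + S) := by
        apply mul_left_cancel₀ hq0; linarith
      rw [pow_one, eq_div_iff (by linarith)]; exact h3.symm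
    exact pow_right_injective₀ h0 h1.ne h2
  subst hm
  -- sign change
  have hprod : ∃ x y, f x * f y < 0 := by
    have hp : ∀ᶠ z in 𝓝 (q 0), 0 < q 0 * z := by
      have : Tendsto (fun z => q 0 * z) (𝓝 (q 0)) (𝓝 (q 0 * q 0)) := by
        apply Continuous.tendsto; fun_prop
      exact this.eventually_const_lt (mul_self_pos.2 hq0)
    obtain ⟨x, hx1, hx2, hx3⟩ := (hfq.and ((hqt.eventually hp).and (eventually_gt_atTop 0))).exists
    obtain ⟨y, hy1, hy2, hy3⟩ := (hfqb.and ((hqb.eventually hp).and (eventually_lt_atBot 0))).exists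
    refine ⟨x, y, ?_⟩
    rw [hx1, hy1, pow_one, pow_one]
    have : 0 < q x⁻¹ * q y⁻¹ := by
      have := mul_pos hx2 hy2
      have h2 : 0 < q 0 * q 0 := mul_self_pos.2 hq0
      have : 0 < (q 0 * q 0) * (q x⁻¹ * q y⁻¹) := by linarith
      exact (pos_iff_pos_of_mul_pos this).1 h2
    have h4 : x⁻¹ * y⁻¹ < 0 := mul_neg_of_pos_of_neg (inv_pos.2 hx3) (inv_lt_zero.2 hy3)
    nlinarith
  obtain ⟨x, y, hxy⟩ := hprod
  have : ∃ z, f z = 0 := by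
    have hr := isPreconnected_range hfc
    rcases mul_neg_iff.1 hxy with ⟨h1, h2⟩ | ⟨h1, h2⟩
    · exact mem_range_of_exists_le_of_exists_ge hfc ⟨y, h2.le⟩ ⟨x, h1.le⟩
    · exact mem_range_of_exists_le_of_exists_ge hfc ⟨x, h1.le⟩ ⟨y, h2.le⟩
  obtain ⟨z, hz0⟩ := this
  exact hnz z hz0

structure IsRadial (K : Set Plane) (P : Plane) (g : Plane → ℝ) : Prop where
  cont : Continuous g
  smul : ∀ (c : ℝ) (u : Plane), 0 ≤ c → g (c • u) = c * g u
  add : ∀ u v, g (u + v) ≤ g u + g v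
  lower : ∃ δ : ℝ, 0 < δ ∧ ∀ u, δ * ‖u‖ ≤ g u
  mem : ∀ u, g u = 1 ↔ P + u ∈ frontier K

lemma exists_radial {K : Set Plane} {P : Plane} (hK : IsCompact K) (hc : Convex ℝ K)
    (hP : P ∈ interior K) : ∃ g, IsRadial K P g := by
  let e : Plane ≃ₜ Plane := Homeomorph.addLeft P
  have hc' : Convex ℝ (e ⁻¹' K) := hc.translate_preimage_right P
  have h0 : e ⁻¹' K ∈ 𝓝 (0 : Plane) := by
    apply e.continuous.continuousAt.preimage_mem_nhds
    have : e 0 = P := by simp [e]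
    rw [this]; exact mem_interior_iff_mem_nhds.1 hP
  have habs : Absorbent ℝ (e ⁻¹' K) := absorbent_nhds_zero h0
  refine ⟨gauge (e ⁻¹' K), continuous_gauge hc' h0, ?_, gauge_add_le hc' habs, ?_, ?_⟩
  · intro c u h
    rw [gauge_smul_of_nonneg h, smul_eq_mul]
  · have hb : Bornology.IsBounded (e ⁻¹' K) := (e.isCompact_preimage.2 hK).isBounded
    obtain ⟨r, hr0, hr⟩ := hb.subset_closedBall_lt 0 0
    refine ⟨r⁻¹, by positivity, fun u => ?_⟩
    have := le_gauge_of_subset_closedBall (x := u) habs hr0.le hr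
    rwa [div_eq_inv_mul] at this
  · intro u
    rw [gauge_eq_one_iff_mem_frontier hc' h0, ← e.preimage_frontier]
    rfl

lemma IsRadial.pos {K : Set Plane} {P : Plane} {g : Plane → ℝ} (hg : IsRadial K P g) {u : Plane}
    (hu : u ≠ 0) : 0 < g u := by
  obtain ⟨δ, h, hd⟩ := hg.lower
  have := norm_pos_iff.2 hu
  exact lt_of_lt_of_le (by positivity) (hd u)

lemma IsRadial.zero {K : Set Plane} {P : Plane} {g : Plane → ℝ} (hg : IsRadial K P g) :
    g 0 = 0 := by
  have := hg.smul 0 0 le_rfl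
  simpa using this

lemma IsRadial.inv_smul {K : Set Plane} {P : Plane} {g : Plane → ℝ} (hg : IsRadial K P g)
    {u : Plane} (hu : u ≠ 0) : g ((g u)⁻¹ • u) = 1 := by
  have := hg.pos hu
  rw [hg.smul _ _ (by positivity), inv_mul_cancel₀ this.ne']

lemma IsRadial.chord {K : Set Plane} {P : Plane} {g : Plane → ℝ} (hg : IsRadial K P g)
    (hP : IsChordalPoint (fun a b => 1 / a + 1 / b) (frontier K) P) :
    ∃ k : ℝ, ∀ u, g u + g (-u) = k * ‖u‖ := by
  obtain ⟨k, hk⟩ := hP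
  refine ⟨k, fun u => ?_⟩
  by_cases hu : u = 0
  · simp [hu, hg.zero]
  have hu' : -u ≠ 0 := neg_ne_zero.2 hu
  have p1 := hg.pos hu
  have p2 := hg.pos hu'
  have hn := norm_pos_iff.2 hu
  have m1 := (hg.mem _).1 (hg.inv_smul hu)
  have m2 := (hg.mem _).1 (hg.inv_smul hu')
  have := hk _ _ m1 m2 ?_
  · simp only [dist_self_add_left, norm_smul, norm_neg, norm_inv, Real.norm_eq_abs,
      abs_of_pos p1, abs_of_pos p2] at this
    rw [← this]
    field_simp
  · refine ⟨g u / (g u + g (-u)), g (-u) / (g u + g (-u)), by positivity, by positivity, ?_, ?_⟩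
    · field_simp
    · have e : (g u / (g u + g (-u)) + g (-u) / (g u + g (-u))) = 1 := by field_simp
      have e2 : g u / (g u + g (-u)) * (g u)⁻¹ = g (-u) / (g u + g (-u)) * (g (-u))⁻¹ := by
        field_simp
      rw [smul_add, smul_add, smul_smul, smul_smul, e2, smul_neg]
      rw [show ∀ a b c : Plane, a + b + (c + -b) = a + c by intros; abel, ← add_smul, e, one_smul]

/-- the right-angle rotation of a vector -/
def rot (e : Plane) : Plane := !₂[-(e 1), e 0]

lemma norm_comb {e : Plane} (he : ‖e‖ = 1) (x y : ℝ) :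
    ‖x • e + y • rot e‖ = √(x ^ 2 + y ^ 2) := by
  have h : e 0 ^ 2 + e 1 ^ 2 = 1 := by
    have := EuclideanSpace.norm_sq_eq e
    simp [he] at this
    exact this.symm
  rw [EuclideanSpace.norm_eq]
  congr 1
  simp [rot]
  linear_combination (x ^ 2 + y ^ 2) * h

lemma exists_comb {e : Plane} (he : ‖e‖ = 1) (u : Plane) :
    u = (e 0 * u 0 + e 1 * u 1) • e + (e 0 * u 1 - e 1 * u 0) • rot e := by
  have h : e 0 ^ 2 + e 1 ^ 2 = 1 := by
    have := EuclideanSpace.norm_sq_eq e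
    simp [he] at this
    exact this.symm
  ext i
  fin_cases i
  · simp [rot]; linear_combination (-u 0) * h
  · simp [rot]; linear_combination (-u 1) * h

lemma analytic_coord {γ : ℝ → Plane} {τ : ℝ} (h : AnalyticAt ℝ γ τ) (i : Fin 2) :
    AnalyticAt ℝ (fun t => γ t i) τ :=
  (EuclideanSpace.proj (𝕜 := ℝ) i).analyticAt _ |>.comp h

/-- analyticity of the radial function at a vertex -/
lemma radial_analytic {K : Set Plane} {P e : Plane} {g : Plane → ℝ} (hg : IsRadial K P g)
    (he : ‖e‖ = 1) {R : ℝ} (hR : 0 < R) (hV : P + R • e ∈ frontier K)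
    (han : IsAnalyticBoundary (frontier K)) :
    AnalyticAt ℝ (fun v : ℝ => g (e + v • rot e)) 0 := by
  have hee : e 0 ^ 2 + e 1 ^ 2 = 1 := by
    have := EuclideanSpace.norm_sq_eq e
    simp [he] at this
    exact this.symm
  obtain ⟨ε, hε, γ, hγ, hγ0, hγ', U, -, -, hU⟩ := han _ hV
  have h0 : (0:ℝ) ∈ Ioo (-ε) ε := ⟨by linarith, hε⟩
  have hγa := hγ 0 h0
  set x : ℝ → ℝ := fun t => e 0 * (γ t 0 - P 0) + e 1 * (γ t 1 - P 1) with hx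
  set y : ℝ → ℝ := fun t => e 0 * (γ t 1 - P 1) - e 1 * (γ t 0 - P 0) with hy
  have ha0 := analytic_coord hγa 0
  have ha1 := analytic_coord hγa 1
  have hxa : AnalyticAt ℝ x 0 := by simp only [hx]; fun_prop
  have hya : AnalyticAt ℝ y 0 := by simp only [hy]; fun_prop
  have hdec : ∀ t, γ t = P + (x t • e + y t • rot e) := by
    intro t
    have := exists_comb he (γ t - P)
    rw [← sub_eq_iff_eq_add', this]; simp [hx, hy]
  have hx0 : x 0 = R := by
    simp only [hx, hγ0]; simp; linear_combination R * hee
  have hy0 : y 0 = 0 := by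
    simp only [hy, hγ0]; simp; ring
  have hge : R * g e = 1 := by
    rw [← hg.smul _ _ hR.le]; exact (hg.mem _).2 hV
  have hgx : ∀ᶠ t in 𝓝 (0:ℝ), g (x t • e + y t • rot e) = 1 := by
    filter_upwards [Ioo_mem_nhds h0.1 h0.2] with t ht
    rw [hg.mem, ← hdec]
    have : γ t ∈ γ '' Ioo (-ε) ε := ⟨t, ht, rfl⟩
    rw [hU] at this
    exact this.1
  have hxpos : ∀ᶠ t in 𝓝 (0:ℝ), 0 < x t :=
    hxa.continuousAt.eventually_const_lt (by rw [hx0]; exact hR)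
  -- Lipschitz bound
  set M := g (rot e) + g (-rot e) with hM
  have hgnn : ∀ u, 0 ≤ g u := by
    intro u
    by_cases hu : u = 0
    · rw [hu, hg.zero]
    · exact (hg.pos hu).le
  have hMb : ∀ z : ℝ, g (z • rot e) ≤ |z| * M := by
    intro z
    have a1 := hgnn (rot e)
    have a2 := hgnn (-rot e)
    rcases le_total 0 z with h | h
    · rw [hg.smul _ _ h, abs_of_nonneg h]
      nlinarith
    · have : z • rot e = (-z) • (-rot e) := by simp
      rw [this, hg.smul _ _ (by linarith), abs_of_nonpos h]
      nlinarith
  have hlip : ∀ᶠ t in 𝓝 (0:ℝ), |x t - R| ≤ R * M * |y t| := by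
    filter_upwards [hgx, hxpos] with t h1 h2
    have b1 := hg.add (x t • e) (y t • rot e)
    have b2 := hg.add (x t • e + y t • rot e) ((-y t) • rot e)
    have e2 : x t • e + y t • rot e + (-y t) • rot e = x t • e := by
      rw [neg_smul]; abel
    rw [e2] at b2
    rw [hg.smul _ _ h2.le, h1] at b1 b2
    have c1 := hMb (y t)
    have c2 := hMb (-y t)
    rw [abs_neg] at c2
    have hgeq : g e = R⁻¹ := by field_simp; linarith
    rw [hgeq] at b1 b2
    have d1 : R * 1 ≤ R * (x t * R⁻¹ + |y t| * M) := mul_le_mul_of_nonneg_left (by linarith) hR.le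
    have d2 : R * (x t * R⁻¹) ≤ R * (1 + |y t| * M) := mul_le_mul_of_nonneg_left (by linarith) hR.le
    have e3 : R * (x t * R⁻¹) = x t := by field_simp
    rw [mul_add, e3] at d1
    rw [e3] at d2
    rw [abs_le]; constructor <;> nlinarith
  have hy' : deriv y 0 ≠ 0 := by
    intro hcon
    have hyd : HasDerivAt y 0 0 := by
      have := hya.differentiableAt.hasDerivAt
      rwa [hcon] at this
    have hyo : y =o[𝓝 0] (fun t : ℝ => t) := by
      have := hyd.isLittleO
      simpa [hy0] using this
    have hxo : (fun t => x t - R) =o[𝓝 0] (fun t : ℝ => t) := by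
      refine Asymptotics.IsBigO.trans_isLittleO ?_ hyo
      refine Asymptotics.IsBigO.of_bound (R * M) ?_
      filter_upwards [hlip] with t ht
      simpa using ht
    have hxd : HasDerivAt x 0 0 := by
      rw [hasDerivAt_iff_isLittleO]
      simpa [hx0] using hxo
    apply hγ'
    have : γ = fun t => P + (x t • e + y t • rot e) := funext hdec
    rw [this]
    have := ((hxd.smul_const e).add (hyd.smul_const (rot e))).const_add P
    simpa using this.deriv
  -- slope
  have hva : AnalyticAt ℝ (fun t => y t / x t) 0 := hya.div hxa (by rw [hx0]; exact hR.ne')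
  have hvd : deriv (fun t => y t / x t) 0 ≠ 0 := by
    have := (hya.differentiableAt.hasDerivAt.div hxa.differentiableAt.hasDerivAt
      (by rw [hx0]; exact hR.ne')).deriv
    have e1 : deriv (fun t => y t / x t) 0 = deriv (y / x) 0 := rfl
    rw [e1, this, hx0, hy0]
    simp only [zero_mul, sub_zero]
    positivity
  have := (analyticAt_comp_iff_of_deriv_ne_zero (g := fun v : ℝ => g (e + v • rot e)) hva hvd).1 ?_
  · simpa [hy0] using this
  · refine (hxa.inv (by rw [hx0]; exact hR.ne')).congr ?_
    filter_upwards [hgx, hxpos] with t h1 h2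
    have : x t • e + y t • rot e = x t • (e + (y t / x t) • rot e) := by
      rw [smul_add, smul_smul]; congr 2; field_simp
    rw [this, hg.smul _ _ h2.le] at h1
    simp only [Function.comp, Pi.inv_apply]
    rw [eq_comm, ← one_div, eq_div_iff h2.ne']; linarith

lemma ellipse_algebra {r L x y ρ σ : ℝ} (hr : 0 < r) (hL : 0 < L) (hρ0 : 0 ≤ ρ)
    (hρ2 : ρ ^ 2 = x ^ 2 + y ^ 2) (hσ0 : 0 ≤ σ) (hσ2 : σ ^ 2 = (x - L) ^ 2 + y ^ 2) :
    (2 * r + L) * ρ - L * x = 2 * r * (r + L) ↔ ρ + σ = 2 * r + L := by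
  constructor
  · intro h
    have hxρ : x ≤ ρ := by
      apply le_trans (le_abs_self x)
      apply abs_le_of_sq_le_sq _ hρ0
      nlinarith [sq_nonneg y]
    have hm : L * x ≤ L * ρ := mul_le_mul_of_nonneg_left hxρ hL.le
    have hle : ρ ≤ r + L := by
      have : (2 * r) * ρ ≤ (2 * r) * (r + L) := by linarith
      exact le_of_mul_le_mul_left this (by positivity)
    have : σ = 2 * r + L - ρ := by
      have h2 : σ ^ 2 = (2 * r + L - ρ) ^ 2 := by
        linear_combination hσ2 - hρ2 + 2 * h
      exact (sq_eq_sq₀ hσ0 (by linarith)).1 h2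
    linarith
  · intro h
    have : σ = 2 * r + L - ρ := by linarith
    rw [this] at hσ2
    linear_combination (1 / 2) * (hρ2 - hσ2)

/-- transferring a frontier point from one base point to another -/
lemma radial_transfer {K : Set Plane} {P Q d : Plane} {g g' : Plane → ℝ} (hg : IsRadial K P g)
    (hg' : IsRadial K Q g') (hd : Q = P + d) {u : Plane} (hu : u ≠ 0) :
    g (u + g' u • d) = g' u := by
  have hp := hg'.pos hu
  have h1 := (hg'.mem _).1 (hg'.inv_smul hu)
  rw [hd, add_assoc, ← hg.mem] at h1
  have : u + g' u • d = g' u • (d + (g' u)⁻¹ • u) := by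
    rw [smul_add, smul_smul, mul_inv_cancel₀ hp.ne', one_smul, add_comm]
  rw [this, hg.smul _ _ hp.le, h1, mul_one]

set_option maxHeartbeats 1000000 in
lemma main_aux {K : Set Plane} {P e : Plane} {r L : ℝ} (he : ‖e‖ = 1) (hr : 0 < r) (hL : 0 < L)
    (hKc : IsCompact K) (hKx : Convex ℝ K) (hP : P ∈ interior K) (hQ : P + L • e ∈ interior K)
    (hcP : IsChordalPoint (fun a b => 1 / a + 1 / b) (frontier K) P)
    (hcQ : IsChordalPoint (fun a b => 1 / a + 1 / b) (frontier K) (P + L • e))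
    (hV1 : P - r • e ∈ frontier K) (hV2 : P + (r + L) • e ∈ frontier K)
    (han : IsAnalyticBoundary (frontier K)) :
    frontier K = {X : Plane | dist X P + dist X (P + L • e) = 2 * r + L} := by
  obtain ⟨g, hg⟩ := exists_radial hKc hKx hP
  obtain ⟨g', hg'⟩ := exists_radial hKc hKx hQ
  obtain ⟨k, hk⟩ := hg.chord hcP
  obtain ⟨k', hk'⟩ := hg'.chord hcQ
  have hrL : 0 < r + L := by positivity
  have g1 : g e = (r + L)⁻¹ := by
    have := (hg.mem _).2 hV2
    rw [hg.smul _ _ hrL.le] at this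
    field_simp; linarith
  have g2 : g (-e) = r⁻¹ := by
    have h : P + r • (-e) ∈ frontier K := by simpa [sub_eq_add_neg] using hV1
    have := (hg.mem _).2 h
    rw [hg.smul _ _ hr.le] at this
    field_simp; linarith
  have g1' : g' e = r⁻¹ := by
    have h : (P + L • e) + r • e ∈ frontier K := by
      rw [add_assoc, ← add_smul, add_comm L r]; exact hV2
    have := (hg'.mem _).2 h
    rw [hg'.smul _ _ hr.le] at this
    field_simp; linarith
  have g2' : g' (-e) = (r + L)⁻¹ := by
    have h : (P + L • e) + (r + L) • (-e) ∈ frontier K := by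
      have e1 : (P + L • e) + (r + L) • (-e) = P - r • e := by
        rw [smul_neg, add_smul]; abel
      rw [e1]; exact hV1
    have := (hg'.mem _).2 h
    rw [hg'.smul _ _ hrL.le] at this
    field_simp; linarith
  have hkv : k = r⁻¹ + (r + L)⁻¹ := by
    have := hk e
    rw [g1, g2, he, mul_one] at this
    linarith
  have hkv' : k' = k := by
    have := hk' e
    rw [g1', g2', he, mul_one] at this
    linarith
  subst hkv'
  have hpos : 0 < k' := by rw [hkv]; positivity
  set n := rot e with hn
  have hnorm : ∀ t : ℝ, ‖t • e + n‖ = √(1 + t ^ 2) := by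
    intro t
    have := norm_comb he t 1
    rw [one_smul] at this
    rw [this]; congr 1; ring
  have hnorm2 : ∀ v : ℝ, ‖e + v • n‖ = √(1 + v ^ 2) := by
    intro v
    have := norm_comb he 1 v
    rw [one_smul] at this
    rw [this]; congr 1; ring
  have hne : ∀ t : ℝ, t • e + n ≠ 0 := by
    intro t h
    have := hnorm t
    rw [h, norm_zero] at this
    have h2 : 0 < √(1 + t ^ 2) := Real.sqrt_pos.2 (by positivity)
    linarith
  set S := L * k' / 2 with hS
  set C := (r ^ 2 + (r + L) ^ 2) / (2 * r * (r + L)) with hC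
  have hgneg : ∀ t : ℝ, g (-(t • e + n)) = k' * √(1 + t ^ 2) - g (t • e + n) := by
    intro t; rw [← hnorm, ← hk]; ring
  have hgneg' : ∀ t : ℝ, g' (-(t • e + n)) = k' * √(1 + t ^ 2) - g' (t • e + n) := by
    intro t; rw [← hnorm, ← hk']; ring
  obtain ⟨δ, hδ, hδg⟩ := hg.lower
  have hpa := radial_analytic hg he hrL hV2 han
  have hcore := core C S (by positivity) (by rw [hC, hS, hkv]; field_simp; ring) (by positivity)
    (fun t => L * g (t • e + n)) (fun s => L * g' (s • e + n))
    (fun v => L * g (e + v • n) - S * √(1 + v ^ 2) + (C - 1))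
    (by have := hg.cont; fun_prop) (L * δ) (by positivity)
    (by
      intro t
      have h1 := hδg (-(t • e + n))
      rw [norm_neg, hnorm, hgneg] at h1
      have h2 : 1 ≤ √(1 + t ^ 2) := Real.one_le_sqrt.2 (by nlinarith)
      have h3 : δ ≤ k' * √(1 + t ^ 2) - g (t • e + n) := by nlinarith
      have := mul_le_mul_of_nonneg_left h3 hL.le
      simp only [hS]; linarith)
    (by intro s; have := hg'.pos (hne s); positivity)
    (by
      intro s
      have := radial_transfer hg hg' rfl (hne s)
      have e1 : s • e + n + g' (s • e + n) • L • e = (s + L * g' (s • e + n)) • e + n := by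
        rw [add_smul, smul_smul, mul_comm L]; abel
      rw [e1] at this
      simp only [this])
    (by
      intro t
      have := radial_transfer hg' hg (d := -(L • e)) (by abel) (neg_ne_zero.2 (hne t))
      have e1 : -(t • e + n) + g (-(t • e + n)) • -(L • e)
          = -((t + L * g (-(t • e + n))) • e + n) := by
        rw [add_smul, smul_neg, smul_smul, mul_comm L]; abel
      rw [e1, hgneg'] at this
      have e2 : 2 * S * √(1 + t ^ 2) - L * g (t • e + n) = L * g (-(t • e + n)) := by
        rw [hgneg, hS]; ring
      simp only [e2]
      rw [hS]
      linear_combination L * this)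
    (by
      have hs : AnalyticAt ℝ (fun v : ℝ => √(1 + v ^ 2)) 0 := by
        have h1 : ContDiffAt ℝ ⊤ (fun v : ℝ => √(1 + v ^ 2)) 0 := by
          have h2 : ContDiffAt ℝ ⊤ (fun v : ℝ => 1 + v ^ 2) 0 := by fun_prop
          exact h2.sqrt (by norm_num)
        exact h1.analyticAt
      have h1 := analyticAt_const (v := L) (x := (0:ℝ)) (𝕜 := ℝ)
      have h2 := analyticAt_const (v := S) (x := (0:ℝ)) (𝕜 := ℝ)
      have h3 := analyticAt_const (v := C - 1) (x := (0:ℝ)) (𝕜 := ℝ)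
      exact ((h1.mul hpa).sub (h2.mul hs)).add h3)
    (by
      simp [g1]; rw [hC, hS, hkv]; field_simp; ring)
    (by
      intro t ht
      have hsq : ∀ s : ℝ, 0 < s → s * √(1 + (s⁻¹) ^ 2) = √(1 + s ^ 2) := by
        intro s hs
        nth_rw 1 [← Real.sqrt_sq hs.le]
        rw [← Real.sqrt_mul (by positivity)]
        congr 1; field_simp
        ring
      have hte : t • e + n = t • (e + t⁻¹ • n) := by
        rw [smul_add, smul_smul, mul_inv_cancel₀ ht, one_smul]
      rcases lt_or_gt_of_ne ht with h | h
      · have h1 := hgneg t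
        have e1 : -(t • e + n) = (-t) • (e + t⁻¹ • n) := by rw [hte, neg_smul]
        rw [e1, hg.smul _ _ (by linarith)] at h1
        have h2 := hsq (-t) (by linarith)
        rw [inv_neg, neg_sq, neg_sq] at h2
        have h3 : g (t • e + n) = k' * √(1 + t ^ 2) + t * g (e + t⁻¹ • n) := by linarith
        simp only [h3, hS]
        linear_combination (-L * k' / 2) * h2
      · have h2 := hsq t h
        simp only [hte, hS]
        rw [hg.smul _ _ h.le]
        linear_combination (L * k' / 2) * h2)
  have hform : ∀ x y : ℝ, L * g (x • e + y • n) = S * √(x ^ 2 + y ^ 2) - (C - 1) * x := by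
    have hp : ∀ x y : ℝ, 0 < y → L * g (x • e + y • n) = S * √(x ^ 2 + y ^ 2) - (C - 1) * x := by
      intro x y hy
      have e1 : x • e + y • n = y • ((x / y) • e + n) := by
        rw [smul_add, smul_smul]; congr 2; field_simp
      have e2 : √(x ^ 2 + y ^ 2) = y * √(1 + (x / y) ^ 2) := by
        nth_rw 2 [← Real.sqrt_sq hy.le]
        rw [← Real.sqrt_mul (by positivity)]
        congr 1; field_simp
        ring
      have := hcore (x / y)
      rw [e1, hg.smul _ _ hy.le, e2]
      have e3 : y * (x / y) = x := by field_simp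
      linear_combination y * this - (C - 1) * e3
    intro x y
    rcases lt_trichotomy y 0 with h | h | h
    · have h1 := hp (-x) (-y) (by linarith)
      have h2 := hk (x • e + y • n)
      rw [norm_comb he] at h2
      have e1 : -(x • e + y • n) = (-x) • e + (-y) • n := by rw [neg_smul, neg_smul]; abel
      rw [e1] at h2
      rw [neg_sq, neg_sq] at h1
      rw [hS] at h1 ⊢
      linear_combination L * h2 - h1
    · subst h
      rw [zero_smul, add_zero, zero_pow two_ne_zero, add_zero, Real.sqrt_sq_eq_abs]
      rcases le_total 0 x with h | h
      · rw [hg.smul _ _ h, g1, abs_of_nonneg h, hS, hC, hkv]; field_simp; ring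
      · rw [show x • e = (-x) • (-e) by simp, hg.smul _ _ (by linarith), g2, abs_of_nonpos h,
          hS, hC, hkv]; field_simp; ring
    · exact hp x y h
  ext X
  obtain ⟨x, y, hxy⟩ : ∃ x y : ℝ, X - P = x • e + y • n := ⟨_, _, exists_comb he (X - P)⟩
  have hX : X = P + (x • e + y • n) := by rw [← hxy]; abel
  have d1 : dist X P = √(x ^ 2 + y ^ 2) := by rw [dist_eq_norm, hxy, norm_comb he]
  have d2 : dist X (P + L • e) = √((x - L) ^ 2 + y ^ 2) := by
    rw [dist_eq_norm, ← norm_comb he, hX]; congr 1; rw [sub_smul]; abel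
  rw [Set.mem_ofPred_eq, d1, d2, hX, ← hg.mem]
  have hf := hform x y
  set ρ := √(x ^ 2 + y ^ 2) with hρ
  have hρ0 : 0 ≤ ρ := Real.sqrt_nonneg _
  have hρ2 : ρ ^ 2 = x ^ 2 + y ^ 2 := Real.sq_sqrt (by positivity)
  have hσ2 : √((x - L) ^ 2 + y ^ 2) ^ 2 = (x - L) ^ 2 + y ^ 2 := Real.sq_sqrt (by positivity)
  have hσ0 : 0 ≤ √((x - L) ^ 2 + y ^ 2) := Real.sqrt_nonneg _
  set σ := √((x - L) ^ 2 + y ^ 2) with hσ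
  have key : g (x • e + y • n) = 1 ↔ (2 * r + L) * ρ - L * x = 2 * r * (r + L) := by
    have hgv : 2 * r * (r + L) * g (x • e + y • n) = (2 * r + L) * ρ - L * x := by
      apply mul_left_cancel₀ hL.ne'
      have : L * (2 * r * (r + L) * g (x • e + y • n)) = 2 * r * (r + L) * (S * ρ - (C - 1) * x) := by
        rw [← hf]; ring
      rw [this, hS, hC, hkv]; field_simp; ring
    rw [← hgv]
    constructor
    · intro h; rw [h, mul_one]
    · intro h
      apply mul_left_cancel₀ (show 2 * r * (r + L) ≠ 0 by positivity)
      linarith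
  rw [key]
  exact ellipse_algebra hr hL hρ0 hρ2 hσ0 hσ2

/-- When `dist V₁ Q = dist V₂ P`, the unique analytic solution of the equireciprocal
problem with equireciprocal points `P, Q` and vertices `V₁, V₂` is the ellipse with
foci `P, Q` and major axis the segment `V₁V₂`. -/
theorem equireciprocal_solution_is_ellipse
    (V₁ P Q V₂ : Plane)
    (hne : V₁ ≠ P ∧ V₁ ≠ Q ∧ V₁ ≠ V₂ ∧ P ≠ Q ∧ P ≠ V₂ ∧ Q ≠ V₂)
    (hcol : Collinear ℝ ({V₁, P, Q, V₂} : Set Plane))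
    (hPseg : P ∈ openSegment ℝ V₁ Q) (hQseg : Q ∈ openSegment ℝ P V₂)
    (hsym : dist V₁ Q = dist V₂ P)
    (K : Set Plane)
    (hK : IsAnalyticSolution (fun a b => 1 / a + 1 / b) P Q V₁ V₂ K) :
    frontier K = {X : Plane | dist X P + dist X Q = dist V₁ V₂} := by
  obtain ⟨hKc, hKx, -, hP, hQ, hcP, hcQ, hax, han⟩ := hK
  have hV1 : V₁ ∈ frontier K := by
    have : V₁ ∈ ({V₁, V₂} : Set Plane) := by simp
    rw [← hax] at this; exact this.2
  have hV2 : V₂ ∈ frontier K := by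
    have : V₂ ∈ ({V₁, V₂} : Set Plane) := by simp
    rw [← hax] at this; exact this.2
  have hPQ : Q - P ≠ 0 := sub_ne_zero.2 (Ne.symm hne.2.2.2.1)
  set L := ‖Q - P‖ with hL
  have hL0 : 0 < L := norm_pos_iff.2 hPQ
  set e := L⁻¹ • (Q - P) with he
  have he1 : ‖e‖ = 1 := by
    rw [he, norm_smul, norm_inv, Real.norm_eq_abs, abs_of_pos hL0, ← hL, inv_mul_cancel₀ hL0.ne']
  have hLe : L • e = Q - P := by rw [he, smul_smul, mul_inv_cancel₀ hL0.ne', one_smul]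
  have hQe : Q = P + L • e := by rw [hLe]; abel
  obtain ⟨a, b, ha, hb, hab, hP1⟩ := hPseg
  obtain ⟨a', b', ha', hb', hab', hQ1⟩ := hQseg
  have hV1e : V₁ = P - (b / a * L) • e := by
    have h1 : V₁ = a⁻¹ • (P - b • Q) := by
      rw [← hP1, add_sub_cancel_right, smul_smul, inv_mul_cancel₀ ha.ne', one_smul]
    rw [mul_smul, hLe, h1]
    have hA : a = 1 - b := by linarith
    have : a⁻¹ = 1 + b / a := by field_simp; linarith
    have h2 : a⁻¹ * b = b / a := by field_simp
    rw [smul_sub, smul_smul, h2, this, add_smul, one_smul, smul_sub]; abel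
  have hV2e : V₂ = P + (a' / b' * L + L) • e := by
    have h1 : V₂ = b'⁻¹ • (Q - a' • P) := by
      rw [← hQ1, add_sub_cancel_left, smul_smul, inv_mul_cancel₀ hb'.ne', one_smul]
    rw [add_smul, mul_smul, hLe, h1]
    have : b'⁻¹ = 1 + a' / b' := by field_simp; linarith
    have h2 : b'⁻¹ * a' = a' / b' := by field_simp
    rw [smul_sub, smul_smul, h2, this, add_smul, one_smul, smul_sub]; abel
  clear_value e
  set r := b / a * L with hr
  set r' := a' / b' * L with hr'
  have hr0 : 0 < r := by positivity
  have hr0' : 0 < r' := by positivity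
  have hrr : r' = r := by
    have e1 : V₁ - Q = (-(r + L)) • e := by rw [hV1e, hQe, neg_smul, add_smul]; abel
    have e2 : V₂ - P = (r' + L) • e := by rw [hV2e]; abel
    rw [dist_eq_norm, dist_eq_norm, e1, e2, norm_smul, norm_smul, he1, norm_neg, Real.norm_eq_abs,
      Real.norm_eq_abs, abs_of_pos (by positivity), abs_of_pos (by positivity)] at hsym
    linarith
  rw [hrr] at hV2e
  have hd : dist V₁ V₂ = 2 * r + L := by
    have e1 : V₁ - V₂ = (-(2 * r + L)) • e := by
      rw [hV1e, hV2e, neg_smul, add_smul, add_smul, two_mul, add_smul]; abel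
    rw [dist_eq_norm, e1, norm_smul, he1, norm_neg, Real.norm_eq_abs, abs_of_pos (by positivity),
      mul_one]
  rw [hd]
  rw [hV1e] at hV1
  rw [hV2e] at hV2
  rw [hQe] at hQ hcQ
  have := main_aux he1 hr0 hL0 hKc hKx hP hQ hcP hcQ hV1 hV2 han
  rw [hQe]
  exact this
end
end

section
/- Let V₁, P, Q, V₂ be four distinct collinear points of ℝ², with P in the open segment from V₁ to Q and Q in the open segment from P to V₂. For the function F(a,b) = a·b (so that an interior F-chordal point is an equiproduct point), the circles through V₁ and V₂ are exactly the boundaries of the analytic solutions of the interior F-chordal problem with equiproduct points P, Q and vertices V₁, V₂: (1) if K is any analytic solution with these data, then frontier K is a circle passing through V₁ and V₂; and (2) conversely, for every circle C passing through V₁ and V₂, the closed disk bounded by C is an analytic solution with equiproduct points P, Q and vertices V₁, V₂. -/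
open Set

noncomputable section

/-- Coordinate along the axis. -/
def cX (u v : ℝ) (P A : Plane) : ℝ := (A 0 - P 0) * u + (A 1 - P 1) * v

/-- Coordinate perpendicular to the axis. -/
def cY (u v : ℝ) (P A : Plane) : ℝ := (A 1 - P 1) * u - (A 0 - P 0) * v

/-- The point with given coordinates. -/
def cPt (u v : ℝ) (P : Plane) (x y : ℝ) : Plane :=
  !₂[P 0 + x * u - y * v, P 1 + x * v + y * u]

lemma cX_pt {u v : ℝ} (h : u ^ 2 + v ^ 2 = 1) (P : Plane) (x y : ℝ) :
    cX u v P (cPt u v P x y) = x := by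
  simp only [cX, cPt, Matrix.cons_val_zero, Matrix.cons_val_one, PiLp.toLp_apply]
  linear_combination x * h

lemma cY_pt {u v : ℝ} (h : u ^ 2 + v ^ 2 = 1) (P : Plane) (x y : ℝ) :
    cY u v P (cPt u v P x y) = y := by
  simp only [cY, cPt, Matrix.cons_val_zero, Matrix.cons_val_one, PiLp.toLp_apply]
  linear_combination y * h

lemma c_ext {u v : ℝ} (h : u ^ 2 + v ^ 2 = 1) {P A B : Plane}
    (hx : cX u v P A = cX u v P B) (hy : cY u v P A = cY u v P B) : A = B := by
  simp only [cX, cY] at hx hy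
  ext i
  fin_cases i
  · show A 0 = B 0
    linear_combination u * hx - v * hy - (A 0 - B 0) * h
  · show A 1 = B 1
    linear_combination v * hx + u * hy - (A 1 - B 1) * h

lemma cX_aff (u v : ℝ) (P A B : Plane) {s t : ℝ} (h : s + t = 1) :
    cX u v P (s • A + t • B) = s * cX u v P A + t * cX u v P B := by
  simp only [cX, PiLp.add_apply, PiLp.smul_apply, smul_eq_mul]
  linear_combination (P 0 * u + P 1 * v) * h

lemma cY_aff (u v : ℝ) (P A B : Plane) {s t : ℝ} (h : s + t = 1) :
    cY u v P (s • A + t • B) = s * cY u v P A + t * cY u v P B := by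
  simp only [cY, PiLp.add_apply, PiLp.smul_apply, smul_eq_mul]
  linear_combination (P 1 * u - P 0 * v) * h

lemma cX_self (u v : ℝ) (P : Plane) : cX u v P P = 0 := by simp [cX]
lemma cY_self (u v : ℝ) (P : Plane) : cY u v P P = 0 := by simp [cY]

lemma c_dist {u v : ℝ} (h : u ^ 2 + v ^ 2 = 1) (P A B : Plane) :
    dist A B ^ 2 = (cX u v P A - cX u v P B) ^ 2 + (cY u v P A - cY u v P B) ^ 2 := by
  rw [EuclideanSpace.dist_eq, Real.sq_sqrt (by positivity)]
  simp only [Fin.sum_univ_two, Real.dist_eq, sq_abs, cX, cY]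
  linear_combination (-(A 0 - B 0) ^ 2 - (A 1 - B 1) ^ 2) * h

lemma cX_cont (u v : ℝ) (P : Plane) : Continuous (cX u v P) := by
  unfold cX; fun_prop
lemma cY_cont (u v : ℝ) (P : Plane) : Continuous (cY u v P) := by
  unfold cY; fun_prop

lemma ray_hits {K : Set Plane} (hK : IsCompact K) {R w : Plane} (hR : R ∈ interior K)
    (hw : w ≠ 0) : ∃ τ : ℝ, 0 < τ ∧ R + τ • w ∈ frontier K := by
  by_contra hcon
  push Not at hcon
  have hclosed := hK.isClosed
  set f : ℝ → Plane := fun τ => R + τ • w with hf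
  have hcf : Continuous f := by fun_prop
  have hpre : IsPreconnected (f '' Ici 0) := isPreconnected_Ici.image f hcf.continuousOn
  have hcov : f '' Ici 0 ⊆ interior K ∪ Kᶜ := by
    rintro _ ⟨τ, hτ, rfl⟩
    rcases (mem_Ici.1 hτ).eq_or_lt with h0 | h0
    · left; simpa [hf, ← h0] using hR
    · by_cases hin : f τ ∈ K
      · left
        by_contra hni
        exact hcon τ h0 (by rw [hclosed.frontier_eq]; exact ⟨hin, hni⟩)
      · right; exact hin
  obtain ⟨M, hM⟩ := hK.isBounded.exists_norm_le
  have hwn : 0 < ‖w‖ := norm_pos_iff.2 hw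
  have hout : ∃ x ∈ f '' Ici 0, x ∈ Kᶜ := by
    refine ⟨f ((|M| + ‖R‖ + 1) / ‖w‖), ⟨_, by simp only [mem_Ici]; positivity, rfl⟩, fun hin => ?_⟩
    have h1 := hM _ hin
    have h2 : ‖((|M| + ‖R‖ + 1) / ‖w‖) • w‖ = |M| + ‖R‖ + 1 := by
      rw [norm_smul, Real.norm_of_nonneg (by positivity)]; field_simp
    have h3 := norm_sub_norm_le (((|M| + ‖R‖ + 1) / ‖w‖) • w) (-R)
    rw [sub_neg_eq_add, norm_neg, add_comm _ R, h2] at h3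
    simp only [hf] at h1
    linarith [le_abs_self M]
  obtain ⟨x, hx, hxo⟩ := hout
  obtain ⟨y, -, hy1, hy2⟩ := hpre _ _ isOpen_interior hclosed.isOpen_compl hcov
    ⟨R, ⟨0, by simp, by simp [hf]⟩, hR⟩ ⟨x, hx, hxo⟩
  exact hy2 (interior_subset hy1)

lemma ray_unique_s8 {K : Set Plane} (hc : Convex ℝ K) {R A : Plane}
    (hR : R ∈ interior K) (hA : A ∈ frontier K) {τ : ℝ} (h0 : 0 < τ) (h1 : τ < 1)
    (hB : (1 - τ) • R + τ • A ∈ frontier K) : False := by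
  have hAK : A ∈ closure K := frontier_subset_closure hA
  have := hc.openSegment_interior_closure_subset_interior hR hAK
    ⟨1 - τ, τ, by linarith, h0, by ring, rfl⟩
  exact hB.2 this

lemma chord_step {K : Set Plane} (hK : IsCompact K) {u v : ℝ} (h : u ^ 2 + v ^ 2 = 1)
    {P R V₁ V₂ A : Plane} {a b c : ℝ} (hac : a < c) (hcb : c < b)
    (hRx : cX u v P R = c) (hRy : cY u v P R = 0)
    (h1x : cX u v P V₁ = a) (h1y : cY u v P V₁ = 0)
    (h2x : cX u v P V₂ = b) (h2y : cY u v P V₂ = 0)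
    (hR : R ∈ interior K) (hch : IsChordalPoint (fun a b => a * b) (frontier K) R)
    (hV1 : V₁ ∈ frontier K) (hV2 : V₂ ∈ frontier K) (hA : A ∈ frontier K)
    (hyA : cY u v P A ≠ 0) :
    ∃ B ∈ frontier K, cY u v P B ≠ 0 ∧
      ((cX u v P B - a) * (cX u v P B - b) + cY u v P B ^ 2) / cY u v P B =
      ((cX u v P A - a) * (cX u v P A - b) + cY u v P A ^ 2) / cY u v P A ∧
      ((cX u v P B - a) ^ 2 + cY u v P B ^ 2) / ((cX u v P B - b) ^ 2 + cY u v P B ^ 2) =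
      ((a - c) / (b - c)) ^ 2 /
        (((cX u v P A - a) ^ 2 + cY u v P A ^ 2) / ((cX u v P A - b) ^ 2 + cY u v P A ^ 2)) := by
  obtain ⟨k, hk⟩ := hch
  have hRA : R - A ≠ 0 := by
    intro h0
    rw [sub_eq_zero] at h0
    exact hyA (h0 ▸ hRy)
  obtain ⟨τ, hτ, hB⟩ := ray_hits hK hR hRA
  have hBe : R + τ • (R - A) = (1 + τ) • R + (-τ) • A := by module
  rw [hBe] at hB
  set B := (1 + τ) • R + (-τ) • A with hBdef
  have hBx : cX u v P B = c + τ * (c - cX u v P A) := by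
    rw [hBdef, cX_aff _ _ _ _ _ (by ring), hRx]; ring
  have hBy : cY u v P B = -τ * cY u v P A := by
    rw [hBdef, cY_aff _ _ _ _ _ (by ring), hRy]; ring
  have hseg : R ∈ openSegment ℝ A B := by
    refine ⟨τ / (1 + τ), 1 / (1 + τ), by positivity, by positivity, by field_simp; ring, ?_⟩
    rw [hBdef, smul_add, smul_smul, smul_smul]
    have e1 : 1 / (1 + τ) * (1 + τ) = 1 := by field_simp
    have e2 : 1 / (1 + τ) * (-τ) = - (τ / (1 + τ)) := by field_simp
    rw [e1, e2]; module
  have hsegV : R ∈ openSegment ℝ V₁ V₂ := by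
    have hba : 0 < b - a := by linarith
    refine ⟨(b - c) / (b - a), (c - a) / (b - a), div_pos (by linarith) hba,
      div_pos (by linarith) hba, by field_simp; ring, ?_⟩
    have hs : (b - c) / (b - a) + (c - a) / (b - a) = 1 := by field_simp; ring
    apply c_ext h (P := P)
    · rw [cX_aff _ _ _ _ _ hs, h1x, h2x, hRx]; field_simp; ring
    · rw [cY_aff _ _ _ _ _ hs, h1y, h2y, hRy]; ring
  have k1 := hk A B hA hB hseg
  have k2 := hk V₁ V₂ hV1 hV2 hsegV
  simp only at k1 k2
  have d1 : dist V₁ R = c - a := by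
    have := c_dist h P V₁ R
    rw [h1x, h1y, hRx, hRy] at this
    rw [← sq_eq_sq₀ dist_nonneg (by linarith)]; rw [this]; ring
  have d2 : dist V₂ R = b - c := by
    have := c_dist h P V₂ R
    rw [h2x, h2y, hRx, hRy] at this
    rw [← sq_eq_sq₀ dist_nonneg (by linarith)]; rw [this]; ring
  have dA := c_dist h P A R
  have dB : dist B R = τ * dist A R := by
    have := c_dist h P B R
    rw [← sq_eq_sq₀ dist_nonneg (by positivity), this, mul_pow, dA, hBx, hBy, hRx, hRy]; ring
  rw [hRx, hRy] at dA
  have key : τ * ((cX u v P A - c) ^ 2 + cY u v P A ^ 2) = (c - a) * (b - c) := by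
    rw [dB] at k1; rw [d1, d2] at k2
    linear_combination k1 - k2 - τ * dA
  refine ⟨B, hB, by rw [hBy]; exact mul_ne_zero (by linarith) hyA, ?_, ?_⟩
  · rw [hBx, hBy]
    generalize cX u v P A = x at *
    generalize cY u v P A = y at *
    field_simp
    linear_combination (-τ - 1) * key
  · rw [hBx, hBy]
    generalize cX u v P A = x at *
    generalize cY u v P A = y at *
    have e1 : (b - c) * ((c + τ * (c - x) - a) ^ 2 + (-τ * y) ^ 2) =
        -τ * (a - c) * ((x - b) ^ 2 + y ^ 2) := by
      linear_combination ((b - c) * τ + (a - c)) * key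
    have e2 : (a - c) * ((c + τ * (c - x) - b) ^ 2 + (-τ * y) ^ 2) =
        -τ * (b - c) * ((x - a) ^ 2 + y ^ 2) := by
      linear_combination ((a - c) * τ + (b - c)) * key
    have p1 : 0 < (x - a) ^ 2 + y ^ 2 := by positivity
    have p2 : 0 < (x - b) ^ 2 + y ^ 2 := by positivity
    have p3 : 0 < (c + τ * (c - x) - b) ^ 2 + (-τ * y) ^ 2 := by
      have : -τ * y ≠ 0 := mul_ne_zero (by linarith) hyA
      positivity
    generalize (c + τ * (c - x) - b) ^ 2 + (-τ * y) ^ 2 = D4 at *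
    generalize (c + τ * (c - x) - a) ^ 2 + (-τ * y) ^ 2 = D3 at *
    generalize (x - b) ^ 2 + y ^ 2 = D2 at *
    generalize (x - a) ^ 2 + y ^ 2 = D1 at *
    have hbc : b - c ≠ 0 := by linarith
    have hac' : a - c ≠ 0 := by linarith
    rw [div_div_eq_mul_div, div_eq_div_iff p3.ne' p1.ne', div_pow]
    field_simp
    have : (a - c) * (D3 * D1 * (b - c) ^ 2 - D4 * (a - c) ^ 2 * D2) = 0 := by
      linear_combination (a - c) * (b - c) * D1 * e1 - (a - c) ^ 2 * D2 * e2
    rcases mul_eq_zero.1 this with h | h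
    · exact absurd h hac'
    · linear_combination h

/-- the circle parameter -/
def cT (u v : ℝ) (P : Plane) (a b : ℝ) (A : Plane) : ℝ :=
  ((cX u v P A - a) * (cX u v P A - b) + cY u v P A ^ 2) / cY u v P A

/-- the squared distance ratio -/
def cR (u v : ℝ) (P : Plane) (a b : ℝ) (A : Plane) : ℝ :=
  ((cX u v P A - a) ^ 2 + cY u v P A ^ 2) / ((cX u v P A - b) ^ 2 + cY u v P A ^ 2)

open Filter Topology

set_option maxHeartbeats 1600000 in
lemma core1 {K : Set Plane} {u v : ℝ} (h : u ^ 2 + v ^ 2 = 1)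
    {P Q V₁ V₂ : Plane} {a b q : ℝ} (ha : a < 0) (hq : 0 < q) (hqb : q < b)
    (hQx : cX u v P Q = q) (hQy : cY u v P Q = 0)
    (h1x : cX u v P V₁ = a) (h1y : cY u v P V₁ = 0)
    (h2x : cX u v P V₂ = b) (h2y : cY u v P V₂ = 0)
    (hS : IsAnalyticSolution (fun a b => a * b) P Q V₁ V₂ K) :
      ∃ O : Plane, ∃ ρ : ℝ, 0 < ρ ∧ frontier K = Metric.sphere O ρ ∧
        V₁ ∈ Metric.sphere O ρ ∧ V₂ ∈ Metric.sphere O ρ := by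
  obtain ⟨hK, hc, -, hP, hQ, hPc, hQc, hax, han⟩ := hS
  have hV1 : V₁ ∈ frontier K := by
    have : V₁ ∈ ({V₁, V₂} : Set Plane) := by simp
    rw [← hax] at this; exact this.2
  have hV2 : V₂ ∈ frontier K := by
    have : V₂ ∈ ({V₁, V₂} : Set Plane) := by simp
    rw [← hax] at this; exact this.2
  have hPx := cX_self u v P
  have hPy := cY_self u v P
  -- points on the axis
  have haxis : ∀ A ∈ frontier K, cY u v P A = 0 → A = V₁ ∨ A = V₂ := by
    intro A hA hy
    have : A ∈ (affineSpan ℝ ({P, Q} : Set Plane) : Set Plane) ∩ frontier K := by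
      refine ⟨?_, hA⟩
      have : A = AffineMap.lineMap P Q (cX u v P A / q) := by
        rw [AffineMap.lineMap_apply_module]
        apply c_ext h (P := P)
        · rw [cX_aff _ _ _ _ _ (by ring), hPx, hQx]; field_simp; ring
        · rw [cY_aff _ _ _ _ _ (by ring), hPy, hQy, hy]; ring
      rw [this]
      exact AffineMap.lineMap_mem_affineSpan_pair _ _ _
    rw [hax] at this
    simpa using this
  -- the contraction
  set μ : ℝ := (a / b) ^ 2 / ((a - q) / (b - q)) ^ 2 with hμ
  have hμ0 : 0 ≤ μ := by positivity
  have hμ1 : μ < 1 := by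
    have h1 : ((a - q) / (b - q)) ^ 2 = ((q - a) / (b - q)) ^ 2 := by ring
    have h2 : (a / b) ^ 2 = (-a / b) ^ 2 := by ring
    have hp : 0 < (q - a) / (b - q) := div_pos (by linarith) (by linarith)
    rw [hμ, h1, h2, div_lt_one (by positivity)]
    have hb : 0 < b := by linarith
    apply pow_lt_pow_left₀ _ (div_nonneg (by linarith) hb.le) (by norm_num)
    rw [div_lt_div_iff₀ hb (by linarith)]
    nlinarith
  have hiter : ∀ A ∈ frontier K, cY u v P A ≠ 0 → ∀ n : ℕ, ∃ B ∈ frontier K, cY u v P B ≠ 0 ∧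
      cT u v P a b B = cT u v P a b A ∧ cR u v P a b B = μ ^ n * cR u v P a b A := by
    intro A hA hy n
    induction n with
    | zero => exact ⟨A, hA, hy, rfl, by simp⟩
    | succ n ih =>
      obtain ⟨B, hB, hyB, hTB, hRB⟩ := ih
      obtain ⟨C, hC, hyC, hTC, hRC⟩ := chord_step hK h (by linarith) hqb hQx hQy h1x h1y h2x h2y
        hQ hQc hV1 hV2 hB hyB
      obtain ⟨D, hD, hyD, hTD, hRD⟩ := chord_step hK h ha (by linarith) hPx hPy h1x h1y h2x h2y
        hP hPc hV1 hV2 hC hyC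
      refine ⟨D, hD, hyD, (hTD.trans hTC).trans hTB, ?_⟩
      change cR u v P a b C = _ / cR u v P a b B at hRC
      change cR u v P a b D = _ / cR u v P a b C at hRD
      rw [hRD, hRC, div_div_eq_mul_div, hRB, pow_succ, hμ]
      simp only [sub_zero]
      ring
  -- analytic parametrization at V₁
  obtain ⟨ε, hε, γ, hγ, hγ0, hγd, U, hU, hV1U, himg⟩ := han V₁ hV1
  have h0mem : (0 : ℝ) ∈ Ioo (-ε) ε := ⟨by linarith, hε⟩
  have hγa : AnalyticAt ℝ γ 0 := hγ 0 h0mem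
  have hγfr : ∀ s ∈ Ioo (-ε) ε, γ s ∈ frontier K := fun s hs =>
    (himg ▸ mem_image_of_mem γ hs : γ s ∈ frontier K ∩ U).1
  have hγD : HasDerivAt γ (deriv γ 0) 0 := hγa.differentiableAt.hasDerivAt
  set w := deriv γ 0 with hw
  have hγ0D : HasDerivAt (fun s => γ s 0) (w 0) 0 := by
    have := (hasDerivAt_pi.1 ((PiLp.continuousLinearEquiv 2 ℝ (fun _ : Fin 2 => ℝ)).hasFDerivAt.comp_hasDerivAt 0 hγD)) 0
    simpa using this
  have hγ1D : HasDerivAt (fun s => γ s 1) (w 1) 0 := by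
    have := (hasDerivAt_pi.1 ((PiLp.continuousLinearEquiv 2 ℝ (fun _ : Fin 2 => ℝ)).hasFDerivAt.comp_hasDerivAt 0 hγD)) 1
    simpa using this
  have hγ0A : AnalyticAt ℝ (fun s => γ s 0) 0 :=
    ((EuclideanSpace.proj (𝕜 := ℝ) (0 : Fin 2)).analyticAt _).comp hγa
  have hγ1A : AnalyticAt ℝ (fun s => γ s 1) 0 :=
    ((EuclideanSpace.proj (𝕜 := ℝ) (1 : Fin 2)).analyticAt _).comp hγa
  set X : ℝ → ℝ := fun s => cX u v P (γ s) with hX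
  set Y : ℝ → ℝ := fun s => cY u v P (γ s) with hY
  set x' : ℝ := w 0 * u + w 1 * v with hx'
  set y' : ℝ := w 1 * u - w 0 * v with hy'
  have hXA : AnalyticAt ℝ X 0 := by
    simp only [hX, cX]; fun_prop
  have hYA : AnalyticAt ℝ Y 0 := by
    simp only [hY, cY]; fun_prop
  have hXD : HasDerivAt X x' 0 :=
    ((hγ0D.sub_const (P 0)).mul_const u).add ((hγ1D.sub_const (P 1)).mul_const v)
  have hYD : HasDerivAt Y y' 0 :=
    ((hγ1D.sub_const (P 1)).mul_const u).sub ((hγ0D.sub_const (P 0)).mul_const v)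
  have hX0 : X 0 = a := by simp only [hX, hγ0, h1x]
  have hY0 : Y 0 = 0 := by simp only [hY, hγ0, h1y]
  -- transversality
  have hy'0 : y' ≠ 0 := by
    intro hy0
    have hx'0 : x' ≠ 0 := by
      intro hx0
      apply hγd
      ext i
      fin_cases i
      · show w 0 = 0
        linear_combination u * (hx'.symm.trans hx0) - v * (hy'.symm.trans hy0) - (w 0) * h
      · show w 1 = 0
        linear_combination v * (hx'.symm.trans hx0) + u * (hy'.symm.trans hy0) - (w 1) * h
    -- w = κ (P - V₁)
    set κ := x' / (-a) with hκ
    have hκ0 : κ ≠ 0 := div_ne_zero hx'0 (by linarith)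
    have hslope := hγD.tendsto_slope_zero
    have hw0 : κ⁻¹ • w = P - V₁ := by
      have e0 : V₁ 0 - P 0 = a * u := by
        simp only [cX, cY] at h1x h1y
        linear_combination u * h1x - v * h1y - (V₁ 0 - P 0) * h
      have e1 : V₁ 1 - P 1 = a * v := by
        simp only [cX, cY] at h1x h1y
        linear_combination v * h1x + u * h1y - (V₁ 1 - P 1) * h
      have f0 : w 0 = x' * u := by
        rw [hx']; linear_combination (-v) * (hy'.symm.trans hy0) - (w 0) * h
      have f1 : w 1 = x' * v := by
        rw [hx']; linear_combination u * (hy'.symm.trans hy0) - (w 1) * h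
      have hane := ha.ne
      ext i
      fin_cases i
      · show κ⁻¹ * w 0 = P 0 - V₁ 0
        rw [f0, hκ]; field_simp; linear_combination e0
      · show κ⁻¹ * w 1 = P 1 - V₁ 1
        rw [f1, hκ]; field_simp; linear_combination e1
    have hZ : Tendsto (fun t : ℝ => V₁ + κ⁻¹ • (t⁻¹ • (γ (0 + t) - γ 0))) (𝓝[≠] 0) (𝓝 P) := by
      have := (hslope.const_smul κ⁻¹).const_add V₁
      rw [hw0] at this
      simpa using this
    have hZin := hZ.eventually (isOpen_interior.mem_nhds hP)
    have hsgn : ∃ᶠ t in 𝓝[≠] (0 : ℝ), 0 < t * κ ∧ t * κ < 1 := by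
      have ht : Tendsto (fun c : ℝ => c / κ) (𝓝[>] 0) (𝓝[≠] 0) := by
        apply tendsto_nhdsWithin_of_tendsto_nhds_of_eventually_within
        · have : Continuous (fun c : ℝ => c / κ) := by fun_prop
          simpa using (this.tendsto 0).mono_left nhdsWithin_le_nhds
        · filter_upwards [self_mem_nhdsWithin] with c hc
          exact div_ne_zero (ne_of_gt hc) hκ0
      refine ht.frequently (Eventually.frequently ?_)
      filter_upwards [Ioo_mem_nhdsGT (zero_lt_one' ℝ)] with c hc
      rw [div_mul_cancel₀ _ hκ0]
      exact hc
    have hIoo : ∀ᶠ t in 𝓝[≠] (0 : ℝ), t ∈ Ioo (-ε) ε :=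
      nhdsWithin_le_nhds (isOpen_Ioo.mem_nhds h0mem)
    obtain ⟨t, ⟨ht0, ht1⟩, htZ, htI⟩ := (hsgn.and_eventually (hZin.and hIoo)).exists
    have ht' : t ≠ 0 := by rintro rfl; simp at ht0
    apply (hγfr t htI).2
    have := hc.openSegment_interior_closure_subset_interior htZ (frontier_subset_closure hV1)
      ⟨t * κ, 1 - t * κ, ht0, by linarith, by ring, rfl⟩
    convert this using 1
    rw [zero_add, hγ0, smul_add, smul_smul, smul_smul]
    have : t * κ * (κ⁻¹ * t⁻¹) = 1 := by field_simp
    rw [← mul_assoc] at this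
    rw [this]
    module
  set L := x' * (a - b) / y' with hL
  have hlim : Tendsto (fun s => ((X s - a) * (X s - b) + Y s ^ 2) / Y s) (𝓝[≠] 0) (𝓝 L) := by
    have hD : HasDerivAt (fun s => (X s - a) * (X s - b) + Y s ^ 2) (x' * (a - b)) 0 := by
      have := ((hXD.sub_const a).mul (hXD.sub_const b)).add (hYD.pow 2)
      have e : x' * (X 0 - b) + (X 0 - a) * x' + ((2 : ℕ) : ℝ) * Y 0 ^ (2 - 1) * y' = x' * (a - b) := by
        rw [hX0, hY0]; simp
      rw [e] at this
      exact this
    have h1 := hD.tendsto_slope_zero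
    have h2 := hYD.tendsto_slope_zero
    refine (h1.div h2 hy'0).congr' ?_
    filter_upwards [self_mem_nhdsWithin] with s hs
    have hs : s ≠ 0 := hs
    simp only [zero_add, hX0, hY0, smul_eq_mul]
    simp
    rw [mul_div_mul_left _ _ (inv_ne_zero hs)]
  have hslopeA : AnalyticAt ℝ (fun s => Y s / X s) 0 := hYA.div hXA (by rw [hX0]; exact ha.ne)
  have hslopeD : deriv (fun s => Y s / X s) 0 ≠ 0 := by
    have hdd : HasDerivAt (fun s => Y s / X s) _ 0 := hYD.div hXD (by rw [hX0]; exact ha.ne)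
    rw [hdd.deriv, hX0, hY0]
    simp only [zero_mul, sub_zero]
    exact div_ne_zero (mul_ne_zero hy'0 ha.ne) (pow_ne_zero _ ha.ne)
  have hmap := hslopeA.hasStrictDerivAt.map_nhds_eq hslopeD
  have hT : ∀ A ∈ frontier K, cY u v P A ≠ 0 → cT u v P a b A = L := by
    intro A hA hy
    by_contra hne
    have hN1 : ∀ᶠ s in 𝓝 (0 : ℝ), s ≠ 0 → ((X s - a) * (X s - b) + Y s ^ 2) / Y s ≠ cT u v P a b A := by
      have := hlim.eventually_ne (Ne.symm hne)
      rwa [eventually_nhdsWithin_iff] at this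
    have hN2 : ∀ᶠ s in 𝓝 (0 : ℝ), X s < 0 :=
      hXA.continuousAt.eventually_lt_const (by rw [hX0]; exact ha)
    have hN3 : ∀ᶠ s in 𝓝 (0 : ℝ), s ∈ Ioo (-ε) ε := isOpen_Ioo.mem_nhds h0mem
    have himage := image_mem_map (m := fun s => Y s / X s) (hN1.and (hN2.and hN3))
    rw [hmap] at himage
    simp only [hY0, zero_div] at himage
    choose B hBf hBy hBT hBR using hiter A hA hy
    have hBlim : Tendsto (fun n => cR u v P a b (B n)) atTop (𝓝 0) := by
      simp only [hBR]
      simpa using (tendsto_pow_atTop_nhds_zero_of_lt_one hμ0 hμ1).mul_const (cR u v P a b A)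
    have hcont : Continuous (fun A => (cX u v P A - b) ^ 2 + cY u v P A ^ 2) := by
      have := cX_cont u v P
      have := cY_cont u v P
      fun_prop
    obtain ⟨M, hM⟩ := (hK.image hcont).bddAbove
    have hMB : ∀ n, (cX u v P (B n) - b) ^ 2 + cY u v P (B n) ^ 2 ≤ M := fun n =>
      hM ⟨B n, hK.isClosed.frontier_subset (hBf n), rfl⟩
    have hD1 : Tendsto (fun n => (cX u v P (B n) - a) ^ 2 + cY u v P (B n) ^ 2) atTop (𝓝 0) := by
      refine squeeze_zero (fun n => by positivity) (fun n => ?_) (by simpa using hBlim.mul_const M)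
      have hpos : 0 < (cX u v P (B n) - b) ^ 2 + cY u v P (B n) ^ 2 := by
        have := hBy n; positivity
      calc _ = cR u v P a b (B n) * ((cX u v P (B n) - b) ^ 2 + cY u v P (B n) ^ 2) := by
            rw [cR, div_mul_cancel₀ _ hpos.ne']
        _ ≤ _ := mul_le_mul_of_nonneg_left (hMB n) (by unfold cR; positivity)
    have hXl : Tendsto (fun n => cX u v P (B n)) atTop (𝓝 a) := by
      have h1 : Tendsto (fun n => (cX u v P (B n) - a) ^ 2) atTop (𝓝 0) :=
        squeeze_zero (fun n => by positivity) (fun n => by nlinarith [sq_nonneg (cY u v P (B n))]) hD1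
      have h2 : Tendsto (fun n => |cX u v P (B n) - a|) atTop (𝓝 0) := by
        simpa [Real.sqrt_sq_eq_abs] using h1.sqrt
      have h3 := (tendsto_zero_iff_abs_tendsto_zero _).2 h2
      simpa using h3.add_const a
    have hYl : Tendsto (fun n => cY u v P (B n)) atTop (𝓝 0) := by
      have h1 : Tendsto (fun n => (cY u v P (B n)) ^ 2) atTop (𝓝 0) :=
        squeeze_zero (fun n => by positivity) (fun n => by nlinarith [sq_nonneg (cX u v P (B n) - a)]) hD1
      have h2 : Tendsto (fun n => |cY u v P (B n)|) atTop (𝓝 0) := by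
        simpa [Real.sqrt_sq_eq_abs] using h1.sqrt
      exact (tendsto_zero_iff_abs_tendsto_zero _).2 h2
    have hsl : Tendsto (fun n => cY u v P (B n) / cX u v P (B n)) atTop (𝓝 0) := by
      have := hYl.div hXl ha.ne
      rw [zero_div] at this
      exact this
    obtain ⟨n, hn1, hn2⟩ := ((hsl.eventually himage).and (hXl.eventually_lt_const ha)).exists
    obtain ⟨s, ⟨hs1, hs2, hs3⟩, hs4⟩ := hn1
    simp only at hs4
    have hBs : B n = γ s := by
      have hγs := hγfr s hs3
      have hXs : X s ≠ 0 := hs2.ne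
      have hτ : 0 < cX u v P (B n) / X s := div_pos_of_neg_of_neg hn2 hs2
      have hτx : cX u v P (B n) / X s * X s = cX u v P (B n) := div_mul_cancel₀ _ hXs
      have hτy : cX u v P (B n) / X s * Y s = cY u v P (B n) := by
        have : cX u v P (B n) ≠ 0 := hn2.ne
        field_simp at hs4
        field_simp
        linear_combination hs4
      generalize cX u v P (B n) / X s = τ at hτ hτx hτy
      have hBeq : B n = (1 - τ) • P + τ • γ s := by
        apply c_ext h (P := P)
        · rw [cX_aff _ _ _ _ _ (by ring), hPx, ← hτx]; simp [hX]
        · rw [cY_aff _ _ _ _ _ (by ring), hPy, ← hτy]; simp [hY]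
      rcases lt_trichotomy τ 1 with h1 | h1 | h1
      · exact (ray_unique_s8 hc hP hγs hτ h1 (hBeq ▸ hBf n)).elim
      · rw [hBeq, h1]; simp
      · refine (ray_unique_s8 hc hP (hBf n) (inv_pos.2 hτ) (inv_lt_one_of_one_lt₀ h1) ?_).elim
        have : (1 - τ⁻¹) • P + τ⁻¹ • B n = γ s := by
          rw [hBeq, smul_add, smul_smul, smul_smul, inv_mul_cancel₀ hτ.ne']
          have e : τ⁻¹ * (1 - τ) = -(1 - τ⁻¹) := by field_simp; ring
          rw [e]; module
        rw [this]; exact hγs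
    have hs0 : s ≠ 0 := by
      rintro rfl
      exact hBy n (by rw [hBs, hγ0, h1y])
    apply hs1 hs0
    rw [← hBT n, hBs]
    rfl
  have hF : ∀ A ∈ frontier K, (cX u v P A - a) * (cX u v P A - b) + cY u v P A ^ 2 =
      L * cY u v P A := by
    intro A hA
    by_cases hy : cY u v P A = 0
    · rcases haxis A hA hy with rfl | rfl
      · rw [h1x, h1y]; ring
      · rw [h2x, h2y]; ring
    · rw [← hT A hA hy, cT]; field_simp
  set O := cPt u v P ((a + b) / 2) (L / 2) with hO
  set ρ := Real.sqrt (((b - a) / 2) ^ 2 + (L / 2) ^ 2) with hρ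
  have hba : 0 < (b - a) / 2 := by linarith
  have hρ0 : 0 < ρ := Real.sqrt_pos.2 (by positivity)
  have hsph : ∀ A : Plane, A ∈ Metric.sphere O ρ ↔
      (cX u v P A - a) * (cX u v P A - b) + cY u v P A ^ 2 = L * cY u v P A := by
    intro A
    rw [Metric.mem_sphere, ← sq_eq_sq₀ dist_nonneg hρ0.le, c_dist h P, hρ,
      Real.sq_sqrt (by positivity), hO, cX_pt h, cY_pt h]
    constructor
    · intro h; linear_combination h
    · intro h; linear_combination h
  refine ⟨O, ρ, hρ0, ?_, (hsph _).2 (hF _ hV1), (hsph _).2 (hF _ hV2)⟩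
  apply Subset.antisymm (fun A hA => (hsph A).2 (hF A hA))
  intro A hA
  rw [hsph] at hA
  have hAP : A - P ≠ 0 := by
    intro h0
    rw [sub_eq_zero] at h0
    rw [h0, hPx, hPy] at hA
    have h4 : a * b < 0 := mul_neg_of_neg_of_pos ha (by linarith)
    have h5 : a * b = 0 := by linear_combination hA
    exact h4.ne h5
  obtain ⟨τ, hτ, hB⟩ := ray_hits hK hP hAP
  have hBe : P + τ • (A - P) = (1 - τ) • P + τ • A := by module
  have hFB := hF _ hB
  rw [hBe, cX_aff _ _ _ _ _ (by ring), cY_aff _ _ _ _ _ (by ring), hPx, hPy] at hFB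
  have h1 : (τ - 1) * (τ * (cX u v P A ^ 2 + cY u v P A ^ 2) - a * b) = 0 := by
    linear_combination hFB - τ * hA
  have hb : 0 < b := by linarith
  have hpos : 0 < τ * (cX u v P A ^ 2 + cY u v P A ^ 2) - a * b := by
    have h3 : 0 ≤ τ * (cX u v P A ^ 2 + cY u v P A ^ 2) := by positivity
    have h4 : a * b < 0 := mul_neg_of_neg_of_pos ha hb
    linarith
  have : τ = 1 := by
    rcases mul_eq_zero.1 h1 with h | h <;> linarith
  subst this
  simpa using hB

lemma sphere_chordal (O : Plane) (ρ : ℝ) (R : Plane) :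
    IsChordalPoint (fun a b => a * b) (Metric.sphere O ρ) R := by
  refine ⟨ρ ^ 2 - dist R O ^ 2, ?_⟩
  rintro A B hA hB ⟨s, t, hs, ht, hst, rfl⟩
  have h10 : (1 : ℝ) ^ 2 + 0 ^ 2 = 1 := by norm_num
  rw [Metric.mem_sphere] at hA hB
  have hA2 := c_dist h10 O A O
  have hB2 := c_dist h10 O B O
  rw [hA, cX_self, cY_self] at hA2
  rw [hB, cX_self, cY_self] at hB2
  have hR2 := c_dist h10 O (s • A + t • B) O
  have hAB := c_dist h10 O A B
  have dA : dist A (s • A + t • B) = t * dist A B := by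
    rw [← sq_eq_sq₀ dist_nonneg (by positivity), mul_pow, hAB, c_dist h10 O,
      cX_aff _ _ _ _ _ hst, cY_aff _ _ _ _ _ hst]
    obtain rfl : s = 1 - t := by linarith
    ring
  have dB : dist B (s • A + t • B) = s * dist A B := by
    rw [← sq_eq_sq₀ dist_nonneg (by positivity), mul_pow, hAB, c_dist h10 O,
      cX_aff _ _ _ _ _ hst, cY_aff _ _ _ _ _ hst]
    obtain rfl : t = 1 - s := by linarith
    ring
  simp only
  rw [cX_aff _ _ _ _ _ hst, cY_aff _ _ _ _ _ hst, cX_self, cY_self] at hR2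
  rw [dA, dB, hR2]
  obtain rfl : t = 1 - s := by linarith
  linear_combination s * (1 - s) * hAB - s * hA2 - (1 - s) * hB2

lemma sphere_analytic (O : Plane) {ρ : ℝ} (hρ : 0 < ρ) :
    IsAnalyticBoundary (Metric.sphere O ρ) := by
  intro p hp
  have h10 : (1 : ℝ) ^ 2 + 0 ^ 2 = 1 := by norm_num
  have key : ∀ A : Plane, A ∈ Metric.sphere O ρ ↔ (A 0 - O 0) ^ 2 + (A 1 - O 1) ^ 2 = ρ ^ 2 := by
    intro A
    rw [Metric.mem_sphere, ← sq_eq_sq₀ dist_nonneg hρ.le, c_dist h10 O]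
    simp [cX, cY]
  have hp2 := (key p).1 hp
  set w0 := p 0 - O 0 with hw0
  set w1 := p 1 - O 1 with hw1
  set w : Plane := p - O with hw
  set j : Plane := !₂[-w1, w0] with hj
  have hj0 : j 0 = -w1 := by simp [hj]
  have hj1 : j 1 = w0 := by simp [hj]
  have hw0' : w 0 = w0 := by simp [hw, hw0]
  have hw1' : w 1 = w1 := by simp [hw, hw1]
  have hρ2 : 0 < ρ ^ 2 := by positivity
  have hγd : HasDerivAt (fun s : ℝ => O + (Real.cos s • w + Real.sin s • j)) j 0 := by
    have h1 := (((Real.hasDerivAt_cos 0).smul_const w).add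
      ((Real.hasDerivAt_sin 0).smul_const j)).const_add O
    simp only [Real.sin_zero, neg_zero, zero_smul, Real.cos_zero, one_smul, zero_add] at h1
    exact h1
  refine ⟨4, by norm_num, fun s => O + (Real.cos s • w + Real.sin s • j), ?_, ?_, ?_, univ,
    isOpen_univ, mem_univ _, ?_⟩
  · intro s _
    exact analyticAt_const.add ((Real.analyticAt_cos.smul analyticAt_const).add
      (Real.analyticAt_sin.smul analyticAt_const))
  · simp [hw]
  · rw [hγd.deriv]
    intro h0
    rw [h0] at hj0 hj1
    simp only [PiLp.zero_apply] at hj0 hj1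
    nlinarith
  · rw [inter_univ]
    apply Subset.antisymm
    · rintro _ ⟨s, -, rfl⟩
      rw [key]
      simp only [PiLp.add_apply, PiLp.smul_apply, smul_eq_mul, hj0, hj1, hw0', hw1']
      linear_combination hp2 + (w0 ^ 2 + w1 ^ 2) * Real.sin_sq_add_cos_sq s
    · intro A hA
      rw [key] at hA
      set z : ℂ := ⟨((A 0 - O 0) * w0 + (A 1 - O 1) * w1) / ρ ^ 2,
        ((A 1 - O 1) * w0 - (A 0 - O 0) * w1) / ρ ^ 2⟩ with hz
      have hzn : ‖z‖ = 1 := by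
        rw [← sq_eq_sq₀ (norm_nonneg _) zero_le_one, ← Complex.normSq_eq_norm_sq,
          Complex.normSq_apply, hz]
        simp only
        field_simp
        linear_combination (w0 ^ 2 + w1 ^ 2) * hA + ρ ^ 2 * hp2
      have hz0 : z ≠ 0 := by rw [← norm_ne_zero_iff, hzn]; norm_num
      refine ⟨Complex.arg z, ⟨?_, ?_⟩, ?_⟩
      · linarith [Complex.neg_pi_lt_arg z, Real.pi_lt_four]
      · linarith [Complex.arg_le_pi z, Real.pi_lt_four]
      · simp only
        rw [Complex.cos_arg hz0, Complex.sin_arg, hzn, hz]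
        ext i
        fin_cases i
        · simp only [PiLp.add_apply, PiLp.smul_apply, smul_eq_mul, Fin.zero_eta, hj0, hw0', div_one]
          field_simp
          linear_combination (A 0 - O 0) * hp2
        · simp only [PiLp.add_apply, PiLp.smul_apply, smul_eq_mul, Fin.mk_one, hj1, hw1', div_one]
          field_simp
          linear_combination (A 1 - O 1) * hp2

lemma core2 {u v : ℝ} (h : u ^ 2 + v ^ 2 = 1)
    {P Q V₁ V₂ : Plane} {a b q : ℝ} (ha : a < 0) (hq : 0 < q) (hqb : q < b)
    (hQx : cX u v P Q = q) (hQy : cY u v P Q = 0)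
    (h1x : cX u v P V₁ = a) (h1y : cY u v P V₁ = 0)
    (h2x : cX u v P V₂ = b) (h2y : cY u v P V₂ = 0)
    {O : Plane} {ρ : ℝ} (hρ : 0 < ρ) (hV1 : V₁ ∈ Metric.sphere O ρ)
    (hV2 : V₂ ∈ Metric.sphere O ρ) :
    IsAnalyticSolution (fun a b => a * b) P Q V₁ V₂ (Metric.closedBall O ρ) := by
  have hPx := cX_self u v P
  have hPy := cY_self u v P
  have hba : 0 < b - a := by linarith
  have hV12 : V₁ ≠ V₂ := by
    rintro rfl
    linarith
  have hseg : ∀ R : Plane, a < cX u v P R → cX u v P R < b → cY u v P R = 0 →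
      R ∈ Metric.ball O ρ := by
    intro R h1 h2 h3
    apply openSegment_subset_ball_of_ne (Metric.sphere_subset_closedBall hV1)
      (Metric.sphere_subset_closedBall hV2) hV12
    generalize hc : cX u v P R = c at *
    refine ⟨(b - c) / (b - a), (c - a) / (b - a), div_pos (by linarith) hba,
      div_pos (by linarith) hba, by field_simp; ring, ?_⟩
    have hs : (b - c) / (b - a) + (c - a) / (b - a) = 1 := by field_simp; ring
    apply c_ext h (P := P)
    · rw [cX_aff _ _ _ _ _ hs, h1x, h2x, hc]; field_simp; ring
    · rw [cY_aff _ _ _ _ _ hs, h1y, h2y, h3]; ring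
  have hP := hseg P (by linarith) (by linarith) hPy
  have hQ := hseg Q (by linarith) (by linarith) hQy
  have hint := interior_closedBall O hρ.ne'
  have hfr := frontier_closedBall O hρ.ne'
  have hline : ∀ A : Plane, cY u v P A = 0 →
      A ∈ (affineSpan ℝ ({P, Q} : Set Plane) : Set Plane) := by
    intro A hy
    have : A = AffineMap.lineMap P Q (cX u v P A / q) := by
      rw [AffineMap.lineMap_apply_module]
      apply c_ext h (P := P)
      · rw [cX_aff _ _ _ _ _ (by ring), hPx, hQx]; field_simp; ring
      · rw [cY_aff _ _ _ _ _ (by ring), hPy, hQy, hy]; ring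
    rw [this]
    exact AffineMap.lineMap_mem_affineSpan_pair _ _ _
  refine ⟨isCompact_closedBall _ _, convex_closedBall _ _, ?_, ?_, ?_, ?_, ?_, ?_, ?_⟩
  · rw [hint]; exact ⟨P, hP⟩
  · rw [hint]; exact hP
  · rw [hint]; exact hQ
  · rw [hfr]; exact sphere_chordal _ _ _
  · rw [hfr]; exact sphere_chordal _ _ _
  · rw [hfr]
    apply Subset.antisymm
    · rintro A ⟨hA, hAs⟩
      obtain ⟨r, rfl⟩ := mem_affineSpan_pair_iff_exists_lineMap_eq.1 hA
      rw [AffineMap.lineMap_apply_module] at *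
      set A := (1 - r) • P + r • Q with hAd
      have hAy : cY u v P A = 0 := by
        rw [hAd, cY_aff _ _ _ _ _ (by ring), hPy, hQy]; ring
      rw [Metric.mem_sphere] at hAs hV1 hV2
      have e1 := c_dist h P A O
      have e2 := c_dist h P V₁ O
      have e3 := c_dist h P V₂ O
      rw [hAs, hAy] at e1
      rw [hV1, h1x, h1y] at e2
      rw [hV2, h2x, h2y] at e3
      have e4 : a + b - 2 * cX u v P O = 0 := by
        have : (b - a) * (a + b - 2 * cX u v P O) = 0 := by linear_combination e2 - e3
        rcases mul_eq_zero.1 this with h | h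
        · linarith
        · exact h
      have e5 : (cX u v P A - a) * (cX u v P A - b) = 0 := by
        linear_combination e2 - e1 + (a - cX u v P A) * e4
      rcases mul_eq_zero.1 e5 with h' | h'
      · left; exact c_ext h (by rw [h1x]; linarith) (by rw [hAy, h1y])
      · right; exact c_ext h (by rw [h2x]; linarith) (by rw [hAy, h2y])
    · rintro A (rfl | rfl)
      · exact ⟨hline _ h1y, hV1⟩
      · exact ⟨hline _ h2y, hV2⟩
  · rw [hfr]; exact sphere_analytic O hρ

/-- The circles through `V₁` and `V₂` are exactly the boundaries of the analytic
solutions of the Equiproduct Problem (`F(a,b) = a·b`) with equiproduct points `P, Q`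
and vertices `V₁, V₂`. -/
theorem equiproduct_solutions_are_circles
    (V₁ P Q V₂ : Plane)
    (hne : V₁ ≠ P ∧ V₁ ≠ Q ∧ V₁ ≠ V₂ ∧ P ≠ Q ∧ P ≠ V₂ ∧ Q ≠ V₂)
    (hcol : Collinear ℝ ({V₁, P, Q, V₂} : Set Plane))
    (hPseg : P ∈ openSegment ℝ V₁ Q) (hQseg : Q ∈ openSegment ℝ P V₂) :
    (∀ K : Set Plane, IsAnalyticSolution (fun a b => a * b) P Q V₁ V₂ K →
      ∃ O : Plane, ∃ ρ : ℝ, 0 < ρ ∧ frontier K = Metric.sphere O ρ ∧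
        V₁ ∈ Metric.sphere O ρ ∧ V₂ ∈ Metric.sphere O ρ) ∧
    (∀ (O : Plane) (ρ : ℝ), 0 < ρ → V₁ ∈ Metric.sphere O ρ → V₂ ∈ Metric.sphere O ρ →
      IsAnalyticSolution (fun a b => a * b) P Q V₁ V₂ (Metric.closedBall O ρ)) := by
  have hd : 0 < dist P Q := dist_pos.2 hne.2.2.2.1
  have h10 : (1 : ℝ) ^ 2 + 0 ^ 2 = 1 := by norm_num
  have hd2 := c_dist h10 P Q P
  rw [dist_comm Q P] at hd2
  simp only [cX, cY, mul_one, mul_zero, sub_self, add_zero, zero_mul, sub_zero] at hd2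
  set q := dist P Q with hq
  set u := (Q 0 - P 0) / q with hu
  set v := (Q 1 - P 1) / q with hv
  have h : u ^ 2 + v ^ 2 = 1 := by
    rw [hu, hv]; field_simp; linarith
  have hQx : cX u v P Q = q := by
    rw [cX, hu, hv]; field_simp; linarith
  have hQy : cY u v P Q = 0 := by
    rw [cY, hu, hv]; field_simp; ring
  have hPx := cX_self u v P
  have hPy := cY_self u v P
  obtain ⟨s, t, hs, ht, hst, e⟩ := hPseg
  obtain ⟨s', t', hs', ht', hst', e'⟩ := hQseg
  have e1 := cX_aff u v P V₁ Q hst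
  have e2 := cY_aff u v P V₁ Q hst
  have e3 := cX_aff u v P P V₂ hst'
  have e4 := cY_aff u v P P V₂ hst'
  rw [e, hPx, hQx] at e1
  rw [e, hPy, hQy] at e2
  rw [e', hPx, hQx] at e3
  rw [e', hPy, hQy] at e4
  have h1y : cY u v P V₁ = 0 := by
    rcases mul_eq_zero.1 (show s * cY u v P V₁ = 0 by linarith) with h | h
    · linarith
    · exact h
  have h2y : cY u v P V₂ = 0 := by
    rcases mul_eq_zero.1 (show t' * cY u v P V₂ = 0 by linarith) with h | h
    · linarith
    · exact h
  have ha : cX u v P V₁ < 0 := by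
    by_contra hcon
    push Not at hcon
    have h1 := mul_nonneg hs.le hcon
    have h2 := mul_pos ht hd
    linarith
  have hb : q < cX u v P V₂ := by
    by_contra hcon
    push Not at hcon
    have h1 := mul_le_mul_of_nonneg_left hcon ht'.le
    have h2 := mul_pos hs' hd
    have h3 : s' * q + t' * q = q := by rw [← add_mul, hst', one_mul]
    linarith
  exact ⟨fun K hK => core1 h ha hd hb hQx hQy rfl h1y rfl h2y hK,
    fun O ρ hρ hV1 hV2 => core2 h ha hd hb hQx hQy rfl h1y rfl h2y hρ hV1 hV2⟩
end
end
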